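/- Let P(x) ∈ ℤ[x] be an irreducible polynomial of degree D ≥ 2, and for z ≥ 2 let L_z denote the set of primes l ∈ [z, 2z] such that P has no root modulo l. Then there exists a positive rational number κ, depending only on P, with κ ≤ D!/(D−1), such that #L_z = (1/κ)·(π(2z) − π(z)) + O(z·(log z)^{−2}) as z → ∞. -/

import Mathlib

namespace BeurlingPNT

open MeasureTheory Set Filter Asymptotics
open scoped Topology

/-- The error term in the counting function of a sequence with mean value `c`. -/
noncomputable def errorTerm (a : ℕ → ℝ) (c t : ℝ) : ℝ := ∑ k ∈ Finset.Icc 0 ⌊t⌋₊, a k - c * t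

/-- A nonnegative sequence whose summatory function is `c x + O(x ^ (1 - η))`. -/
structure PowerSaving (a : ℕ → ℝ) (c C η : ℝ) : Prop where
  zero : a 0 = 0
  nonneg : ∀ n, 0 ≤ a n
  η_pos : 0 < η
  η_lt : η < 1
  C_nonneg : 0 ≤ C
  c_nonneg : 0 ≤ c
  bound : ∀ x : ℝ, 1 ≤ x → |errorTerm a c x| ≤ C * x ^ (1 - η)

variable {a : ℕ → ℝ} {c C η : ℝ}

theorem measurable_errorTerm (a : ℕ → ℝ) (c : ℝ) : Measurable (errorTerm a c) :=
  ((measurable_from_nat (f := fun n : ℕ ↦ ∑ k ∈ Finset.Icc 0 n, a k)).comp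
    Nat.measurable_floor).sub (measurable_id.const_mul c)

namespace PowerSaving

theorem norm_errorTerm_mul_cpow_le (h : PowerSaving a c C η) (s : ℂ) {t : ℝ} (ht : 1 ≤ t) :
    ‖(errorTerm a c t : ℂ) * (t : ℂ) ^ (-(s + 1))‖ ≤ C * t ^ (-(η + s.re)) := by
  have ht0 : 0 < t := by linarith
  rw [norm_mul, Complex.norm_cpow_eq_rpow_re_of_pos ht0, Complex.norm_real, Real.norm_eq_abs]
  calc _ ≤ (C * t ^ (1 - η)) * t ^ (-(s + 1)).re := by
        gcongr; exact h.bound t ht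
    _ = _ := by
        rw [mul_assoc, ← Real.rpow_add ht0]; congr 2; simp; ring

theorem integrableOn (h : PowerSaving a c C η) {s : ℂ} (hs : 1 - η < s.re) {N : ℝ} (hN : 1 ≤ N) :
    IntegrableOn (fun t : ℝ ↦ (errorTerm a c t : ℂ) * (t : ℂ) ^ (-(s + 1))) (Ioi N) := by
  have h1 : IntegrableOn (fun t : ℝ ↦ C * t ^ (-(η + s.re))) (Ioi N) :=
    (integrableOn_Ioi_rpow_of_lt (by linarith) (by linarith)).const_mul C
  refine Integrable.mono' h1 ?_ ?_
  · refine AEStronglyMeasurable.mul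
      (Complex.measurable_ofReal.comp (measurable_errorTerm a c)).aestronglyMeasurable ?_
    refine ContinuousOn.aestronglyMeasurable (fun t ht ↦ ContinuousAt.continuousWithinAt ?_)
      measurableSet_Ioi
    exact Complex.continuousAt_ofReal_cpow_const _ _ (Or.inr (by
      have : N < t := ht
      linarith))
  · refine (ae_restrict_iff' measurableSet_Ioi).2 (Eventually.of_forall fun t ht ↦ ?_)
    exact h.norm_errorTerm_mul_cpow_le s (hN.trans (le_of_lt ht))

theorem norm_integral_le (h : PowerSaving a c C η) {s : ℂ} (hs : 1 - η < s.re) {N : ℝ}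
    (hN : 1 ≤ N) :
    ‖∫ t in Ioi N, (errorTerm a c t : ℂ) * (t : ℂ) ^ (-(s + 1))‖
      ≤ C * N ^ (1 - η - s.re) / (η + s.re - 1) := by
  have h1 : IntegrableOn (fun t : ℝ ↦ C * t ^ (-(η + s.re))) (Ioi N) :=
    (integrableOn_Ioi_rpow_of_lt (by linarith) (by linarith)).const_mul C
  refine (norm_integral_le_of_norm_le h1 ?_).trans_eq ?_
  · refine (ae_restrict_iff' measurableSet_Ioi).2 (Eventually.of_forall fun t ht ↦ ?_)
    exact h.norm_errorTerm_mul_cpow_le s (hN.trans (le_of_lt ht))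
  · rw [integral_const_mul, integral_Ioi_rpow_of_lt (by linarith) (by linarith)]
    have : η + s.re - 1 ≠ 0 := by linarith
    have h2 : -(η + s.re) + 1 ≠ 0 := by intro h; apply this; linarith
    rw [show -(η + s.re) + 1 = 1 - η - s.re by ring] at *
    field_simp
    ring

/-- The regular part of the Dirichlet series of a sequence with power-saving counting function. -/
noncomputable def regularPart (a : ℕ → ℝ) (c : ℝ) (s : ℂ) : ℂ :=
  c + s * ∫ t in Ioi (1 : ℝ), (errorTerm a c t : ℂ) * (t : ℂ) ^ (-(s + 1))

theorem isBigO_errorTerm (h : PowerSaving a c C η) :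
    errorTerm a c =O[atTop] fun x ↦ x ^ (1 - η) := by
  refine IsBigO.of_bound C ?_
  filter_upwards [eventually_ge_atTop 1] with x hx
  rw [Real.norm_eq_abs, Real.norm_of_nonneg (by positivity)]
  exact h.bound x hx

theorem differentiableAt_regularPart (h : PowerSaving a c C η) {s : ℂ} (hs : 1 - η < s.re) :
    DifferentiableAt ℂ (regularPart a c) s := by
  set f : ℝ → ℂ := indicator (Ioi 1) (fun t ↦ (errorTerm a c t : ℂ)) with hf
  have key : ∀ s : ℂ, ∫ t in Ioi (1 : ℝ), (errorTerm a c t : ℂ) * (t : ℂ) ^ (-(s + 1))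
      = mellin f (-s) := by
    intro s
    rw [mellin, ← integral_indicator measurableSet_Ioi, ← integral_indicator measurableSet_Ioi]
    congr 1
    ext t
    by_cases ht : 1 < t
    · have : 0 < t := by linarith
      simp only [hf, indicator, mem_Ioi, ht, this, if_true, smul_eq_mul]
      rw [mul_comm]; congr 2; ring
    · simp [hf, indicator, ht]
  have hdiff : DifferentiableAt ℂ (mellin f) (-s) := by
    refine mellin_differentiableAt_of_isBigO_rpow (a := -(1 - η)) (b := (-s).re - 1) ?_ ?_
      (by simp; linarith) ?_ (by linarith)
    · refine LocallyIntegrable.locallyIntegrableOn ?_ _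
      have hm : AEStronglyMeasurable f volume :=
        ((Complex.measurable_ofReal.comp (measurable_errorTerm a c)).indicator
          measurableSet_Ioi).aestronglyMeasurable
      refine (locallyIntegrable_iff).2 fun k hk ↦ ?_
      obtain ⟨B, hB⟩ := hk.isBounded.exists_norm_le
      refine Measure.integrableOn_of_bounded (M := C * (max 1 B) ^ (1 - η)) hk.measure_lt_top.ne
        hm ?_
      refine (ae_restrict_iff' hk.measurableSet).2 (Eventually.of_forall fun t ht ↦ ?_)
      by_cases h1 : 1 < t
      · simp only [hf, indicator, mem_Ioi, h1, if_true, Complex.norm_real, Real.norm_eq_abs]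
        refine (h.bound t h1.le).trans ?_
        have : t ≤ B := (le_abs_self t).trans (hB t ht)
        have h3 := h.C_nonneg
        have h4 := h.η_lt
        gcongr
        exact this.trans (le_max_right _ _)
      · simp only [hf, indicator, mem_Ioi, h1, if_false, norm_zero]
        have h3 := h.C_nonneg
        positivity
    · rw [neg_neg]
      refine IsBigO.trans ?_ h.isBigO_errorTerm
      refine IsBigO.of_bound 1 (Eventually.of_forall fun t ↦ ?_)
      by_cases h1 : 1 < t <;> simp [hf, h1]
    · have : f =ᶠ[𝓝[>] 0] 0 := by
        filter_upwards [mem_nhdsWithin_of_mem_nhds (Iio_mem_nhds (zero_lt_one))] with t ht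
        have : ¬ 1 < t := not_lt.2 (le_of_lt ht)
        simp [hf, this]
      exact this.trans_isBigO (isBigO_zero _ _)
  have : regularPart a c = fun s ↦ (c : ℂ) + s * mellin f (-s) := by
    ext s; rw [regularPart, key]
  rw [this]
  exact (differentiableAt_const _).add (differentiableAt_id.mul
    (DifferentiableAt.comp (g := mellin f) s hdiff differentiableAt_id.neg))

theorem sum_eq (h : PowerSaving a c C η) (n : ℕ) :
    ∑ k ∈ Finset.Icc 1 n, a k = ∑ k ∈ Finset.Icc 0 n, a k := by
  rw [← Finset.insert_Icc_succ_left_eq_Icc (Nat.zero_le n), Finset.sum_insert (by simp), h.zero,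
    zero_add]
  rfl

theorem isBigO_sum (h : PowerSaving a c C η) :
    (fun n : ℕ ↦ ∑ k ∈ Finset.Icc 1 n, a k) =O[atTop] fun n : ℕ ↦ (n : ℝ) ^ (1 : ℝ) := by
  refine IsBigO.of_bound (C + c) ?_
  filter_upwards [eventually_ge_atTop 1] with n hn
  have hn' : (1 : ℝ) ≤ n := by exact_mod_cast hn
  have h1 := h.bound n hn'
  rw [errorTerm, Nat.floor_natCast] at h1
  rw [h.sum_eq, Real.norm_of_nonneg (Finset.sum_nonneg fun _ _ ↦ h.nonneg _), Real.rpow_one,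
    Real.norm_of_nonneg (by positivity)]
  have h2 : (n : ℝ) ^ (1 - η) ≤ n := by
    conv_rhs => rw [← Real.rpow_one (n : ℝ)]
    exact Real.rpow_le_rpow_of_exponent_le hn' (by linarith [h.η_pos])
  have h3 := le_abs_self (∑ k ∈ Finset.Icc 0 n, a k - c * n)
  have := mul_le_mul_of_nonneg_left h2 h.C_nonneg
  linarith

theorem lseriesSummable (h : PowerSaving a c C η) {s : ℂ} (hs : 1 < s.re) :
    LSeriesSummable (fun n ↦ (a n : ℂ)) s :=
  LSeriesSummable_of_sum_norm_bigO_and_nonneg h.isBigO_sum h.nonneg zero_le_one hs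

theorem lseries_eq (h : PowerSaving a c C η) {s : ℂ} (hs : 1 < s.re) :
    LSeries (fun n ↦ (a n : ℂ)) s = c / (s - 1) + regularPart a c s := by
  rw [LSeries_eq_mul_integral_of_nonneg a zero_le_one hs h.isBigO_sum h.nonneg, regularPart]
  have hs1 : s - 1 ≠ 0 := by
    intro h0; have := congrArg Complex.re h0; simp at this; linarith
  have hi : IntegrableOn (fun t : ℝ ↦ (c : ℂ) * (t : ℂ) ^ (-s)) (Ioi 1) :=
    (integrableOn_Ioi_cpow_of_lt (by simpa using hs) zero_lt_one).const_mul _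
  have e1 : ∫ t in Ioi (1 : ℝ), (∑ k ∈ Finset.Icc 1 ⌊t⌋₊, (a k : ℂ)) * (t : ℂ) ^ (-(s + 1))
      = (∫ t in Ioi (1 : ℝ), (errorTerm a c t : ℂ) * (t : ℂ) ^ (-(s + 1)))
        + ∫ t in Ioi (1 : ℝ), (c : ℂ) * (t : ℂ) ^ (-s) := by
    rw [← integral_add (h.integrableOn (by linarith [h.η_pos]) le_rfl) hi]
    refine setIntegral_congr_fun measurableSet_Ioi fun t ht ↦ ?_
    have ht0 : (t : ℂ) ≠ 0 := by
      have : (1 : ℝ) < t := ht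
      exact_mod_cast (by linarith : t ≠ 0)
    have e2 : (t : ℂ) ^ (-s) = t * (t : ℂ) ^ (-(s + 1)) := by
      rw [show -s = 1 + -(s + 1) by ring, Complex.cpow_add _ _ ht0, Complex.cpow_one]
    have e3 := h.sum_eq ⌊t⌋₊
    simp only [errorTerm, ← Complex.ofReal_sum, e3, e2]
    push_cast
    ring
  rw [e1, integral_const_mul, integral_Ioi_cpow_of_lt (by simpa using hs) zero_lt_one]
  have hs2 : -s + 1 ≠ 0 := by intro h0; apply hs1; linear_combination -h0
  simp only [Complex.ofReal_one, Complex.one_cpow]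
  field_simp
  ring

theorem regularPart_eq_truncated (h : PowerSaving a c C η) {s : ℂ} (hs : 1 - η < s.re)
    (hs1 : s ≠ 1) {N : ℝ} (hN : 1 ≤ N) :
    regularPart a c s = c + ((∑ k ∈ Finset.Icc 0 ⌊N⌋₊, (k : ℂ) ^ (-s) * (a k : ℂ))
      - (N : ℂ) ^ (-s) * (∑ k ∈ Finset.Icc 0 ⌊N⌋₊, a k : ℝ)
      - c * s * (((N : ℂ) ^ (1 - s) - 1) / (1 - s)))
      + s * ∫ t in Ioi N, (errorTerm a c t : ℂ) * (t : ℂ) ^ (-(s + 1)) := by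
  have hs0 : s ≠ 0 := by
    rintro rfl
    simp at hs
    linarith [h.η_lt]
  have h0 : (0 : ℝ) ∉ uIcc 1 N := by
    rw [uIcc_of_le hN]; exact fun h ↦ by linarith [h.1]
  have hsplit := setIntegral_union (f := fun t : ℝ ↦ (errorTerm a c t : ℂ) * (t : ℂ) ^ (-(s + 1)))
    (Ioc_disjoint_Ioi (le_refl N) : Disjoint (Ioc 1 N) (Ioi N)) measurableSet_Ioi
    ((h.integrableOn hs le_rfl).mono_set Ioc_subset_Ioi_self) (h.integrableOn hs hN)
  rw [Ioc_union_Ioi_eq_Ioi hN] at hsplit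
  have hder : ∀ t ∈ Icc (1 : ℝ) N, HasDerivAt (fun t : ℝ ↦ (t : ℂ) ^ (-s))
      (-s * (t : ℂ) ^ (-(s + 1))) t := by
    intro t ht
    have := hasDerivAt_ofReal_cpow_const (x := t) (r := -s) (by linarith [ht.1])
      (neg_ne_zero.2 hs0)
    rwa [show -s - 1 = -(s + 1) by ring] at this
  have hic : ∀ w : ℂ, ContinuousOn (fun t : ℝ ↦ (t : ℂ) ^ w) (Icc 1 N) := fun w t ht ↦
    (Complex.continuousAt_ofReal_cpow_const _ _
      (Or.inr (by linarith [ht.1] : t ≠ 0))).continuousWithinAt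
  have habel := sum_mul_eq_sub_integral_mul₀ (f := fun t : ℝ ↦ (t : ℂ) ^ (-s))
    (fun k ↦ (a k : ℂ)) (by simp [h.zero]) N
    (fun t ht ↦ (hder t ht).differentiableAt) (by
      refine IntegrableOn.congr_fun (f := fun t : ℝ ↦ -s * (t : ℂ) ^ (-(s + 1))) ?_
        (fun t ht ↦ (hder t ht).deriv.symm) measurableSet_Icc
      exact ((hic _).const_smul (-s)).integrableOn_Icc)
  have e1 : ∫ t in Ioc (1 : ℝ) N, (errorTerm a c t : ℂ) * (t : ℂ) ^ (-(s + 1))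
      = (∫ t in Ioc (1 : ℝ) N, (∑ k ∈ Finset.Icc 0 ⌊t⌋₊, (a k : ℂ)) * (t : ℂ) ^ (-(s + 1)))
        - ∫ t in Ioc (1 : ℝ) N, (c : ℂ) * (t : ℂ) ^ (-s) := by
    have i1 : IntegrableOn (fun t : ℝ ↦ (c : ℂ) * (t : ℂ) ^ (-s)) (Ioc 1 N) :=
      (((hic _).const_smul (c : ℂ)).integrableOn_Icc).mono_set Ioc_subset_Icc_self
    have i2 := (h.integrableOn hs le_rfl).mono_set (Ioc_subset_Ioi_self : Ioc 1 N ⊆ _)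
    have e4 : ∀ t ∈ Ioc (1 : ℝ) N, (∑ k ∈ Finset.Icc 0 ⌊t⌋₊, (a k : ℂ)) * (t : ℂ) ^ (-(s + 1))
        = (errorTerm a c t : ℂ) * (t : ℂ) ^ (-(s + 1)) + (c : ℂ) * (t : ℂ) ^ (-s) := by
      intro t ht
      have ht0 : (t : ℂ) ≠ 0 := by exact_mod_cast (by linarith [ht.1] : t ≠ 0)
      have e2 : (t : ℂ) ^ (-s) = t * (t : ℂ) ^ (-(s + 1)) := by
        rw [show -s = 1 + -(s + 1) by ring, Complex.cpow_add _ _ ht0, Complex.cpow_one]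
      simp only [errorTerm, ← Complex.ofReal_sum, e2]
      push_cast
      ring
    rw [setIntegral_congr_fun measurableSet_Ioc e4, integral_add i2 i1, add_sub_cancel_right]
  have e2 : ∫ t in Ioc (1 : ℝ) N, deriv (fun t : ℝ ↦ (t : ℂ) ^ (-s)) t *
      (∑ k ∈ Finset.Icc 0 ⌊t⌋₊, (a k : ℂ))
      = -s * ∫ t in Ioc (1 : ℝ) N, (∑ k ∈ Finset.Icc 0 ⌊t⌋₊, (a k : ℂ)) * (t : ℂ) ^ (-(s + 1)) := by
    rw [← integral_const_mul]
    refine setIntegral_congr_fun measurableSet_Ioc fun t ht ↦ ?_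
    simp only [(hder t (Ioc_subset_Icc_self ht)).deriv]
    ring
  have e3 : ∫ t in Ioc (1 : ℝ) N, (c : ℂ) * (t : ℂ) ^ (-s)
      = c * (((N : ℂ) ^ (1 - s) - 1) / (1 - s)) := by
    rw [integral_const_mul, ← intervalIntegral.integral_of_le hN, integral_cpow
      (Or.inr ⟨by intro h; apply hs1; linear_combination -h, h0⟩)]
    simp only [Complex.ofReal_one, Complex.one_cpow]
    rw [show -s + 1 = 1 - s by ring]
  rw [e2] at habel
  rw [regularPart, hsplit, e1, e3]
  simp only [Complex.ofReal_natCast] at habel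
  rw [habel]
  push_cast
  ring

theorem norm_regularPart_le_const (h : PowerSaving a c C η) {s : ℂ} (hs : 1 - η / 2 ≤ s.re) :
    ‖regularPart a c s‖ ≤ c + ‖s‖ * (2 * C / η) := by
  have hη := h.η_pos
  have hC := h.C_nonneg
  have h1 := h.norm_integral_le (s := s) (by linarith) le_rfl
  rw [Real.one_rpow, mul_one] at h1
  have h2 : C / (η + s.re - 1) ≤ 2 * C / η := by
    rw [div_le_div_iff₀ (by linarith) hη]
    nlinarith
  rw [regularPart]
  refine (norm_add_le _ _).trans ?_
  rw [norm_mul, Complex.norm_real, Real.norm_of_nonneg h.c_nonneg]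
  gcongr
  exact h1.trans h2

theorem norm_sum_le (h : PowerSaving a c C η) {r : ℝ} (hr : 0 < r) {s : ℂ} (hs : 1 - r ≤ s.re)
    {N : ℝ} (hN : 1 ≤ N) :
    ‖∑ k ∈ Finset.Icc 0 ⌊N⌋₊, (k : ℂ) ^ (-s) * (a k : ℂ)‖
      ≤ (∑' n, ‖LSeries.term (fun n ↦ (a n : ℂ)) (1 + r : ℝ) n‖) * N ^ (2 * r) := by
  have hsum := (h.lseriesSummable (s := ((1 + r : ℝ) : ℂ)) (by simpa using hr)).norm
  refine (_root_.norm_sum_le _ _).trans ?_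
  have hN0 : 0 < N := by linarith
  refine le_trans ?_ (mul_le_mul_of_nonneg_right
    (hsum.sum_le_tsum (Finset.Icc 0 ⌊N⌋₊) fun _ _ ↦ norm_nonneg _) (by positivity))
  rw [Finset.sum_mul]
  refine Finset.sum_le_sum fun k hk ↦ ?_
  rcases Nat.eq_zero_or_pos k with rfl | hk0
  · simp [h.zero]
  have hk1 : (1 : ℝ) ≤ k := by exact_mod_cast hk0
  have hkN : (k : ℝ) ≤ N := (Nat.le_floor_iff hN0.le).1 (Finset.mem_Icc.1 hk).2
  rw [LSeries.norm_term_eq, if_neg hk0.ne', norm_mul, Complex.norm_natCast_cpow_of_pos hk0,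
    Complex.ofReal_re, Complex.neg_re, mul_comm, div_eq_mul_inv, mul_assoc,
    ← Real.rpow_neg (by positivity)]
  gcongr
  calc (k : ℝ) ^ (-s.re) ≤ (k : ℝ) ^ (-(1 + r) + 2 * r) :=
        Real.rpow_le_rpow_of_exponent_le hk1 (by linarith)
    _ = (k : ℝ) ^ (-(1 + r)) * (k : ℝ) ^ (2 * r) := Real.rpow_add (by linarith) _ _
    _ ≤ _ := by gcongr

/-- The regular part grows slower than any power slightly to the left of the line `re s = 1`. -/
theorem exists_norm_regularPart_le (h : PowerSaving a c C η) {ε : ℝ} (hε : 0 < ε) :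
    ∃ r K : ℝ, 0 < r ∧ r ≤ η / 2 ∧ 0 ≤ K ∧ ∀ s : ℂ, 1 - r ≤ s.re → s.re ≤ 3 →
      ‖regularPart a c s‖ ≤ K * (1 + |s.im|) ^ ε := by
  have hη := h.η_pos
  have hη1 := h.η_lt
  have hC := h.C_nonneg
  have hc := h.c_nonneg
  set r := min (η / 2) (ε * η / 4) with hr_def
  have hr : 0 < r := lt_min (by positivity) (by positivity)
  have hr1 : r ≤ η / 2 := min_le_left _ _
  have hr2 : r ≤ ε * η / 4 := min_le_right _ _
  set K0 := ∑' n, ‖LSeries.term (fun n ↦ (a n : ℂ)) (1 + r : ℝ) n‖ with hK0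
  have hK0n : 0 ≤ K0 := tsum_nonneg fun _ ↦ norm_nonneg _
  refine ⟨r, 6 * c + K0 + C + 8 * C / η, hr, hr1, by positivity, fun s hs1 hs3 ↦ ?_⟩
  set T := 1 + |s.im| with hT
  have hT1 : 1 ≤ T := by linarith [abs_nonneg s.im]
  have hTε : 1 ≤ T ^ ε := Real.one_le_rpow hT1 hε.le
  have hT0 : 0 < T := by linarith
  have hre : |s.re| ≤ 3 := abs_le.2 ⟨by linarith, hs3⟩
  have hsT : ‖s‖ ≤ 3 * T := by
    refine (Complex.norm_le_abs_re_add_abs_im s).trans ?_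
    linarith [abs_nonneg s.im]
  by_cases him : |s.im| < 1
  · refine (h.norm_regularPart_le_const (by linarith)).trans ?_
    have : ‖s‖ ≤ 4 := by
      refine (Complex.norm_le_abs_re_add_abs_im s).trans ?_
      linarith
    calc c + ‖s‖ * (2 * C / η) ≤ c + 4 * (2 * C / η) := by gcongr
      _ ≤ (6 * c + K0 + C + 8 * C / η) * 1 := by
        have : 4 * (2 * C / η) = 8 * C / η := by ring
        rw [this]; linarith
      _ ≤ _ := by gcongr
  push Not at him
  have hs1' : s ≠ 1 := by
    rintro rfl
    simp at him
    linarith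
  set N := T ^ (2 / η) with hN_def
  have hN : 1 ≤ N := Real.one_le_rpow hT1 (by positivity)
  have hN0 : 0 < N := by linarith
  rw [h.regularPart_eq_truncated (by linarith) hs1' hN]
  have hNr : N ^ r ≤ T ^ ε := by
    rw [hN_def, ← Real.rpow_mul hT0.le]
    refine Real.rpow_le_rpow_of_exponent_le hT1 ?_
    rw [div_mul_eq_mul_div, div_le_iff₀ hη]
    nlinarith
  have hN2r : N ^ (2 * r) ≤ T ^ ε := by
    rw [hN_def, ← Real.rpow_mul hT0.le]
    refine Real.rpow_le_rpow_of_exponent_le hT1 ?_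
    rw [div_mul_eq_mul_div, div_le_iff₀ hη]
    nlinarith
  have hTN : T * N ^ (1 - η - s.re) ≤ T ^ ε := by
    calc T * N ^ (1 - η - s.re) ≤ T * N ^ (r - η) :=
          mul_le_mul_of_nonneg_left
            (Real.rpow_le_rpow_of_exponent_le hN (by linarith)) hT0.le
      _ = T ^ (1 + 2 / η * (r - η)) := by
          rw [Real.rpow_add hT0, Real.rpow_one, hN_def, ← Real.rpow_mul hT0.le]
      _ ≤ T ^ ε := by
          refine Real.rpow_le_rpow_of_exponent_le hT1 ?_
          have : 2 / η * (r - η) ≤ ε / 2 - 2 := by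
            rw [div_mul_eq_mul_div, div_le_iff₀ hη]
            nlinarith
          linarith
  have b1 := h.norm_sum_le hr hs1 hN
  have b2 : ‖(N : ℂ) ^ (-s) * ((∑ k ∈ Finset.Icc 0 ⌊N⌋₊, a k : ℝ) : ℂ)‖ ≤ (c + C) * T ^ ε := by
    have hA : ∑ k ∈ Finset.Icc 0 ⌊N⌋₊, a k ≤ (c + C) * N := by
      have h1 := (le_abs_self _).trans (h.bound N hN)
      rw [errorTerm] at h1
      have h2 : N ^ (1 - η) ≤ N := by
        conv_rhs => rw [← Real.rpow_one N]
        exact Real.rpow_le_rpow_of_exponent_le hN (by linarith)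
      nlinarith [mul_le_mul_of_nonneg_left h2 hC]
    rw [norm_mul, Complex.norm_cpow_eq_rpow_re_of_pos hN0, Complex.norm_real,
      Real.norm_of_nonneg (Finset.sum_nonneg fun _ _ ↦ h.nonneg _)]
    calc _ ≤ N ^ (r - 1) * ((c + C) * N) :=
          mul_le_mul (Real.rpow_le_rpow_of_exponent_le hN (by simp; linarith)) hA
            (Finset.sum_nonneg fun _ _ ↦ h.nonneg _) (by positivity)
      _ = (c + C) * N ^ r := by
          rw [Real.rpow_sub hN0, Real.rpow_one]
          field_simp
      _ ≤ _ := by gcongr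
  have b3 : ‖(c : ℂ) * s * (((N : ℂ) ^ (1 - s) - 1) / (1 - s))‖ ≤ 4 * c * T ^ ε := by
    have hd : 1 ≤ ‖1 - s‖ := by
      refine le_trans ?_ (Complex.abs_im_le_norm _)
      simpa using him
    have hsd : ‖s‖ ≤ 2 * ‖1 - s‖ := by
      have : s = 1 - (1 - s) := by ring
      calc ‖s‖ = ‖1 - (1 - s)‖ := by rw [← this]
        _ ≤ ‖(1 : ℂ)‖ + ‖1 - s‖ := norm_sub_le _ _
        _ ≤ _ := by rw [norm_one]; linarith
    have hn : ‖(N : ℂ) ^ (1 - s) - 1‖ ≤ 2 * T ^ ε := by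
      refine (norm_sub_le _ _).trans ?_
      rw [Complex.norm_cpow_eq_rpow_re_of_pos hN0, norm_one]
      have : N ^ (1 - s).re ≤ N ^ r := Real.rpow_le_rpow_of_exponent_le hN (by simp; linarith)
      linarith
    rw [norm_mul, norm_mul, norm_div, Complex.norm_real, Real.norm_of_nonneg hc]
    calc c * ‖s‖ * (‖(N : ℂ) ^ (1 - s) - 1‖ / ‖1 - s‖)
        ≤ c * (2 * ‖1 - s‖) * ((2 * T ^ ε) / ‖1 - s‖) := by gcongr
      _ = _ := by field_simp; ring
  have b4 : ‖s * ∫ t in Ioi N, (errorTerm a c t : ℂ) * (t : ℂ) ^ (-(s + 1))‖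
      ≤ 6 * C / η * T ^ ε := by
    have h1 := h.norm_integral_le (s := s) (by linarith) hN
    rw [norm_mul]
    calc _ ≤ 3 * T * (C * N ^ (1 - η - s.re) / (η + s.re - 1)) := by gcongr
      _ ≤ 3 * T * (C * N ^ (1 - η - s.re) / (η / 2)) := by gcongr; linarith
      _ = 6 * C / η * (T * N ^ (1 - η - s.re)) := by field_simp; ring
      _ ≤ _ := by gcongr
  have b0 : ‖(c : ℂ)‖ ≤ c * T ^ ε := by
    rw [Complex.norm_real, Real.norm_of_nonneg hc]; nlinarith
  have b5 : 6 * C / η * T ^ ε ≤ 8 * C / η * T ^ ε := by gcongr; norm_num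
  calc _ ≤ ‖(c : ℂ)‖ + (‖∑ k ∈ Finset.Icc 0 ⌊N⌋₊, (k : ℂ) ^ (-s) * (a k : ℂ)‖
      + ‖(N : ℂ) ^ (-s) * ((∑ k ∈ Finset.Icc 0 ⌊N⌋₊, a k : ℝ) : ℂ)‖
      + ‖(c : ℂ) * s * (((N : ℂ) ^ (1 - s) - 1) / (1 - s))‖)
      + ‖s * ∫ t in Ioi N, (errorTerm a c t : ℂ) * (t : ℂ) ^ (-(s + 1))‖ := by
        refine (norm_add_le _ _).trans (add_le_add_left ((norm_add_le _ _).trans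
          (add_le_add_right ((norm_sub_le _ _).trans (add_le_add_left (norm_sub_le _ _) _)) _)) _)
    _ ≤ c * T ^ ε + (K0 * N ^ (2 * r) + (c + C) * T ^ ε + 4 * c * T ^ ε) + 6 * C / η * T ^ ε := by
        gcongr
    _ ≤ _ := by nlinarith [mul_le_mul_of_nonneg_left hN2r hK0n]

end PowerSaving
end BeurlingPNT

namespace BeurlingPNT

open MeasureTheory Set Filter Asymptotics
open scoped Topology

variable {a : ℕ → ℝ} {c C η : ℝ}
namespace PowerSaving

theorem isOpen_re_gt (x : ℝ) : IsOpen {s : ℂ | x < s.re} :=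
  isOpen_lt continuous_const Complex.continuous_re

theorem differentiableOn_regularPart (h : PowerSaving a c C η) :
    DifferentiableOn ℂ (regularPart a c) {s | 1 - η < s.re} :=
  fun _ hs ↦ (h.differentiableAt_regularPart hs).differentiableWithinAt

theorem analyticAt_regularPart (h : PowerSaving a c C η) {s : ℂ} (hs : 1 - η < s.re) :
    AnalyticAt ℂ (regularPart a c) s :=
  h.differentiableOn_regularPart.analyticAt ((isOpen_re_gt _).mem_nhds hs)

theorem exists_norm_iteratedDeriv_regularPart_le (h : PowerSaving a c C η) {ε : ℝ} (hε : 0 < ε)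
    (j : ℕ) : ∃ K : ℝ, 0 ≤ K ∧ ∀ s : ℂ, 1 < s.re → s.re ≤ 2 →
      ‖iteratedDeriv j (regularPart a c) s‖ ≤ K * (1 + |s.im|) ^ ε := by
  obtain ⟨r, K, hr, hrη, hK, hb⟩ := h.exists_norm_regularPart_le hε
  have hη := h.η_lt
  refine ⟨j.factorial * (K * 2 ^ ε) / r ^ j, by positivity, fun s hs hs2 ↦ ?_⟩
  have hball : ∀ z ∈ Metric.closedBall s r, 1 - r < z.re ∧ z.re ≤ 3 ∧ |z.im| ≤ |s.im| + r := by
    intro z hz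
    rw [Metric.mem_closedBall, dist_eq_norm] at hz
    have h1 := abs_le.1 ((Complex.abs_re_le_norm (z - s)).trans hz)
    have h2 := abs_le.1 ((Complex.abs_im_le_norm (z - s)).trans hz)
    simp only [Complex.sub_re, Complex.sub_im] at h1 h2
    refine ⟨by linarith, by linarith, abs_le.2 ⟨?_, ?_⟩⟩
    · linarith [neg_abs_le s.im]
    · linarith [le_abs_self s.im]
  have hd : DiffContOnCl ℂ (regularPart a c) (Metric.ball s r) := by
    refine DifferentiableOn.diffContOnCl ?_
    rw [closure_ball _ hr.ne']
    intro z hz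
    exact (h.differentiableAt_regularPart (by linarith [(hball z hz).1])).differentiableWithinAt
  refine (Complex.norm_iteratedDeriv_le_of_forall_mem_sphere_norm_le
    (C := K * 2 ^ ε * (1 + |s.im|) ^ ε) j hr hd fun z hz ↦ ?_).trans_eq (by ring)
  obtain ⟨h1, h2, h3⟩ := hball z (Metric.sphere_subset_closedBall hz)
  refine (hb z h1.le h2).trans ?_
  rw [mul_assoc, ← Real.mul_rpow (by norm_num) (by positivity)]
  gcongr
  linarith [abs_nonneg s.im]

theorem hasDerivAt_iteratedDeriv_regularPart (h : PowerSaving a c C η) (j : ℕ) {s : ℂ}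
    (hs : 1 - η < s.re) : HasDerivAt (iteratedDeriv j (regularPart a c))
      (iteratedDeriv (j + 1) (regularPart a c) s) s := by
  rw [iteratedDeriv_succ, iteratedDeriv_eq_iterate]
  exact ((h.analyticAt_regularPart hs).iterated_deriv j).differentiableAt.hasDerivAt

end PowerSaving
end BeurlingPNT

namespace BeurlingPNT

open MeasureTheory Set Filter Asymptotics
open scoped Topology

variable {a : ℕ → ℝ} {c C η : ℝ}

/-- `Λ` plays the role of the von Mangoldt function of `a`: its Dirichlet series is minus the
logarithmic derivative of the one of `a`. -/
structure IsVonMangoldt (a Λ : ℕ → ℝ) : Prop where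
  one : a 1 = 1
  nonneg : ∀ n, 0 ≤ Λ n
  conv : ∀ n, ∑ p ∈ n.divisorsAntidiagonal, Λ p.1 * a p.2 = a n * Real.log n

namespace IsVonMangoldt

variable {Λ : ℕ → ℝ}

theorem vonMangoldt_one (hΛ : IsVonMangoldt a Λ) : Λ 1 = 0 := by
  have := hΛ.conv 1
  simpa [hΛ.one] using this

theorem le (hΛ : IsVonMangoldt a Λ) (ha : ∀ n, 0 ≤ a n) {n : ℕ} (hn : n ≠ 0) :
    Λ n ≤ a n * Real.log n := by
  rw [← hΛ.conv n]
  refine le_trans ?_ (Finset.single_le_sum (f := fun p : ℕ × ℕ ↦ Λ p.1 * a p.2)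
    (fun p _ ↦ mul_nonneg (hΛ.nonneg _) (ha _)) (a := (n, 1)) (by simp [hn]))
  simp [hΛ.one]

theorem abscissa_le (h : PowerSaving a c C η) :
    LSeries.abscissaOfAbsConv (fun n ↦ (a n : ℂ)) ≤ 1 :=
  LSeries.abscissaOfAbsConv_le_of_forall_lt_LSeriesSummable (x := 1)
    fun _ hy ↦ h.lseriesSummable (by simpa using hy)

/-- The coefficients of the logarithm of the Dirichlet series of `a`. -/
noncomputable def logCoeff (Λ : ℕ → ℝ) (n : ℕ) : ℂ := ((Λ n / Real.log n : ℝ) : ℂ)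

theorem logCoeff_nonneg (hΛ : IsVonMangoldt a Λ) (n : ℕ) : 0 ≤ Λ n / Real.log n :=
  div_nonneg (hΛ.nonneg n) (Real.log_natCast_nonneg n)

theorem norm_logCoeff_le (h : PowerSaving a c C η) (hΛ : IsVonMangoldt a Λ) {n : ℕ} (hn : n ≠ 0) :
    ‖logCoeff Λ n‖ ≤ ‖(a n : ℂ)‖ := by
  rw [logCoeff, Complex.norm_real, Complex.norm_real, Real.norm_of_nonneg (hΛ.logCoeff_nonneg n),
    Real.norm_of_nonneg (h.nonneg n)]
  exact div_le_of_le_mul₀ (Real.log_natCast_nonneg n) (h.nonneg n) (hΛ.le h.nonneg hn)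

theorem lseriesSummable_logCoeff (h : PowerSaving a c C η) (hΛ : IsVonMangoldt a Λ) {s : ℂ}
    (hs : 1 < s.re) : LSeriesSummable (logCoeff Λ) s := by
  refine Summable.of_norm_bounded (h.lseriesSummable hs).norm fun n ↦ ?_
  rcases eq_or_ne n 0 with rfl | hn
  · simp
  · exact LSeries.norm_term_le s (hΛ.norm_logCoeff_le h hn)

theorem abscissa_logCoeff_le (h : PowerSaving a c C η) (hΛ : IsVonMangoldt a Λ) :
    LSeries.abscissaOfAbsConv (logCoeff Λ) ≤ 1 :=
  LSeries.abscissaOfAbsConv_le_of_forall_lt_LSeriesSummable (x := 1)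
    fun _ hy ↦ hΛ.lseriesSummable_logCoeff h (by simpa using hy)

theorem logMul_logCoeff (hΛ : IsVonMangoldt a Λ) {n : ℕ} (hn : n ≠ 0) :
    LSeries.logMul (logCoeff Λ) n = (Λ n : ℂ) := by
  rcases eq_or_ne n 1 with rfl | hn1
  · simp [LSeries.logMul, hΛ.vonMangoldt_one]
  · have : Real.log n ≠ 0 := by
      refine (Real.log_pos ?_).ne'
      exact_mod_cast (by omega : 1 < n)
    rw [LSeries.logMul, logCoeff, Complex.natCast_log.symm, ← Complex.ofReal_mul,
      mul_div_cancel₀ _ this]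

theorem one_lt_of_lt {x : EReal} (hx : x ≤ 1) {s : ℂ} (hs : 1 < s.re) : x < s.re :=
  hx.trans_lt (by exact_mod_cast hs)

theorem lseriesSummable_vonMangoldt (h : PowerSaving a c C η) (hΛ : IsVonMangoldt a Λ) {s : ℂ}
    (hs : 1 < s.re) : LSeriesSummable (fun n ↦ (Λ n : ℂ)) s :=
  (LSeriesSummable_congr s hΛ.logMul_logCoeff).1
    (LSeriesSummable_logMul_of_lt_re (one_lt_of_lt (hΛ.abscissa_logCoeff_le h) hs))

theorem hasDerivAt_lseries_logCoeff (h : PowerSaving a c C η) (hΛ : IsVonMangoldt a Λ) {s : ℂ}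
    (hs : 1 < s.re) :
    HasDerivAt (LSeries (logCoeff Λ)) (-LSeries (fun n ↦ (Λ n : ℂ)) s) s := by
  have := LSeries_hasDerivAt (one_lt_of_lt (hΛ.abscissa_logCoeff_le h) hs)
  rwa [LSeries_congr hΛ.logMul_logCoeff] at this

theorem hasDerivAt_lseries (h : PowerSaving a c C η) (hΛ : IsVonMangoldt a Λ) {s : ℂ}
    (hs : 1 < s.re) :
    HasDerivAt (LSeries fun n ↦ (a n : ℂ))
      (-(LSeries (fun n ↦ (Λ n : ℂ)) s * LSeries (fun n ↦ (a n : ℂ)) s)) s := by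
  have := LSeries_hasDerivAt (one_lt_of_lt (abscissa_le h) hs)
  rwa [← LSeries_convolution' (hΛ.lseriesSummable_vonMangoldt h hs) (h.lseriesSummable hs),
    LSeries_congr (g := LSeries.logMul fun n ↦ (a n : ℂ))]
  intro n _
  rw [LSeries.convolution_def, LSeries.logMul, Complex.natCast_log.symm, mul_comm]
  beta_reduce
  exact_mod_cast hΛ.conv n

theorem lseries_eq_exp (h : PowerSaving a c C η) (hΛ : IsVonMangoldt a Λ) {s : ℂ}
    (hs : 1 < s.re) : LSeries (fun n ↦ (a n : ℂ)) s = Complex.exp (LSeries (logCoeff Λ) s) := by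
  set F : ℂ → ℂ := fun s ↦ LSeries (fun n ↦ (a n : ℂ)) s * Complex.exp (-LSeries (logCoeff Λ) s)
  have hF (s : ℂ) (hs : 1 < s.re) : HasDerivAt F 0 s := by
    refine ((hΛ.hasDerivAt_lseries h hs).mul
      (hΛ.hasDerivAt_lseries_logCoeff h hs).neg.cexp).congr_deriv ?_
    simp only [Pi.neg_apply]
    ring
  have hconst {s t : ℂ} (hs : 1 < s.re) (ht : 1 < t.re) : F s = F t :=
    (PowerSaving.isOpen_re_gt 1).is_const_of_deriv_eq_zero
      (convex_halfSpace_re_gt 1).isPreconnected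
      (fun s hs ↦ (hF s hs).differentiableAt.differentiableWithinAt) (fun s hs ↦ (hF s hs).deriv)
      hs ht
  have hlim : Tendsto (fun x : ℝ ↦ F x) atTop (𝓝 1) := by
    have h1 := LSeries.tendsto_atTop ((abscissa_le h).trans_lt (EReal.coe_lt_top 1))
    have h2 := LSeries.tendsto_atTop ((hΛ.abscissa_logCoeff_le h).trans_lt (EReal.coe_lt_top 1))
    have := h1.mul h2.neg.cexp
    simpa [hΛ.one, logCoeff] using this
  have hFs : F s = 1 := by
    refine tendsto_nhds_unique (tendsto_const_nhds.congr' ?_) hlim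
    filter_upwards [eventually_gt_atTop 1] with x hx
    exact hconst hs (by simpa using hx)
  simp only [F, Complex.exp_neg] at hFs
  exact (mul_inv_eq_one₀ (Complex.exp_ne_zero _)).1 hFs

theorem term_logCoeff (n : ℕ) (hn : n ≠ 0) (σ t : ℝ) :
    LSeries.term (logCoeff Λ) (σ + t * Complex.I) n =
      ((Λ n / Real.log n / (n : ℝ) ^ σ : ℝ) : ℂ) * ((n : ℂ) ^ (t * Complex.I))⁻¹ := by
  have : (n : ℂ) ≠ 0 := by exact_mod_cast hn
  rw [LSeries.term_of_ne_zero hn, Complex.cpow_add _ _ this, logCoeff, Complex.ofReal_div (_ / _),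
    Complex.ofReal_cpow (by positivity)]
  push_cast
  field_simp

theorem norm_natCast_cpow_mul_I (n : ℕ) (hn : n ≠ 0) (t : ℝ) :
    ‖((n : ℂ) ^ (t * Complex.I))⁻¹‖ = 1 := by
  rw [norm_inv, Complex.norm_natCast_cpow_of_pos (by omega)]
  simp

theorem re_lseries_comb_nonneg (h : PowerSaving a c C η) (hΛ : IsVonMangoldt a Λ) {σ : ℝ}
    (hσ : 1 < σ) (t : ℝ) :
    0 ≤ (3 * LSeries (logCoeff Λ) σ + 4 * LSeries (logCoeff Λ) (σ + t * Complex.I) +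
      LSeries (logCoeff Λ) (σ + (2 * t : ℝ) * Complex.I)).re := by
  have hsum (t : ℝ) : LSeriesSummable (logCoeff Λ) (σ + t * Complex.I) :=
    hΛ.lseriesSummable_logCoeff h (by simpa using hσ)
  have h0 := (hsum 0).hasSum
  have := ((h0.mul_left 3).add ((hsum t).hasSum.mul_left 4)).add (hsum (2 * t)).hasSum
  rw [show (σ : ℂ) + ((0 : ℝ) : ℂ) * Complex.I = σ by simp] at this
  refine (Complex.hasSum_re this).nonneg fun n ↦ ?_
  rcases eq_or_ne n 0 with rfl | hn
  · simp
  have hn0 : (n : ℂ) ≠ 0 := by exact_mod_cast hn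
  have e0 := term_logCoeff (Λ := Λ) n hn σ 0
  rw [show (σ : ℂ) + ((0 : ℝ) : ℂ) * Complex.I = σ by simp] at e0
  rw [e0, term_logCoeff n hn, term_logCoeff n hn]
  have e2 : ((n : ℂ) ^ ((2 * t : ℝ) * Complex.I))⁻¹ = (((n : ℂ) ^ (t * Complex.I))⁻¹) ^ 2 := by
    rw [inv_pow, ← Complex.cpow_nat_mul]
    push_cast
    ring_nf
  have hx : 0 ≤ Λ n / Real.log n / (n : ℝ) ^ σ :=
    div_nonneg (hΛ.logCoeff_nonneg n) (by positivity)
  have hw := norm_natCast_cpow_mul_I n hn t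
  rw [e2]
  generalize Λ n / Real.log n / (n : ℝ) ^ σ = x at *
  generalize ((n : ℂ) ^ (t * Complex.I))⁻¹ = w at *
  have hw2 : w.re ^ 2 + w.im ^ 2 = 1 := by
    have := Complex.sq_norm w
    rw [hw, Complex.normSq_apply] at this
    nlinarith
  have : (3 * ((x : ℂ) * ((n : ℂ) ^ (((0 : ℝ) : ℂ) * Complex.I))⁻¹) + 4 * (x * w) +
      x * w ^ 2).re = x * (2 * (1 + w.re) ^ 2) := by
    simp [pow_two]
    linear_combination (-x) * hw2
  rw [this]
  positivity

theorem norm_lseries_mul_ge (h : PowerSaving a c C η) (hΛ : IsVonMangoldt a Λ) {σ : ℝ}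
    (hσ : 1 < σ) (t : ℝ) :
    1 ≤ ‖LSeries (fun n ↦ (a n : ℂ)) σ‖ ^ 3 *
      ‖LSeries (fun n ↦ (a n : ℂ)) (σ + t * Complex.I)‖ ^ 4 *
      ‖LSeries (fun n ↦ (a n : ℂ)) (σ + (2 * t : ℝ) * Complex.I)‖ := by
  rw [hΛ.lseries_eq_exp h (by simpa using hσ), hΛ.lseries_eq_exp h (by simpa using hσ),
    hΛ.lseries_eq_exp h (by simpa using hσ), Complex.norm_exp, Complex.norm_exp, Complex.norm_exp,
    ← Real.exp_nat_mul, ← Real.exp_nat_mul, ← Real.exp_add, ← Real.exp_add]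
  refine Real.one_le_exp ?_
  simpa using hΛ.re_lseries_comb_nonneg h hσ t

theorem lseries_ne_zero (h : PowerSaving a c C η) (hΛ : IsVonMangoldt a Λ) {s : ℂ}
    (hs : 1 < s.re) : LSeries (fun n ↦ (a n : ℂ)) s ≠ 0 := by
  rw [hΛ.lseries_eq_exp h hs]
  exact Complex.exp_ne_zero _

theorem norm_lseries_ge (h : PowerSaving a c C η) (hΛ : IsVonMangoldt a Λ) {σ : ℝ}
    (hσ : 1 < σ) {s : ℂ} (hs : σ ≤ s.re) :
    Real.exp (-∑' n, ‖LSeries.term (logCoeff Λ) σ n‖) ≤ ‖LSeries (fun n ↦ (a n : ℂ)) s‖ := by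
  rw [hΛ.lseries_eq_exp h (hσ.trans_le hs), Complex.norm_exp, Real.exp_le_exp]
  have hsum := hΛ.lseriesSummable_logCoeff h (s := s) (hσ.trans_le hs)
  have hsum' := hΛ.lseriesSummable_logCoeff h (s := σ) (by simpa using hσ)
  have h1 : ‖LSeries (logCoeff Λ) s‖ ≤ ∑' n, ‖LSeries.term (logCoeff Λ) σ n‖ :=
    (norm_tsum_le_tsum_norm hsum.norm).trans (Summable.tsum_le_tsum
      (fun n ↦ LSeries.norm_term_le_of_re_le_re _ (by simpa using hs) n) hsum.norm hsum'.norm)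
  have := (abs_le.1 ((Complex.abs_re_le_norm _).trans h1)).1
  linarith

end IsVonMangoldt

end BeurlingPNT

namespace BeurlingPNT

open MeasureTheory Set Filter Asymptotics
open scoped Topology

variable {a : ℕ → ℝ} {c C η : ℝ}

namespace IsVonMangoldt

variable {Λ : ℕ → ℝ}

theorem hasDerivAt_lseries_regularPart (h : PowerSaving a c C η) {s : ℂ} (hs : 1 < s.re) :
    HasDerivAt (LSeries fun n ↦ (a n : ℂ))
      (-c / (s - 1) ^ 2 + iteratedDeriv 1 (PowerSaving.regularPart a c) s) s := by
  have h1 : s - 1 ≠ 0 := fun h0 ↦ by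
    rw [sub_eq_zero] at h0
    simp [h0] at hs
  have hη := h.η_pos
  have := ((hasDerivAt_const s (c : ℂ)).div ((hasDerivAt_id s).sub_const 1) h1).add
    (h.hasDerivAt_iteratedDeriv_regularPart 0 (s := s) (by linarith))
  refine HasDerivAt.congr_of_eventuallyEq (this.congr_deriv ?_) ?_
  · simp
  · filter_upwards [(PowerSaving.isOpen_re_gt 1).mem_nhds hs] with w hw
    simp [h.lseries_eq hw]

theorem one_add_abs_rpow_ge (t : ℝ) {ε : ℝ} (hε : 0 ≤ ε) : 1 ≤ (1 + |t|) ^ ε :=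
  Real.one_le_rpow (by linarith [abs_nonneg t]) hε

theorem abs_im_le_norm_sub_one (s : ℂ) : |s.im| ≤ ‖s - 1‖ := by
  simpa using Complex.abs_im_le_norm (s - 1)

/-- The upper bounds feeding into the `3-4-1` argument, with a common constant. -/
theorem exists_upper_bounds (h : PowerSaving a c C η) {ε : ℝ} (hε : 0 < ε) (hε1 : ε ≤ 1) {ρ : ℝ}
    (hρ : 0 < ρ) : ∃ K : ℝ, 1 ≤ K ∧
      (∀ σ : ℝ, 1 < σ → σ ≤ 2 → ‖LSeries (fun n ↦ (a n : ℂ)) σ‖ ≤ K / (σ - 1)) ∧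
      (∀ s : ℂ, 1 < s.re → s.re ≤ 2 → ρ ≤ |s.im| →
        ‖LSeries (fun n ↦ (a n : ℂ)) s‖ ≤ K * (1 + |s.im|) ^ ε) ∧
      (∀ s : ℂ, 1 < s.re → s.re ≤ 2 → ρ ≤ |s.im| →
        ‖deriv (LSeries (fun n ↦ (a n : ℂ))) s‖ ≤ K * (1 + |s.im|) ^ ε) ∧
      ∀ σ t : ℝ, 1 < σ → σ ≤ 2 → ρ ≤ |t| →
        ‖LSeries (fun n ↦ (a n : ℂ)) (σ + (2 * t : ℝ) * Complex.I)‖ ≤ K * (1 + |t|) ^ ε := by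
  obtain ⟨K0, hK0, h0⟩ := h.exists_norm_iteratedDeriv_regularPart_le hε 0
  obtain ⟨K1, hK1, h1⟩ := h.exists_norm_iteratedDeriv_regularPart_le hε 1
  simp only [iteratedDeriv_zero] at h0
  have hc := h.c_nonneg
  have hA : 0 ≤ c / ρ := by positivity
  have hB : 0 ≤ c / ρ ^ 2 := by positivity
  have key (s : ℂ) (hs : 1 < s.re) (hs2 : s.re ≤ 2) (ht : ρ ≤ |s.im|) :
      ‖LSeries (fun n ↦ (a n : ℂ)) s‖ ≤ (c / ρ + K0) * (1 + |s.im|) ^ ε := by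
    have hV := one_add_abs_rpow_ge s.im hε.le
    have hn : ρ ≤ ‖s - 1‖ := ht.trans (abs_im_le_norm_sub_one s)
    rw [h.lseries_eq hs]
    calc _ ≤ ‖(c : ℂ) / (s - 1)‖ + ‖PowerSaving.regularPart a c s‖ := norm_add_le _ _
      _ ≤ c / ρ + K0 * (1 + |s.im|) ^ ε := by
          refine add_le_add ?_ (h0 s hs hs2)
          rw [norm_div, Complex.norm_real, Real.norm_of_nonneg hc]
          gcongr
      _ ≤ _ := by nlinarith
  refine ⟨1 + c + 2 * (c / ρ + K0) + c / ρ ^ 2 + K1, by nlinarith, ?_, ?_, ?_, ?_⟩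
  · intro σ hσ hσ2
    have hσ' : 0 < σ - 1 := by linarith
    rw [h.lseries_eq (by simpa using hσ), le_div_iff₀ hσ']
    have e := h0 σ (by simpa using hσ) (by simpa using hσ2)
    simp only [Complex.ofReal_im, abs_zero, add_zero, Real.one_rpow, mul_one] at e
    calc ‖(c : ℂ) / (σ - 1) + PowerSaving.regularPart a c σ‖ * (σ - 1)
        ≤ (‖(c : ℂ) / (σ - 1)‖ + ‖PowerSaving.regularPart a c σ‖) * (σ - 1) := by
          gcongr
          exact norm_add_le _ _
      _ ≤ (c / (σ - 1) + K0) * (σ - 1) := by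
          gcongr
          rw [← Complex.ofReal_one, ← Complex.ofReal_sub, ← Complex.ofReal_div, Complex.norm_real,
            Real.norm_of_nonneg (by positivity)]
      _ = c + K0 * (σ - 1) := by field_simp
      _ ≤ _ := by nlinarith
  · intro s hs hs2 ht
    have hV := one_add_abs_rpow_ge s.im hε.le
    exact (key s hs hs2 ht).trans (mul_le_mul_of_nonneg_right (by nlinarith) (by positivity))
  · intro s hs hs2 ht
    have hV := one_add_abs_rpow_ge s.im hε.le
    have hn : ρ ≤ ‖s - 1‖ := ht.trans (abs_im_le_norm_sub_one s)
    rw [(hasDerivAt_lseries_regularPart h hs).deriv]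
    calc _ ≤ ‖-(c : ℂ) / (s - 1) ^ 2‖ + ‖iteratedDeriv 1 (PowerSaving.regularPart a c) s‖ :=
          norm_add_le _ _
      _ ≤ c / ρ ^ 2 + K1 * (1 + |s.im|) ^ ε := by
          refine add_le_add ?_ (h1 s hs hs2)
          rw [norm_div, norm_neg, Complex.norm_real, Real.norm_of_nonneg hc, norm_pow]
          gcongr
      _ ≤ (c / ρ ^ 2 + K1) * (1 + |s.im|) ^ ε := by nlinarith
      _ ≤ _ := by
          gcongr
          nlinarith
  · intro σ t hσ hσ2 ht
    have hV := one_add_abs_rpow_ge t hε.le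
    refine (key _ (by simpa using hσ) (by simpa using hσ2) ?_).trans ?_
    · simp only [Complex.add_im, Complex.ofReal_im, Complex.mul_im, Complex.ofReal_re,
        Complex.I_im, mul_one, Complex.I_re, mul_zero, add_zero, zero_add, abs_mul, abs_two]
      linarith
    · simp only [Complex.add_im, Complex.ofReal_im, Complex.mul_im, Complex.ofReal_re,
        Complex.I_im, mul_one, Complex.I_re, mul_zero, add_zero, zero_add, abs_mul, abs_two]
      have : (1 + 2 * |t|) ^ ε ≤ 2 * (1 + |t|) ^ ε := by
        calc (1 + 2 * |t|) ^ ε ≤ (2 * (1 + |t|)) ^ ε := by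
              gcongr
              linarith
          _ = 2 ^ ε * (1 + |t|) ^ ε := Real.mul_rpow (by norm_num) (by positivity)
          _ ≤ 2 ^ (1 : ℝ) * (1 + |t|) ^ ε := by
              gcongr
              norm_num
          _ = _ := by simp
      calc _ ≤ (c / ρ + K0) * (2 * (1 + |t|) ^ ε) := by gcongr
        _ = 2 * (c / ρ + K0) * (1 + |t|) ^ ε := by ring
        _ ≤ _ := by
          gcongr
          nlinarith

theorem norm_sub_le_of_deriv_le (h : PowerSaving a c C η) {σ σ' t B : ℝ} (hσ : 1 < σ)
    (hσ' : σ ≤ σ') (hB : ∀ x ∈ Icc σ σ',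
      ‖deriv (LSeries (fun n ↦ (a n : ℂ))) (x + t * Complex.I)‖ ≤ B) :
    ‖LSeries (fun n ↦ (a n : ℂ)) (σ' + t * Complex.I) -
      LSeries (fun n ↦ (a n : ℂ)) (σ + t * Complex.I)‖ ≤ B * (σ' - σ) := by
  refine norm_image_sub_le_of_norm_deriv_le_segment'
    (f := fun x : ℝ ↦ LSeries (fun n ↦ (a n : ℂ)) (x + t * Complex.I))
    (f' := fun x : ℝ ↦ deriv (LSeries (fun n ↦ (a n : ℂ))) (x + t * Complex.I))
    (fun x hx ↦ ?_) (fun x hx ↦ hB x (Ico_subset_Icc_self hx)) σ' (right_mem_Icc.2 hσ')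
  have hx1 : 1 < ((x : ℂ) + t * Complex.I).re := by simpa using hσ.trans_le hx.1
  have h1 := (hasDerivAt_lseries_regularPart h hx1).differentiableAt.hasDerivAt
  have h2 : HasDerivAt (fun x : ℂ ↦ x + t * Complex.I) 1 x := (hasDerivAt_id _).add_const _
  simpa using (h1.comp (x : ℂ) h2).comp_ofReal.hasDerivWithinAt

theorem exists_norm_lseries_ge (h : PowerSaving a c C η) (hΛ : IsVonMangoldt a Λ) {ε : ℝ}
    (hε : 0 < ε) (hε1 : ε ≤ 1) {ρ : ℝ} (hρ : 0 < ρ) : ∃ K : ℝ, 0 < K ∧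
      ∀ s : ℂ, 1 < s.re → s.re ≤ 2 → ρ ≤ |s.im| →
        1 ≤ K * (1 + |s.im|) ^ (4 * ε) * ‖LSeries (fun n ↦ (a n : ℂ)) s‖ := by
  obtain ⟨K, hK, hreal, hup, hder, hup2⟩ := exists_upper_bounds h hε hε1 hρ
  refine ⟨16 * K ^ 7, by positivity, fun s hs hs2 ht ↦ ?_⟩
  obtain ⟨σ, t, rfl⟩ : ∃ σ t : ℝ, s = σ + t * Complex.I := ⟨s.re, s.im, by simp⟩
  simp only [Complex.add_re, Complex.ofReal_re, Complex.mul_re, Complex.I_re, mul_zero,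
    Complex.ofReal_im, Complex.I_im, mul_one, sub_self, add_zero, Complex.add_im, Complex.mul_im,
    zero_add] at hs hs2 ht ⊢
  have hV := one_add_abs_rpow_ge t hε.le
  have hV4 : (1 + |t|) ^ (4 * ε) = ((1 + |t|) ^ ε) ^ 4 := by
    rw [← Real.rpow_mul_natCast (by positivity), mul_comm]
    norm_num
  rw [hV4]
  have low (σ : ℝ) (hs : 1 < σ) (hs2 : σ ≤ 2) : (σ - 1) ^ 3 ≤ K ^ 4 * (1 + |t|) ^ ε *
      ‖LSeries (fun n ↦ (a n : ℂ)) (σ + t * Complex.I)‖ ^ 4 := by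
    have hσ : 0 < σ - 1 := by linarith
    have := hΛ.norm_lseries_mul_ge h hs t
    have h3 : 1 ≤ (K / (σ - 1)) ^ 3 * ‖LSeries (fun n ↦ (a n : ℂ)) (σ + t * Complex.I)‖ ^ 4 *
        (K * (1 + |t|) ^ ε) := by
      refine this.trans ?_
      gcongr
      · exact hreal σ hs hs2
      · exact hup2 σ t hs hs2 ht
    rw [div_pow, div_mul_eq_mul_div, div_mul_eq_mul_div, le_div_iff₀ (by positivity)] at h3
    linarith
  have hder' (x : ℝ) (hx : 1 < x) (hx2 : x ≤ 2) := hder (x + t * Complex.I) (by simpa using hx)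
    (by simpa using hx2) (by simpa using ht)
  simp only [Complex.add_im, Complex.ofReal_im, Complex.mul_im, Complex.ofReal_re,
        Complex.I_im, mul_one, Complex.I_re, mul_zero, add_zero, zero_add] at hder'
  generalize (1 + |t|) ^ ε = V at *
  set q : ℝ := (16 * K ^ 8 * V ^ 5)⁻¹ with hq
  have hq0 : 0 < q := by positivity
  have hq1 : q ≤ 1 := by
    refine inv_le_one_of_one_le₀ ?_
    nlinarith [one_le_pow₀ hK (n := 8), one_le_pow₀ hV (n := 5)]
  have hqe : q * (16 * K ^ 8 * V ^ 5) = 1 := inv_mul_cancel₀ (by positivity)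
  have low' (σ : ℝ) (hs : 1 + q ≤ σ) (hs2 : σ ≤ 2) :
      2 * (K * V * q) ≤ ‖LSeries (fun n ↦ (a n : ℂ)) (σ + t * Complex.I)‖ := by
    have h1 := low σ (by linarith) hs2
    have h2 : q ^ 3 ≤ (σ - 1) ^ 3 := by
      gcongr
      linarith
    refine le_of_pow_le_pow_left₀ (n := 4) (by norm_num) (norm_nonneg _) ?_
    have h3 : K ^ 4 * V * (2 * (K * V * q)) ^ 4 = q ^ 3 := by
      linear_combination (q ^ 3) * hqe
    exact le_of_mul_le_mul_left (by linarith) (by positivity : 0 < K ^ 4 * V)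
  have main : K * V * q ≤ ‖LSeries (fun n ↦ (a n : ℂ)) (σ + t * Complex.I)‖ := by
    rcases le_total (1 + q) σ with h1 | h1
    · have := low' σ h1 hs2
      have : 0 ≤ K * V * q := by positivity
      linarith
    · have h2 := low' (1 + q) le_rfl (by linarith)
      have h3 := norm_sub_le_of_deriv_le h (t := t) hs h1
        (fun x hx ↦ hder' x (by linarith [hx.1]) (by linarith [hx.2]))
      have h4 := norm_sub_norm_le (LSeries (fun n ↦ (a n : ℂ)) ((1 + q : ℝ) + t * Complex.I))
        (LSeries (fun n ↦ (a n : ℂ)) (σ + t * Complex.I))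
      have h5 : K * V * (1 + q - σ) ≤ K * V * q := by
        gcongr
        linarith
      linarith
  calc (1 : ℝ) = 16 * K ^ 7 * V ^ 4 * (K * V * q) := by linear_combination -hqe
    _ ≤ _ := by gcongr

end IsVonMangoldt

end BeurlingPNT

namespace BeurlingPNT

open MeasureTheory Set Filter Asymptotics
open scoped Topology

variable {a : ℕ → ℝ} {c C η : ℝ}

/-- The indicator sequence of the positive integers. -/
noncomputable def oneSeq (n : ℕ) : ℝ := if n = 0 then 0 else 1

theorem powerSaving_oneSeq : PowerSaving oneSeq 1 1 (1 / 2) where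
  zero := by simp [oneSeq]
  nonneg n := by
    unfold oneSeq
    positivity
  η_pos := by norm_num
  η_lt := by norm_num
  C_nonneg := by norm_num
  c_nonneg := by norm_num
  bound x hx := by
    have h1 : ∑ k ∈ Finset.Icc 0 ⌊x⌋₊, oneSeq k = ⌊x⌋₊ := by
      have : ∀ n : ℕ, ∑ k ∈ Finset.Icc 0 n, oneSeq k = n := fun n ↦ by
        induction n with
        | zero => simp [oneSeq]
        | succ n ih => rw [Finset.sum_Icc_succ_top (by omega), ih]; simp [oneSeq]
      exact this _
    have h2 : (1 : ℝ) ≤ x ^ (1 - 1 / 2 : ℝ) := Real.one_le_rpow hx (by norm_num)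
    rw [errorTerm, h1, one_mul, one_mul, abs_le]
    constructor <;> linarith [Nat.floor_le (by linarith : 0 ≤ x), Nat.lt_floor_add_one x]

/-- The entire-near-`1` function `(s - 1) * LSeries a s` and its formal derivatives. -/
noncomputable def clearedDeriv (a : ℕ → ℝ) (c : ℝ) (j : ℕ) (s : ℂ) : ℂ :=
  (if j = 0 then (c : ℂ) else j * iteratedDeriv (j - 1) (PowerSaving.regularPart a c) s) +
    (s - 1) * iteratedDeriv j (PowerSaving.regularPart a c) s

namespace PowerSaving

theorem hasDerivAt_clearedDeriv (h : PowerSaving a c C η) (j : ℕ) {s : ℂ} (hs : 1 < s.re) :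
    HasDerivAt (clearedDeriv a c j) (clearedDeriv a c (j + 1) s) s := by
  have hη := h.η_pos
  have hd (j : ℕ) := h.hasDerivAt_iteratedDeriv_regularPart j (s := s) (by linarith)
  have h2 := ((hasDerivAt_id s).sub_const 1).mul (hd j)
  rcases j with _ | j
  · refine ((hasDerivAt_const s (c : ℂ)).add h2).congr_deriv ?_
    simp [clearedDeriv]
  · refine (((hd j).const_mul ((j + 1 : ℕ) : ℂ)).add h2).congr_deriv ?_
    simp [clearedDeriv]
    ring

theorem clearedDeriv_zero (h : PowerSaving a c C η) {s : ℂ} (hs : 1 < s.re) :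
    clearedDeriv a c 0 s = (s - 1) * LSeries (fun n ↦ (a n : ℂ)) s := by
  have h1 : s - 1 ≠ 0 := fun h0 ↦ by
    rw [sub_eq_zero] at h0
    simp [h0] at hs
  rw [h.lseries_eq hs, clearedDeriv]
  simp only [if_true, iteratedDeriv_zero]
  field_simp

theorem norm_sub_one_le {s : ℂ} (hs : 1 < s.re) (hs2 : s.re ≤ 2) : ‖s - 1‖ ≤ 1 + |s.im| := by
  refine (Complex.norm_le_abs_re_add_abs_im _).trans ?_
  simp only [Complex.sub_re, Complex.one_re, Complex.sub_im, Complex.one_im, sub_zero]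
  rw [abs_of_pos (by linarith)]
  linarith

theorem exists_norm_clearedDeriv_le (h : PowerSaving a c C η) {ε : ℝ} (hε : 0 < ε) (j : ℕ) :
    ∃ K : ℝ, 0 ≤ K ∧ ∀ s : ℂ, 1 < s.re → s.re ≤ 2 →
      ‖clearedDeriv a c j s‖ ≤ K * ((1 + |s.im|) * (1 + |s.im|) ^ ε) := by
  obtain ⟨K, hK, hKs⟩ := h.exists_norm_iteratedDeriv_regularPart_le hε j
  obtain ⟨K', hK', hKs'⟩ := h.exists_norm_iteratedDeriv_regularPart_le hε (j - 1)
  refine ⟨c + j * K' + K, by have := h.c_nonneg; positivity, fun s hs hs2 ↦ ?_⟩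
  have hV : 1 ≤ (1 + |s.im|) ^ ε := IsVonMangoldt.one_add_abs_rpow_ge s.im hε.le
  have hU : 1 ≤ 1 + |s.im| := by linarith [abs_nonneg s.im]
  have hc := h.c_nonneg
  calc ‖clearedDeriv a c j s‖
      ≤ (c + j * (K' * (1 + |s.im|) ^ ε)) + (1 + |s.im|) * (K * (1 + |s.im|) ^ ε) := by
        refine (norm_add_le _ _).trans (add_le_add ?_ ?_)
        · split_ifs with hj
          · rw [Complex.norm_real, Real.norm_of_nonneg hc]
            have : 0 ≤ j * (K' * (1 + |s.im|) ^ ε) := by positivity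
            linarith
          · rw [norm_mul, Complex.norm_natCast]
            have : j * ‖iteratedDeriv (j - 1) (regularPart a c) s‖ ≤
              j * (K' * (1 + |s.im|) ^ ε) := by
                gcongr
                exact hKs' s hs hs2
            linarith
        · rw [norm_mul]
          gcongr
          · exact norm_sub_one_le hs hs2
          · exact hKs s hs hs2
    _ ≤ _ := by
        have h1 : c ≤ c * ((1 + |s.im|) * (1 + |s.im|) ^ ε) :=
          le_mul_of_one_le_right hc (by nlinarith)
        have h2 : j * (K' * (1 + |s.im|) ^ ε) ≤ j * (K' * ((1 + |s.im|) * (1 + |s.im|) ^ ε)) := by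
          gcongr
          exact le_mul_of_one_le_left (by positivity) hU
        linarith

end PowerSaving

namespace IsVonMangoldt

variable {Λ : ℕ → ℝ}

theorem exists_norm_cleared_ge (h : PowerSaving a c C η) (hΛ : IsVonMangoldt a Λ) (hc : 0 < c)
    {ε : ℝ} (hε : 0 < ε) (hε1 : ε ≤ 1) : ∃ K : ℝ, 0 < K ∧
      ∀ s : ℂ, 1 < s.re → s.re ≤ 2 →
        1 + |s.im| ≤ K * (1 + |s.im|) ^ (4 * ε) * ‖clearedDeriv a c 0 s‖ := by
  have hη := h.η_pos
  obtain ⟨ρ, hρ, hnear⟩ : ∃ ρ > 0, ∀ s : ℂ, 1 < s.re → ‖s - 1‖ < 2 * ρ →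
      c / 2 ≤ ‖clearedDeriv a c 0 s‖ := by
    have hcont : ContinuousAt (fun s ↦ ‖clearedDeriv a c 0 s‖) 1 := by
      have h1 : ContinuousAt (PowerSaving.regularPart a c) 1 :=
        (h.differentiableAt_regularPart (by simpa using hη)).continuousAt
      have h2 : ContinuousAt (fun s ↦ ‖(c : ℂ) + (s - 1) * PowerSaving.regularPart a c s‖) 1 := by
        fun_prop
      refine h2.congr (Eventually.of_forall fun s ↦ ?_)
      simp [clearedDeriv]
    have h1 : c / 2 < ‖clearedDeriv a c 0 1‖ := by
      simp only [clearedDeriv, if_true, sub_self, zero_mul, add_zero, Complex.norm_real,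
        Real.norm_of_nonneg hc.le]
      linarith
    obtain ⟨δ, hδ, hδ'⟩ := Metric.eventually_nhds_iff.1 (hcont.eventually (lt_mem_nhds h1))
    refine ⟨δ / 2, by positivity, fun s _ hs ↦ (hδ' ?_).le⟩
    rw [dist_eq_norm]
    linarith
  obtain ⟨K, hK, hfar⟩ := hΛ.exists_norm_lseries_ge h hε hε1 hρ
  obtain ⟨m, hm, hmid⟩ : ∃ m : ℝ, 0 < m ∧ ∀ s : ℂ, 1 + ρ ≤ s.re →
      m ≤ ‖LSeries (fun n ↦ (a n : ℂ)) s‖ :=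
    ⟨_, Real.exp_pos _, fun s hs ↦ hΛ.norm_lseries_ge h (by linarith) hs⟩
  refine ⟨(1 + ρ⁻¹) * K + (1 + ρ) * (2 / c) + (1 + ρ) / (ρ * m), by positivity, fun s hs hs2 ↦ ?_⟩
  have hV := one_add_abs_rpow_ge s.im (ε := 4 * ε) (by positivity)
  set V := (1 + |s.im|) ^ (4 * ε)
  set Y := ‖clearedDeriv a c 0 s‖ with hY
  have hY0 : 0 ≤ Y := norm_nonneg _
  have hYeq : Y = ‖s - 1‖ * ‖LSeries (fun n ↦ (a n : ℂ)) s‖ := by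
    rw [hY, h.clearedDeriv_zero hs, norm_mul]
  have p1 : 0 ≤ (1 + ρ⁻¹) * K * (V * Y) := by positivity
  have p2 : 0 ≤ (1 + ρ) * (2 / c) * (V * Y) := by positivity
  have p3 : 0 ≤ (1 + ρ) / (ρ * m) * (V * Y) := by positivity
  have hVY : Y ≤ V * Y := le_mul_of_one_le_left hY0 hV
  rcases le_or_gt ρ |s.im| with ht | ht
  · have h1 := hfar s hs hs2 ht
    have h2 : 1 + |s.im| ≤ (1 + ρ⁻¹) * |s.im| := by
      have : 1 ≤ ρ⁻¹ * |s.im| := by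
        rw [inv_mul_eq_div, le_div_iff₀ hρ]
        linarith
      linarith
    have h3 : 1 + |s.im| ≤ (1 + ρ⁻¹) * K * (V * Y) := by
      calc _ ≤ (1 + ρ⁻¹) * |s.im| := h2
        _ ≤ (1 + ρ⁻¹) * ‖s - 1‖ := by
            gcongr
            exact abs_im_le_norm_sub_one s
        _ ≤ (1 + ρ⁻¹) * ‖s - 1‖ * (K * V * ‖LSeries (fun n ↦ (a n : ℂ)) s‖) :=
            le_mul_of_one_le_right (by positivity) h1
        _ = _ := by rw [hYeq]; ring
    linarith
  · rcases le_or_gt (1 + ρ) s.re with hr | hr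
    · have h1 := hmid s hr
      have h2 : ρ ≤ ‖s - 1‖ := by
        have := (le_abs_self _).trans (Complex.abs_re_le_norm (s - 1))
        simp only [Complex.sub_re, Complex.one_re] at this
        linarith
      have h3 : ρ * m ≤ V * Y := by
        refine le_trans ?_ hVY
        rw [hYeq]
        gcongr
      have h4 : 1 + ρ ≤ (1 + ρ) / (ρ * m) * (V * Y) := by
        rw [div_mul_eq_mul_div, le_div_iff₀ (by positivity)]
        gcongr
      linarith
    · have h1 : ‖s - 1‖ < 2 * ρ := by
        refine (Complex.norm_le_abs_re_add_abs_im _).trans_lt ?_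
        simp only [Complex.sub_re, Complex.one_re, Complex.sub_im, Complex.one_im, sub_zero]
        rw [abs_of_pos (by linarith)]
        linarith
      have h3 : c / 2 ≤ V * Y := (hnear s hs h1).trans hVY
      have h4 : 1 + ρ ≤ (1 + ρ) * (2 / c) * (V * Y) := by
        calc 1 + ρ = (1 + ρ) * (2 / c) * (c / 2) := by field_simp
          _ ≤ _ := by gcongr
      linarith

/-- The coefficients `Λ n - 1`. -/
noncomputable def excess (Λ : ℕ → ℝ) (n : ℕ) : ℂ := ((Λ n - 1 : ℝ) : ℂ)

theorem lseriesSummable_excess (h : PowerSaving a c C η) (hΛ : IsVonMangoldt a Λ) {s : ℂ}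
    (hs : 1 < s.re) : LSeriesSummable (excess Λ) s ∧ LSeries (excess Λ) s =
      LSeries (fun n ↦ (Λ n : ℂ)) s - LSeries (fun n ↦ (oneSeq n : ℂ)) s := by
  have h1 := (hΛ.lseriesSummable_vonMangoldt h hs)
  have h2 := powerSaving_oneSeq.lseriesSummable hs
  have h3 {n : ℕ} (hn : n ≠ 0) : ((fun n ↦ (Λ n : ℂ)) - fun n ↦ (oneSeq n : ℂ)) n = excess Λ n := by
    simp [excess, oneSeq, hn]
  refine ⟨(LSeriesSummable_congr s h3).1 (h1.sub h2), ?_⟩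
  rw [← LSeries_sub h1 h2]
  exact (LSeries_congr h3 s).symm

theorem abscissa_excess_le (h : PowerSaving a c C η) (hΛ : IsVonMangoldt a Λ) :
    LSeries.abscissaOfAbsConv (excess Λ) ≤ 1 :=
  LSeries.abscissaOfAbsConv_le_of_forall_lt_LSeriesSummable (x := 1)
    fun _ hy ↦ (hΛ.lseriesSummable_excess h (by simpa using hy)).1

theorem clearedDeriv_ne_zero (h : PowerSaving a c C η) (hΛ : IsVonMangoldt a Λ) {s : ℂ}
    (hs : 1 < s.re) : clearedDeriv a c 0 s ≠ 0 := by
  have h1 : s - 1 ≠ 0 := fun h0 ↦ by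
    rw [sub_eq_zero] at h0
    simp [h0] at hs
  rw [h.clearedDeriv_zero hs]
  exact mul_ne_zero h1 (hΛ.lseries_ne_zero h hs)

theorem lseries_excess_eq (h : PowerSaving a c C η) (hΛ : IsVonMangoldt a Λ) {s : ℂ}
    (hs : 1 < s.re) : LSeries (excess Λ) s =
      -(clearedDeriv a c 1 s / clearedDeriv a c 0 s) - PowerSaving.regularPart oneSeq 1 s := by
  have h1 : s - 1 ≠ 0 := fun h0 ↦ by
    rw [sub_eq_zero] at h0
    simp [h0] at hs
  have hZ := hΛ.lseries_ne_zero h hs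
  have hd : clearedDeriv a c 1 s = 1 * LSeries (fun n ↦ (a n : ℂ)) s + (s - 1) *
      -(LSeries (fun n ↦ (Λ n : ℂ)) s * LSeries (fun n ↦ (a n : ℂ)) s) := by
    refine (h.hasDerivAt_clearedDeriv 0 hs).unique (HasDerivAt.congr_of_eventuallyEq
      (((hasDerivAt_id s).sub_const 1).mul (hΛ.hasDerivAt_lseries h hs)) ?_)
    filter_upwards [(PowerSaving.isOpen_re_gt 1).mem_nhds hs] with w hw
    simp [h.clearedDeriv_zero hw]
  rw [(hΛ.lseriesSummable_excess h hs).2, powerSaving_oneSeq.lseries_eq hs, hd,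
    h.clearedDeriv_zero hs]
  simp only [Complex.ofReal_one]
  field_simp
  ring

theorem logMul_logMul_excess_eq (h : PowerSaving a c C η) (hΛ : IsVonMangoldt a Λ) {s : ℂ}
    (hs : 1 < s.re) : LSeries (LSeries.logMul (LSeries.logMul (excess Λ))) s =
      -(clearedDeriv a c 3 s / clearedDeriv a c 0 s -
        3 * (clearedDeriv a c 2 s / clearedDeriv a c 0 s) *
          (clearedDeriv a c 1 s / clearedDeriv a c 0 s) +
        2 * (clearedDeriv a c 1 s / clearedDeriv a c 0 s) ^ 3) -
      iteratedDeriv 2 (PowerSaving.regularPart oneSeq 1) s := by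
  have hq (j : ℕ) {s : ℂ} (hs : 1 < s.re) :
      HasDerivAt (fun s ↦ clearedDeriv a c j s / clearedDeriv a c 0 s)
        (clearedDeriv a c (j + 1) s / clearedDeriv a c 0 s -
          (clearedDeriv a c j s / clearedDeriv a c 0 s) *
          (clearedDeriv a c 1 s / clearedDeriv a c 0 s)) s := by
    have h0 := hΛ.clearedDeriv_ne_zero h hs
    refine ((h.hasDerivAt_clearedDeriv j hs).div (h.hasDerivAt_clearedDeriv 0 hs) h0).congr_deriv ?_
    field_simp
  have hR (j : ℕ) {s : ℂ} (hs : 1 < s.re) := powerSaving_oneSeq.hasDerivAt_iteratedDeriv_regularPart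
    j (s := s) (by linarith)
  have hdiff {s : ℂ} (hs : 1 < s.re) : -LSeries (LSeries.logMul (excess Λ)) s =
      -(clearedDeriv a c 2 s / clearedDeriv a c 0 s -
        (clearedDeriv a c 1 s / clearedDeriv a c 0 s) *
          (clearedDeriv a c 1 s / clearedDeriv a c 0 s)) -
      iteratedDeriv 1 (PowerSaving.regularPart oneSeq 1) s := by
    refine (LSeries_hasDerivAt (one_lt_of_lt (hΛ.abscissa_excess_le h) hs)).unique
      (((hq 1 hs).neg.sub (hR 0 hs)).congr_of_eventuallyEq ?_)
    filter_upwards [(PowerSaving.isOpen_re_gt 1).mem_nhds hs] with w hw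
    simp [hΛ.lseries_excess_eq h hw]
  have hdiff2 : -LSeries (LSeries.logMul (LSeries.logMul (excess Λ))) s =
      -(-((clearedDeriv a c 3 s / clearedDeriv a c 0 s -
          (clearedDeriv a c 2 s / clearedDeriv a c 0 s) *
            (clearedDeriv a c 1 s / clearedDeriv a c 0 s)) -
        ((clearedDeriv a c 2 s / clearedDeriv a c 0 s -
          (clearedDeriv a c 1 s / clearedDeriv a c 0 s) *
            (clearedDeriv a c 1 s / clearedDeriv a c 0 s)) *
          (clearedDeriv a c 1 s / clearedDeriv a c 0 s) +
        (clearedDeriv a c 1 s / clearedDeriv a c 0 s) *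
          (clearedDeriv a c 2 s / clearedDeriv a c 0 s -
          (clearedDeriv a c 1 s / clearedDeriv a c 0 s) *
            (clearedDeriv a c 1 s / clearedDeriv a c 0 s)))) -
      iteratedDeriv 2 (PowerSaving.regularPart oneSeq 1) s) := by
    refine (LSeries_hasDerivAt (one_lt_of_lt
      (LSeries.abscissaOfAbsConv_logMul.trans_le (hΛ.abscissa_excess_le h)) hs)).unique
      ((((hq 2 hs).sub ((hq 1 hs).mul (hq 1 hs))).neg.sub (hR 1 hs)).neg.congr_of_eventuallyEq ?_)
    filter_upwards [(PowerSaving.isOpen_re_gt 1).mem_nhds hs] with w hw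
    simp only [Pi.neg_apply, Pi.sub_apply, Pi.mul_apply]
    rw [← hdiff hw, neg_neg]
  rw [← neg_inj, hdiff2]
  ring

theorem exists_norm_logMul_logMul_excess_le (h : PowerSaving a c C η) (hΛ : IsVonMangoldt a Λ)
    (hc : 0 < c) : ∃ K : ℝ, 0 ≤ K ∧ ∀ s : ℂ, 1 < s.re → s.re ≤ 2 →
      ‖LSeries (LSeries.logMul (LSeries.logMul (excess Λ))) s‖ ≤
        K * (1 + |s.im|) ^ (1 / 4 : ℝ) := by
  have hε : (0 : ℝ) < 1 / 60 := by norm_num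
  obtain ⟨K0, hK0, h0⟩ := hΛ.exists_norm_cleared_ge h hc hε (by norm_num)
  obtain ⟨K1, hK1, h1⟩ := h.exists_norm_clearedDeriv_le hε 1
  obtain ⟨K2, hK2, h2⟩ := h.exists_norm_clearedDeriv_le hε 2
  obtain ⟨K3, hK3, h3⟩ := h.exists_norm_clearedDeriv_le hε 3
  obtain ⟨R, hR, hRs⟩ := powerSaving_oneSeq.exists_norm_iteratedDeriv_regularPart_le hε 2
  refine ⟨K3 * K0 + 3 * (K2 * K0) * (K1 * K0) + 2 * (K1 * K0) ^ 3 + R, by positivity,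
    fun s hs hs2 ↦ ?_⟩
  have hV := one_add_abs_rpow_ge s.im hε.le
  have hU : 0 < 1 + |s.im| := by linarith [abs_nonneg s.im]
  have hV4 : (1 + |s.im|) ^ (4 * (1 / 60) : ℝ) = ((1 + |s.im|) ^ (1 / 60 : ℝ)) ^ 4 := by
    rw [← Real.rpow_mul_natCast (by positivity), mul_comm]
    norm_num
  have hV15 : (1 + |s.im|) ^ (1 / 4 : ℝ) = ((1 + |s.im|) ^ (1 / 60 : ℝ)) ^ 15 := by
    rw [← Real.rpow_mul_natCast (by positivity)]
    norm_num
  have hY : 0 < ‖clearedDeriv a c 0 s‖ := norm_pos_iff.2 (hΛ.clearedDeriv_ne_zero h hs)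
  have hq (j : ℕ) {K : ℝ} (hK : 0 ≤ K)
      (hj : ‖clearedDeriv a c j s‖ ≤ K * ((1 + |s.im|) * (1 + |s.im|) ^ (1 / 60 : ℝ))) :
      ‖clearedDeriv a c j s / clearedDeriv a c 0 s‖ ≤
        K * K0 * ((1 + |s.im|) ^ (1 / 60 : ℝ)) ^ 5 := by
    rw [norm_div, div_le_iff₀ hY]
    refine hj.trans ?_
    have := h0 s hs hs2
    rw [hV4] at this
    calc _ ≤ K * ((K0 * ((1 + |s.im|) ^ (1 / 60 : ℝ)) ^ 4 * ‖clearedDeriv a c 0 s‖) *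
          (1 + |s.im|) ^ (1 / 60 : ℝ)) := by gcongr
      _ = _ := by ring
  have q1 := hq 1 hK1 (h1 s hs hs2)
  have q2 := hq 2 hK2 (h2 s hs hs2)
  have q3 := hq 3 hK3 (h3 s hs hs2)
  have r := hRs s hs hs2
  rw [hΛ.logMul_logMul_excess_eq h hs, hV15]
  generalize (1 + |s.im|) ^ (1 / 60 : ℝ) = V at *
  generalize clearedDeriv a c 1 s / clearedDeriv a c 0 s = y1 at *
  generalize clearedDeriv a c 2 s / clearedDeriv a c 0 s = y2 at *
  generalize clearedDeriv a c 3 s / clearedDeriv a c 0 s = y3 at *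
  generalize iteratedDeriv 2 (PowerSaving.regularPart oneSeq 1) s = z at *
  have hV5 : V ^ 5 ≤ V ^ 15 := pow_le_pow_right₀ hV (by norm_num)
  have hV10 : V ^ 10 ≤ V ^ 15 := pow_le_pow_right₀ hV (by norm_num)
  have hV1 : V ≤ V ^ 15 := le_self_pow₀ hV (by norm_num)
  calc ‖-(y3 - 3 * y2 * y1 + 2 * y1 ^ 3) - z‖
      ≤ (‖y3‖ + 3 * ‖y2‖ * ‖y1‖ + 2 * ‖y1‖ ^ 3) + ‖z‖ := by
        refine (norm_sub_le _ _).trans ?_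
        rw [norm_neg]
        gcongr
        refine (norm_add_le _ _).trans ?_
        gcongr
        · refine (norm_sub_le _ _).trans ?_
          simp
        · simp
    _ ≤ (K3 * K0 * V ^ 5 + 3 * (K2 * K0 * V ^ 5) * (K1 * K0 * V ^ 5) +
          2 * (K1 * K0 * V ^ 5) ^ 3) + R * V := by gcongr
    _ = K3 * K0 * V ^ 5 + 3 * (K2 * K0) * (K1 * K0) * V ^ 10 + 2 * (K1 * K0) ^ 3 * V ^ 15 +
          R * V := by ring
    _ ≤ K3 * K0 * V ^ 15 + 3 * (K2 * K0) * (K1 * K0) * V ^ 15 + 2 * (K1 * K0) ^ 3 * V ^ 15 +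
          R * V ^ 15 := by gcongr
    _ = _ := by ring

end IsVonMangoldt

end BeurlingPNT

namespace BeurlingPNT

open MeasureTheory Set Filter Asymptotics
open scoped Topology


theorem hasMellin_max_one_sub {s : ℂ} (hs : 0 < s.re) :
    HasMellin (fun u : ℝ ↦ ((max (1 - u) 0 : ℝ) : ℂ)) s (1 / (s * (s + 1))) := by
  have h1 := hasMellin_one_Ioc hs
  have h2 := hasMellin_cpow_Ioc 1 (s := s) (by simp; linarith)
  have h := hasMellin_sub h1.1 h2.1
  rw [h1.2, h2.2] at h
  have heq : EqOn (fun t : ℝ ↦ (t : ℂ) ^ (s - 1) •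
      ((Ioc 0 1).indicator (fun _ ↦ (1 : ℂ)) t -
        (Ioc 0 1).indicator (fun t : ℝ ↦ (t : ℂ) ^ (1 : ℂ)) t))
      (fun t : ℝ ↦ (t : ℂ) ^ (s - 1) • ((max (1 - t) 0 : ℝ) : ℂ)) (Ioi 0) := fun t ht ↦ by
    have ht0 : 0 < t := ht
    rcases le_or_gt t 1 with h1 | h1
    · simp [indicator, ht0, h1]
    · simp [indicator, h1.not_ge, h1.le]
  have hs0 : s ≠ 0 := fun h0 ↦ by simp [h0] at hs
  have hs1 : s + 1 ≠ 0 := fun h0 ↦ by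
    have := congrArg Complex.re h0
    simp at this
    linarith
  refine ⟨h.1.congr_fun heq measurableSet_Ioi, ?_⟩
  rw [mellin, ← setIntegral_congr_fun measurableSet_Ioi heq]
  refine h.2.trans ?_
  field_simp
  ring

theorem norm_inv_mul_add_one_le {σ : ℝ} (hσ : 1 ≤ σ) (t : ℝ) :
    ‖1 / (((σ : ℂ) + t * Complex.I) * ((σ : ℂ) + t * Complex.I + 1))‖ ≤
      4 * (1 + |t|) ^ (-2 : ℝ) := by
  have h (x : ℝ) (hx : 1 ≤ x) : (1 + |t|) / 2 ≤ ‖(x : ℂ) + t * Complex.I‖ := by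
    have h1 := (le_abs_self _).trans (Complex.abs_re_le_norm ((x : ℂ) + t * Complex.I))
    have h2 := Complex.abs_im_le_norm ((x : ℂ) + t * Complex.I)
    simp at h1 h2
    linarith
  have h1 := h σ hσ
  have h2 := h (σ + 1) (by linarith)
  rw [show ((σ + 1 : ℝ) : ℂ) + t * Complex.I = (σ : ℂ) + t * Complex.I + 1 by push_cast; ring] at h2
  have hU : 0 < 1 + |t| := by positivity
  rw [norm_div, norm_mul, norm_one, Real.rpow_neg hU.le, ← div_eq_mul_inv,
    div_le_div_iff₀ (mul_pos (by linarith) (by linarith)) (by positivity), Real.rpow_two]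
  nlinarith [mul_le_mul h1 h2 (by positivity) (by linarith)]

theorem integrable_one_add_abs_rpow {r : ℝ} (hr : 1 < r) :
    Integrable fun t : ℝ ↦ (1 + |t|) ^ (-r) := by
  simpa using integrable_one_add_norm (E := ℝ) (μ := volume) (r := r) (by simpa using hr)

theorem integrable_inv_mul_add_one {σ : ℝ} (hσ : 1 ≤ σ) :
    Integrable fun t : ℝ ↦ 1 / (((σ : ℂ) + t * Complex.I) * ((σ : ℂ) + t * Complex.I + 1)) := by
  refine Integrable.mono' ((integrable_one_add_abs_rpow (r := 2) (by norm_num)).const_mul 4)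
    ?_ (Eventually.of_forall (norm_inv_mul_add_one_le hσ))
  exact Measurable.aestronglyMeasurable (by fun_prop)

theorem continuous_ofReal_cpow_line {x : ℝ} (hx : 0 < x) (σ : ℝ) (k : ℂ) :
    Continuous fun t : ℝ ↦ (x : ℂ) ^ ((σ : ℂ) + t * Complex.I + k) := by
  have : (x : ℂ) ≠ 0 := by exact_mod_cast hx.ne'
  exact Continuous.const_cpow (by fun_prop) (.inl this)

theorem norm_cpow_line {x : ℝ} (hx : 0 < x) (σ t : ℝ) :
    ‖(x : ℂ) ^ ((σ : ℂ) + t * Complex.I)‖ = x ^ σ := by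
  rw [Complex.norm_cpow_eq_rpow_re_of_pos hx]
  simp

theorem integrable_cpow_mul_inv {x : ℝ} (hx : 0 < x) {σ : ℝ} (hσ : 1 ≤ σ) :
    Integrable fun t : ℝ ↦ (x : ℂ) ^ ((σ : ℂ) + t * Complex.I) *
      (1 / (((σ : ℂ) + t * Complex.I) * ((σ : ℂ) + t * Complex.I + 1))) := by
  refine (integrable_inv_mul_add_one hσ).bdd_mul (c := x ^ σ) ?_
    (Eventually.of_forall fun t ↦ (norm_cpow_line hx σ t).le)
  simpa using (continuous_ofReal_cpow_line hx σ 0).aestronglyMeasurable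

/-- The Perron formula for the Riesz mean of order one of a single term. -/
theorem integral_cpow_mul_inv {x : ℝ} (hx : 0 < x) {σ : ℝ} (hσ : 1 ≤ σ) :
    ∫ t : ℝ, (x : ℂ) ^ ((σ : ℂ) + t * Complex.I) *
      (1 / (((σ : ℂ) + t * Complex.I) * ((σ : ℂ) + t * Complex.I + 1))) =
      (2 * Real.pi) * ((max (1 - x⁻¹) 0 : ℝ) : ℂ) := by
  have hre (t : ℝ) : 0 < ((σ : ℂ) + t * Complex.I).re := by
    simp
    linarith
  have hm (t : ℝ) := (hasMellin_max_one_sub (hre t)).2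
  have hinv := mellinInv_mellin_eq σ (fun u : ℝ ↦ ((max (1 - u) 0 : ℝ) : ℂ)) (x := x⁻¹)
    (by positivity) (hasMellin_max_one_sub (s := σ) (by simp; linarith)).1
    (by
      rw [Complex.VerticalIntegrable]
      simp_rw [hm]
      exact integrable_inv_mul_add_one hσ) (by fun_prop)
  rw [mellinInv] at hinv
  simp_rw [hm] at hinv
  rw [← hinv, Complex.real_smul, ← mul_assoc]
  have hpi : (2 * Real.pi : ℂ) * ((1 / (2 * Real.pi) : ℝ) : ℂ) = 1 := by
    push_cast
    field_simp
  rw [hpi, one_mul]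
  refine integral_congr_ae (Eventually.of_forall fun t ↦ ?_)
  have : (x : ℂ).arg ≠ Real.pi := by
    rw [Complex.arg_ofReal_of_nonneg hx.le]
    exact Real.pi_pos.ne
  simp only [smul_eq_mul]
  rw [Complex.ofReal_inv, Complex.inv_cpow _ _ this, Complex.cpow_neg, inv_inv]

/-- The difference of two Perron kernels for Riesz means of order one. -/
noncomputable def rieszKernel (x y σ t : ℝ) : ℂ :=
  ((y : ℂ) ^ ((σ : ℂ) + t * Complex.I + 1) - (x : ℂ) ^ ((σ : ℂ) + t * Complex.I + 1)) *
    (1 / (((σ : ℂ) + t * Complex.I) * ((σ : ℂ) + t * Complex.I + 1)))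

theorem term_mul_rieszKernel_eq (f : ℕ → ℂ) {x y : ℝ} (hx : 0 < x) (hy : 0 < y) (σ t : ℝ) {n : ℕ}
    (hn : n ≠ 0) : LSeries.term f ((σ : ℂ) + t * Complex.I) n * rieszKernel x y σ t =
      f n * y * (((y / n : ℝ) : ℂ) ^ ((σ : ℂ) + t * Complex.I) *
        (1 / (((σ : ℂ) + t * Complex.I) * ((σ : ℂ) + t * Complex.I + 1)))) -
      f n * x * (((x / n : ℝ) : ℂ) ^ ((σ : ℂ) + t * Complex.I) *
        (1 / (((σ : ℂ) + t * Complex.I) * ((σ : ℂ) + t * Complex.I + 1)))) := by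
  have hn0 : (n : ℂ) ≠ 0 := by exact_mod_cast hn
  have hx0 : (x : ℂ) ≠ 0 := by exact_mod_cast hx.ne'
  have hy0 : (y : ℂ) ≠ 0 := by exact_mod_cast hy.ne'
  have hdiv {z : ℝ} (hz : 0 < z) (s : ℂ) : ((z / n : ℝ) : ℂ) ^ s = (z : ℂ) ^ s / (n : ℂ) ^ s := by
    rw [Complex.ofReal_div, Complex.div_cpow_ofReal_nonneg hz.le (Nat.cast_nonneg n)]
    simp
  rw [LSeries.term_of_ne_zero hn, rieszKernel, hdiv hx, hdiv hy, Complex.cpow_add _ _ hx0,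
    Complex.cpow_add _ _ hy0, Complex.cpow_one, Complex.cpow_one]
  ring

theorem integrable_rieszKernel {x y : ℝ} (hx : 0 < x) (hy : 0 < y) {σ : ℝ} (hσ : 1 ≤ σ) :
    Integrable (rieszKernel x y σ) := by
  have := (((integrable_cpow_mul_inv hy hσ).const_mul (y : ℂ)).sub
    ((integrable_cpow_mul_inv hx hσ).const_mul (x : ℂ)))
  refine this.congr (Eventually.of_forall fun t ↦ ?_)
  have := term_mul_rieszKernel_eq (fun _ ↦ 1) hx hy σ t one_ne_zero
  simp only [LSeries.term_of_ne_zero one_ne_zero, Nat.cast_one, Complex.one_cpow, div_one,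
    one_mul] at this
  simp only [Pi.sub_apply]
  exact this.symm

theorem hasSum_riesz {f : ℕ → ℂ} (hf0 : f 0 = 0) {σ : ℝ} (hσ : 1 ≤ σ)
    (hf : LSeriesSummable f σ) {x y : ℝ} (hx : 0 < x) (hy : 0 < y) :
    HasSum (fun n : ℕ ↦ (2 * Real.pi) * (f n * ((max (y - n) 0 - max (x - n) 0 : ℝ) : ℂ)))
      (∫ t : ℝ, LSeries f ((σ : ℂ) + t * Complex.I) * rieszKernel x y σ t) := by
  have hmul {z : ℝ} (hz : 0 < z) {n : ℕ} (hn : n ≠ 0) :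
      (z : ℂ) * ((max (1 - (z / n)⁻¹) 0 : ℝ) : ℂ) = ((max (z - n) 0 : ℝ) : ℂ) := by
    rw [← Complex.ofReal_mul, mul_max_of_nonneg _ _ hz.le]
    congr 2
    · field_simp
    · simp
  have hterm (n : ℕ) : ∫ t : ℝ, LSeries.term f ((σ : ℂ) + t * Complex.I) n * rieszKernel x y σ t =
      (2 * Real.pi) * (f n * ((max (y - n) 0 - max (x - n) 0 : ℝ) : ℂ)) := by
    rcases eq_or_ne n 0 with rfl | hn
    · simp [hf0]
    have hn0 : (0 : ℝ) < n := by exact_mod_cast Nat.pos_of_ne_zero hn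
    simp_rw [term_mul_rieszKernel_eq f hx hy σ _ hn]
    rw [integral_sub ((integrable_cpow_mul_inv (by positivity) hσ).const_mul _)
      ((integrable_cpow_mul_inv (by positivity) hσ).const_mul _), integral_const_mul,
      integral_const_mul, integral_cpow_mul_inv (by positivity) hσ,
      integral_cpow_mul_inv (by positivity) hσ, Complex.ofReal_sub, ← hmul hx hn, ← hmul hy hn]
    ring
  have hnorm (n : ℕ) (t : ℝ) :
      ‖LSeries.term f ((σ : ℂ) + t * Complex.I) n‖ = ‖LSeries.term f σ n‖ := by
    simp [LSeries.norm_term_eq]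
  have hmeas (n : ℕ) : AEStronglyMeasurable
      (fun t : ℝ ↦ LSeries.term f ((σ : ℂ) + t * Complex.I) n) volume := by
    rcases eq_or_ne n 0 with rfl | hn
    · simpa using aestronglyMeasurable_const
    have hn0 : (n : ℂ) ≠ 0 := by exact_mod_cast hn
    have hcont : Continuous fun t : ℝ ↦ (n : ℂ) ^ ((σ : ℂ) + t * Complex.I) :=
      Continuous.const_cpow (by fun_prop) (.inl hn0)
    simp only [LSeries.term_of_ne_zero hn]
    exact (continuous_const.div hcont fun t ↦ by simp [hn0]).aestronglyMeasurable
  have := hasSum_integral_of_summable_integral_norm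
    (F := fun n (t : ℝ) ↦ LSeries.term f ((σ : ℂ) + t * Complex.I) n * rieszKernel x y σ t)
    (μ := volume)
    (fun n ↦ (integrable_rieszKernel hx hy hσ).bdd_mul (hmeas n)
      (Eventually.of_forall fun t ↦ (hnorm n t).le))
    (by
      simp_rw [norm_mul, hnorm, integral_const_mul]
      exact hf.norm.mul_right _)
  simp_rw [hterm, tsum_mul_right] at this
  exact this

end BeurlingPNT

namespace BeurlingPNT

open MeasureTheory Set Filter Asymptotics
open scoped Topology

variable {a : ℕ → ℝ} {c C η : ℝ}

theorem norm_one_add_cpow_sub_one_le {σ : ℝ} (hσ : 1 ≤ σ) (hσ2 : σ ≤ 2) {δ : ℝ} (hδ : 0 < δ)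
    (hδ1 : δ ≤ 1) (t : ℝ) :
    ‖((1 + δ : ℝ) : ℂ) ^ ((σ : ℂ) + t * Complex.I + 1) - 1‖ ≤ 11 * √(δ * (1 + |t|)) := by
  set s : ℂ := (σ : ℂ) + t * Complex.I + 1 with hs
  have hre : s.re = σ + 1 := by simp [hs]
  have hU : 0 < 1 + |t| := by positivity
  have hs0 : s ≠ 0 := fun h0 ↦ by
    rw [h0] at hre
    simp at hre
    linarith
  have hsn : ‖s‖ ≤ 3 * (1 + |t|) := by
    refine (Complex.norm_le_abs_re_add_abs_im _).trans ?_
    rw [hre, abs_of_pos (by linarith)]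
    simp only [hs, Complex.add_im, Complex.ofReal_im, Complex.mul_im, Complex.ofReal_re,
      Complex.I_im, mul_one, Complex.I_re, mul_zero, add_zero, zero_add, Complex.one_im]
    linarith [abs_nonneg t]
  have h1 : ‖((1 + δ : ℝ) : ℂ) ^ s - 1‖ ≤ 9 := by
    refine (norm_sub_le _ _).trans ?_
    rw [Complex.norm_cpow_eq_rpow_re_of_pos (by linarith), hre, norm_one]
    have : (1 + δ) ^ (σ + 1) ≤ 2 ^ (3 : ℝ) :=
      (Real.rpow_le_rpow (by linarith) (by linarith) (by linarith)).trans
        (Real.rpow_le_rpow_of_exponent_le (by norm_num) (by linarith))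
    norm_num at this
    linarith
  have h2 : ‖((1 + δ : ℝ) : ℂ) ^ s - 1‖ ≤ 12 * (δ * (1 + |t|)) := by
    have := norm_image_sub_le_of_norm_deriv_le_segment' (f := fun u : ℝ ↦ (u : ℂ) ^ s)
      (f' := fun u : ℝ ↦ s * (u : ℂ) ^ (s - 1)) (a := 1) (b := 1 + δ) (C := 12 * (1 + |t|))
      (fun u hu ↦ ?_) (fun u hu ↦ ?_) (1 + δ) (right_mem_Icc.2 (by linarith))
    · simp only [Complex.ofReal_one, Complex.one_cpow, add_sub_cancel_left] at this
      linarith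
    · exact (hasDerivAt_ofReal_cpow_const (by linarith [hu.1] : u ≠ 0) hs0).hasDerivWithinAt
    · have hu0 : 0 < u := by linarith [hu.1]
      rw [norm_mul, Complex.norm_cpow_eq_rpow_re_of_pos hu0, Complex.sub_re, hre, Complex.one_re,
        add_sub_cancel_right]
      have : u ^ σ ≤ 2 ^ (2 : ℝ) :=
        (Real.rpow_le_rpow hu0.le (by linarith [hu.2]) (by linarith)).trans
          (Real.rpow_le_rpow_of_exponent_le (by norm_num) (by linarith))
      norm_num at this
      calc _ ≤ 3 * (1 + |t|) * 4 := by gcongr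
        _ = _ := by ring
  refine le_of_sq_le_sq ?_ (by positivity)
  rw [mul_pow, Real.sq_sqrt (by positivity), sq]
  calc _ ≤ 9 * (12 * (δ * (1 + |t|))) := mul_le_mul h1 h2 (norm_nonneg _) (by norm_num)
    _ ≤ _ := by nlinarith [mul_pos hδ hU]

theorem rpow_one_add_inv_le {x : ℝ} (hx : 1 ≤ x) :
    x ^ (1 + (1 + Real.log x)⁻¹ + 1) ≤ 3 * x ^ 2 := by
  have hl := Real.log_nonneg hx
  have hx0 : 0 < x := by linarith
  have h1 : x ^ (1 + Real.log x)⁻¹ ≤ 3 := by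
    rw [Real.rpow_def_of_pos hx0, ← div_eq_mul_inv]
    refine (Real.exp_le_exp.2 ((div_le_one (by linarith)).2 (by linarith))).trans ?_
    linarith [Real.exp_one_lt_d9]
  rw [show 1 + (1 + Real.log x)⁻¹ + 1 = (1 + Real.log x)⁻¹ + 2 by ring, Real.rpow_add hx0,
    Real.rpow_two]
  gcongr

namespace IsVonMangoldt

variable {Λ : ℕ → ℝ}

theorem logMul_logMul_excess (n : ℕ) : LSeries.logMul (LSeries.logMul (excess Λ)) n =
    (((Λ n - 1) * Real.log n ^ 2 : ℝ) : ℂ) := by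
  rw [LSeries.logMul, LSeries.logMul, excess, Complex.natCast_log.symm]
  push_cast
  ring

theorem exists_abs_sum_riesz_le (h : PowerSaving a c C η) (hΛ : IsVonMangoldt a Λ) (hc : 0 < c) :
    ∃ K : ℝ, 0 ≤ K ∧ ∀ (x δ : ℝ) (M : ℕ), 1 ≤ x → 0 < δ → δ ≤ 1 → (1 + δ) * x < M + 1 →
      |∑ n ∈ Finset.Icc 1 M, (Λ n - 1) * Real.log n ^ 2 *
        (max ((1 + δ) * x - n) 0 - max (x - n) 0)| ≤ K * (x ^ 2 * √δ) := by
  obtain ⟨K, hK, hG⟩ := hΛ.exists_norm_logMul_logMul_excess_le h hc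
  set J := ∫ t : ℝ, (1 + |t|) ^ (-(5 / 4) : ℝ) with hJ
  have hJ0 : 0 ≤ J := integral_nonneg fun t ↦ by positivity
  refine ⟨132 * K * J, by positivity, fun x δ M hx hδ hδ1 hM ↦ ?_⟩
  have hl := Real.log_nonneg hx
  have hx0 : 0 < x := by linarith
  set σ : ℝ := 1 + (1 + Real.log x)⁻¹ with hσdef
  have hσ : 1 < σ := by
    have : 0 < (1 + Real.log x)⁻¹ := by positivity
    linarith
  have hσ2 : σ ≤ 2 := by
    have : (1 + Real.log x)⁻¹ ≤ 1 := inv_le_one_of_one_le₀ (by linarith)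
    linarith
  have hsum := hasSum_riesz (f := LSeries.logMul (LSeries.logMul (excess Λ)))
    (by simp [LSeries.logMul]) hσ.le (LSeriesSummable_logMul_of_lt_re (one_lt_of_lt
      (LSeries.abscissaOfAbsConv_logMul.trans_le (hΛ.abscissa_excess_le h)) (by simpa using hσ)))
    hx0 (y := (1 + δ) * x) (by positivity)
  have hfin : HasSum (fun n : ℕ ↦ (2 * Real.pi) * (LSeries.logMul (LSeries.logMul (excess Λ)) n *
      ((max ((1 + δ) * x - n) 0 - max (x - n) 0 : ℝ) : ℂ)))
      (∑ n ∈ Finset.Icc 1 M, (2 * Real.pi) * (LSeries.logMul (LSeries.logMul (excess Λ)) n *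
      ((max ((1 + δ) * x - n) 0 - max (x - n) 0 : ℝ) : ℂ))) := by
    refine hasSum_sum_of_ne_finset_zero fun n hn ↦ ?_
    rcases eq_or_ne n 0 with rfl | hn0
    · simp [LSeries.logMul]
    · have : M + 1 ≤ n := by
        simp only [Finset.mem_Icc] at hn
        omega
      have : (M : ℝ) + 1 ≤ n := by exact_mod_cast this
      rw [max_eq_right (by linarith), max_eq_right (by nlinarith)]
      simp
  have heq := hsum.unique hfin
  have hsq : (fun t : ℝ ↦ K * (1 + |t|) ^ (1 / 4 : ℝ) *
      (3 * x ^ 2 * (11 * √(δ * (1 + |t|))) * (4 * (1 + |t|) ^ (-2 : ℝ)))) =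
      fun t ↦ 132 * K * (x ^ 2 * √δ) * (1 + |t|) ^ (-(5 / 4) : ℝ) := by
    ext t
    have hU : 0 < 1 + |t| := by positivity
    rw [show (-(5 / 4) : ℝ) = 1 / 4 + 1 / 2 + -2 by norm_num, Real.rpow_add hU, Real.rpow_add hU,
      Real.sqrt_mul hδ.le, Real.sqrt_eq_rpow (1 + |t|)]
    ring
  have hbound := norm_integral_le_of_norm_le
    (f := fun t : ℝ ↦ LSeries (LSeries.logMul (LSeries.logMul (excess Λ)))
      ((σ : ℂ) + t * Complex.I) * rieszKernel x ((1 + δ) * x) σ t)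
    (g := fun t : ℝ ↦ K * (1 + |t|) ^ (1 / 4 : ℝ) *
      (3 * x ^ 2 * (11 * √(δ * (1 + |t|))) * (4 * (1 + |t|) ^ (-2 : ℝ))))
    (by
      rw [hsq]
      exact (integrable_one_add_abs_rpow (by norm_num)).const_mul _)
    (Eventually.of_forall fun t ↦ by
      rw [norm_mul, rieszKernel, norm_mul]
      gcongr
      · have := hG ((σ : ℂ) + t * Complex.I) (by simpa using hσ) (by simpa using hσ2)
        simpa using this
      · rw [Complex.ofReal_mul, Complex.mul_cpow_ofReal_nonneg (by linarith) hx0.le,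
          ← sub_one_mul, norm_mul, mul_comm]
        gcongr
        · rw [Complex.norm_cpow_eq_rpow_re_of_pos hx0]
          simpa using rpow_one_add_inv_le hx
        · exact norm_one_add_cpow_sub_one_le hσ.le hσ2 hδ hδ1 t
      · exact norm_inv_mul_add_one_le hσ.le t)
  rw [heq, hsq, integral_const_mul, ← hJ] at hbound
  have hreal : ∑ n ∈ Finset.Icc 1 M, (2 * Real.pi) *
      (LSeries.logMul (LSeries.logMul (excess Λ)) n *
        ((max ((1 + δ) * x - n) 0 - max (x - n) 0 : ℝ) : ℂ)) =
      ((2 * Real.pi * ∑ n ∈ Finset.Icc 1 M, (Λ n - 1) * Real.log n ^ 2 *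
        (max ((1 + δ) * x - n) 0 - max (x - n) 0) : ℝ) : ℂ) := by
    rw [← Finset.mul_sum]
    push_cast [logMul_logMul_excess]
    rfl
  rw [hreal, Complex.norm_real, Real.norm_eq_abs, abs_mul, abs_of_pos (by positivity)] at hbound
  have hpi : 1 ≤ 2 * Real.pi := by linarith [Real.pi_gt_three]
  calc _ ≤ 2 * Real.pi * |∑ n ∈ Finset.Icc 1 M, (Λ n - 1) * Real.log n ^ 2 *
        (max ((1 + δ) * x - n) 0 - max (x - n) 0)| := le_mul_of_one_le_left (abs_nonneg _) hpi
    _ ≤ _ := hbound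
    _ = _ := by ring

theorem sum_sub_le {K w δ : ℝ} {N M : ℕ} (hnn : ∀ n, 0 ≤ Λ n)
    (hK : |∑ n ∈ Finset.Icc 1 M, (Λ n - 1) * Real.log n ^ 2 *
        (max ((1 + δ) * w - n) 0 - max (w - n) 0)| ≤ K) (hw : w = N) (hδ : 0 < δ) (hN : 1 ≤ N)
    (hNM : N ≤ M) (hM : M ≤ (1 + δ) * w) :
    δ * w * ∑ n ∈ Finset.Icc 1 N, (Λ n - 1) * Real.log n ^ 2 ≤
      K + δ * w * (δ * w * Real.log M ^ 2) := by
  have hw0 : 0 < w := by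
    rw [hw]
    exact_mod_cast hN
  have hMN : (M : ℝ) - N ≤ δ * w := by linarith
  have hφ (n : ℕ) : 0 ≤ max ((1 + δ) * w - n) 0 - max (w - n) 0 ∧
      max ((1 + δ) * w - n) 0 - max (w - n) 0 ≤ δ * w := by
    have : 0 < δ * w := by positivity
    rcases le_total (w - n) 0 with h1 | h1 <;> rcases le_total ((1 + δ) * w - n) 0 with h2 | h2 <;>
      simp only [max_eq_left, max_eq_right, h1, h2] <;> constructor <;> linarith
  have hsplit : Finset.Icc 1 M = Finset.Icc 1 N ∪ Finset.Ioc N M := by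
    ext n
    simp only [Finset.mem_Icc, Finset.mem_union, Finset.mem_Ioc]
    omega
  have hdisj : Disjoint (Finset.Icc 1 N) (Finset.Ioc N M) := by
    rw [Finset.disjoint_left]
    intro n
    simp only [Finset.mem_Icc, Finset.mem_Ioc]
    omega
  rw [hsplit, Finset.sum_union hdisj] at hK
  have h1 : ∑ n ∈ Finset.Icc 1 N, (Λ n - 1) * Real.log n ^ 2 *
      (max ((1 + δ) * w - n) 0 - max (w - n) 0) =
      δ * w * ∑ n ∈ Finset.Icc 1 N, (Λ n - 1) * Real.log n ^ 2 := by
    rw [Finset.mul_sum]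
    refine Finset.sum_congr rfl fun n hn ↦ ?_
    have : (n : ℝ) ≤ w := by
      rw [hw]
      exact_mod_cast (Finset.mem_Icc.1 hn).2
    have h2 : (n : ℝ) ≤ (1 + δ) * w := by nlinarith
    rw [max_eq_left (by linarith), max_eq_left (by linarith)]
    ring
  have h2 : -(δ * w * (δ * w * Real.log M ^ 2)) ≤ ∑ n ∈ Finset.Ioc N M,
      (Λ n - 1) * Real.log n ^ 2 * (max ((1 + δ) * w - n) 0 - max (w - n) 0) := by
    have : ∑ n ∈ Finset.Ioc N M, -(Real.log M ^ 2 * (δ * w)) ≤ ∑ n ∈ Finset.Ioc N M,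
      (Λ n - 1) * Real.log n ^ 2 * (max ((1 + δ) * w - n) 0 - max (w - n) 0) := by
      refine Finset.sum_le_sum fun n hn ↦ ?_
      obtain ⟨hn1, hn2⟩ := Finset.mem_Ioc.1 hn
      have hlog : Real.log n ^ 2 ≤ Real.log M ^ 2 := by
        have : (0 : ℝ) < n := by exact_mod_cast (by omega : 0 < n)
        gcongr
      have e1 : 0 ≤ Λ n * Real.log n ^ 2 * (max ((1 + δ) * w - n) 0 - max (w - n) 0) :=
        mul_nonneg (mul_nonneg (hnn n) (by positivity)) (hφ n).1
      have e2 : Real.log n ^ 2 * (max ((1 + δ) * w - n) 0 - max (w - n) 0) ≤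
          Real.log M ^ 2 * (δ * w) :=
        mul_le_mul hlog (hφ n).2 (hφ n).1 (by positivity)
      linarith
    rw [Finset.sum_const, Nat.card_Ioc, nsmul_eq_mul, Nat.cast_sub hNM] at this
    refine le_trans ?_ this
    have : ((M : ℝ) - N) * (Real.log M ^ 2 * (δ * w)) ≤ δ * w * (Real.log M ^ 2 * (δ * w)) := by
      gcongr
    linarith
  rw [h1] at hK
  have := (abs_le.1 hK).2
  linarith

theorem le_sum_sub {K w δ : ℝ} {N : ℕ} (hnn : ∀ n, 0 ≤ Λ n)
    (hK : |∑ n ∈ Finset.Icc 1 N, (Λ n - 1) * Real.log n ^ 2 *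
        (max ((1 + δ) * w - n) 0 - max (w - n) 0)| ≤ K) (hw : (1 + δ) * w = N) (hδ : 0 < δ)
    (hN : 1 ≤ N) :
    -(K + δ * w * ((δ * w + 1) * Real.log N ^ 2)) ≤
      δ * w * ∑ n ∈ Finset.Icc 1 N, (Λ n - 1) * Real.log n ^ 2 := by
  have hN0 : (0 : ℝ) < N := by exact_mod_cast hN
  have hw0 : 0 < w := by
    by_contra! h0
    nlinarith
  have hdw : 0 < δ * w := by positivity
  have hφ (n : ℕ) : max ((1 + δ) * w - n) 0 - max (w - n) 0 ≤ δ * w := by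
    rcases le_total (w - n) 0 with h1 | h1 <;> rcases le_total ((1 + δ) * w - n) 0 with h2 | h2 <;>
      simp only [max_eq_left, max_eq_right, h1, h2] <;> linarith
  have key : ∑ n ∈ Finset.Icc 1 N, ((Λ n - 1) * Real.log n ^ 2 *
        (max ((1 + δ) * w - n) 0 - max (w - n) 0) -
          if n ≤ ⌊w⌋₊ then 0 else δ * w * Real.log N ^ 2) ≤
      ∑ n ∈ Finset.Icc 1 N, δ * w * ((Λ n - 1) * Real.log n ^ 2) := by
    refine Finset.sum_le_sum fun n hn ↦ ?_
    obtain ⟨hn1, hn2⟩ := Finset.mem_Icc.1 hn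
    have hn0 : (0 : ℝ) < n := by exact_mod_cast hn1
    split_ifs with hnw
    · have h1 : (n : ℝ) ≤ w := (Nat.le_floor_iff hw0.le).1 hnw
      have h2 : (n : ℝ) ≤ (1 + δ) * w := by nlinarith
      rw [max_eq_left (by linarith), max_eq_left (by linarith)]
      linarith
    · have hlog : Real.log n ^ 2 ≤ Real.log N ^ 2 := by
        gcongr
      have h1 : w < n := (Nat.floor_lt hw0.le).1 (by omega)
      have h2 : (n : ℝ) ≤ (1 + δ) * w := by
        rw [hw]
        exact_mod_cast hn2
      have e1 : Λ n * Real.log n ^ 2 * (max ((1 + δ) * w - n) 0 - max (w - n) 0) ≤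
          Λ n * Real.log n ^ 2 * (δ * w) :=
        mul_le_mul_of_nonneg_left (hφ n) (mul_nonneg (hnn n) (by positivity))
      have e2 : 0 ≤ Real.log n ^ 2 * (max ((1 + δ) * w - n) 0 - max (w - n) 0) := by
        rw [max_eq_left (by linarith), max_eq_right (by linarith)]
        exact mul_nonneg (by positivity) (by linarith)
      have e3 : δ * w * Real.log n ^ 2 ≤ δ * w * Real.log N ^ 2 := by gcongr
      linarith
  rw [Finset.sum_sub_distrib, ← Finset.mul_sum] at key
  have hcount : ∑ n ∈ Finset.Icc 1 N, (if n ≤ ⌊w⌋₊ then 0 else δ * w * Real.log N ^ 2) ≤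
      (δ * w + 1) * (δ * w * Real.log N ^ 2) := by
    have hwN : ⌊w⌋₊ ≤ N := by
      have : w ≤ N := by nlinarith
      exact Nat.floor_le_of_le this
    rw [Finset.sum_ite, Finset.sum_const_zero, zero_add, Finset.sum_const, nsmul_eq_mul]
    have hsub : (Finset.Icc 1 N).filter (fun n ↦ ¬ n ≤ ⌊w⌋₊) ⊆ Finset.Ioc ⌊w⌋₊ N := fun n ↦ by
      simp only [Finset.mem_filter, Finset.mem_Icc, Finset.mem_Ioc]
      omega
    have hcard := Finset.card_le_card hsub
    rw [Nat.card_Ioc] at hcard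
    have h3 : (((Finset.Icc 1 N).filter (fun n ↦ ¬ n ≤ ⌊w⌋₊)).card : ℝ) ≤ N - ⌊w⌋₊ := by
      rw [← Nat.cast_sub hwN]
      exact_mod_cast hcard
    gcongr
    linarith [Nat.lt_floor_add_one w]
  have := (abs_le.1 hK).1
  linarith

/-- The prime number theorem with a power of the logarithm saved, for Beurling-type systems whose
counting function has a power saving error term. -/
theorem exists_abs_sum_le (h : PowerSaving a c C η) (hΛ : IsVonMangoldt a Λ) (hc : 0 < c) :
    ∃ K : ℝ, 0 ≤ K ∧ ∀ N : ℕ, 2 ≤ N →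
      |∑ n ∈ Finset.Icc 1 N, (Λ n - 1) * Real.log n ^ 2| ≤ K * (N * Real.log N) := by
  obtain ⟨K, hK, hKs⟩ := hΛ.exists_abs_sum_riesz_le h hc
  refine ⟨2 * K + 2 + 1, by positivity, fun N hN ↦ ?_⟩
  have hN0 : (2 : ℝ) ≤ N := by exact_mod_cast hN
  set l := Real.log N with hl
  have hl2 : 1 ≤ 2 * l := by
    have : Real.log 2 ≤ l := Real.log_le_log (by norm_num) hN0
    linarith [Real.log_two_gt_d9]
  have hl0 : 0 < l := by linarith
  have hlN : l ≤ N := (Real.log_le_self (by linarith))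
  set δ : ℝ := (2 * l)⁻¹ with hδdef
  have hδ : 0 < δ := by positivity
  have hδ1 : δ ≤ 1 := inv_le_one_of_one_le₀ hl2
  have hδl : δ * (2 * l) = 1 := inv_mul_cancel₀ (by positivity)
  have hsq : √δ ≤ δ * (2 * l) := by
    rw [hδl]
    exact Real.sqrt_le_one.2 hδ1
  rw [abs_le]
  constructor
  · set w : ℝ := N / (1 + δ) with hw
    have hwN : (1 + δ) * w = N := by
      rw [hw]
      field_simp
    have hw1 : 1 ≤ w := by
      rw [hw, le_div_iff₀ (by linarith)]
      linarith
    have hwle : w ≤ N := by nlinarith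
    have h1 := hKs w δ N hw1 hδ hδ1 (by rw [hwN]; linarith)
    have h2 := le_sum_sub hΛ.nonneg h1 hwN hδ (by omega)
    have hdw : 0 < δ * w := by positivity
    refine le_of_mul_le_mul_left (le_trans ?_ h2) hdw
    have e1 : K * (w ^ 2 * √δ) ≤ δ * w * (2 * K * (N * l)) := by
      calc K * (w ^ 2 * √δ) ≤ K * ((w * N) * (δ * (2 * l))) := by
            rw [sq]
            gcongr
        _ = _ := by ring
    have e2 : (δ * w + 1) * l ^ 2 ≤ 3 * (N * l) := by
      have : δ * w * l ^ 2 ≤ δ * N * l ^ 2 := by gcongr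
      have e3 : δ * N * l ^ 2 = N * l / 2 := by linear_combination (N * l / 2) * hδl
      nlinarith
    have e4 := mul_le_mul_of_nonneg_left e2 hdw.le
    linarith
  · have hNn : (N : ℝ) ≤ (1 + δ) * N := by nlinarith
    have h1 := hKs N δ ⌊(1 + δ) * N⌋₊ (by linarith) hδ hδ1 (Nat.lt_floor_add_one _)
    have h2 := sum_sub_le hΛ.nonneg h1 rfl hδ (by omega) (Nat.le_floor hNn)
      (Nat.floor_le (by positivity))
    have hdw : 0 < δ * N := by positivity
    refine le_of_mul_le_mul_left (h2.trans ?_) hdw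
    have e1 : K * ((N : ℝ) ^ 2 * √δ) ≤ δ * N * (2 * K * (N * l)) := by
      calc K * ((N : ℝ) ^ 2 * √δ) ≤ K * ((N * N) * (δ * (2 * l))) := by
            rw [sq]
            gcongr
        _ = _ := by ring
    have hM : Real.log ⌊(1 + δ) * N⌋₊ ≤ 2 * l := by
      have hpos : 0 < ⌊(1 + δ) * (N : ℝ)⌋₊ := Nat.floor_pos.2 (by linarith)
      calc Real.log ⌊(1 + δ) * N⌋₊ ≤ Real.log (N ^ 2) := by
            refine Real.log_le_log (by exact_mod_cast hpos) ?_
            refine (Nat.floor_le (by positivity)).trans ?_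
            nlinarith
        _ = 2 * l := by rw [Real.log_pow, hl]; norm_num
    have hM2 : Real.log ⌊(1 + δ) * N⌋₊ ^ 2 ≤ (2 * l) ^ 2 := by
      gcongr
    have e2 : δ * N * Real.log ⌊(1 + δ) * N⌋₊ ^ 2 ≤ 2 * (N * l) := by
      calc _ ≤ δ * N * (2 * l) ^ 2 := by gcongr
        _ = _ := by linear_combination (2 * N * l) * hδl
    have e4 := mul_le_mul_of_nonneg_left e2 hdw.le
    have e5 : 0 ≤ δ * N * (N * l) := by positivity
    linarith

end IsVonMangoldt

end BeurlingPNT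

namespace LatticeSum

open MeasureTheory Module

variable {E ι : Type*} [NormedAddCommGroup E] [NormedSpace ℝ E] [FiniteDimensional ℝ E]
  [MeasurableSpace E] [BorelSpace E] [Finite ι]

/-- The integral of a function with bounded support, unfolded over a lattice. -/
theorem integral_eq_sum (μ : Measure E) [μ.IsAddHaarMeasure] (b : Basis ι ℝ E) {f : E → ℝ}
    (hf : Integrable f μ) {D M : ℝ} (hD : ∀ y ∈ ZSpan.fundamentalDomain b, ‖y‖ ≤ D)
    (hM : ∀ x, f x ≠ 0 → ‖x‖ ≤ M) (T : Finset (Submodule.span ℤ (Set.range b)))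
    (hT : ∀ x : Submodule.span ℤ (Set.range b), ‖(x : E)‖ ≤ M + D → x ∈ T) :
    ∫ x, f x ∂μ = ∑ x ∈ T, ∫ y in ZSpan.fundamentalDomain b, f (x + y) ∂μ := by
  have : VAddInvariantMeasure (Submodule.span ℤ (Set.range b)) E μ :=
    ⟨fun x s _ ↦ measure_preimage_add μ (x : E) s⟩
  rw [(ZSpan.isAddFundamentalDomain b μ).integral_eq_tsum'' f hf]
  refine tsum_eq_sum fun x hx ↦ ?_
  refine setIntegral_eq_zero_of_forall_eq_zero fun y hy ↦ ?_
  by_contra h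
  refine hx (hT x ?_)
  have h1 := hM _ h
  have h2 := hD y hy
  have h3 : ‖(x : E)‖ ≤ ‖(x : E) + y‖ + ‖y‖ := by simpa using norm_sub_le ((x : E) + y) y
  change ‖(x : E) + y‖ ≤ M at h1
  linarith

/-- Riemann sums of a compactly supported Lipschitz function over a lattice. -/
theorem exists_abs_tsum_sub_le (b : Basis ι ℝ E) {Φ : E → ℝ} {K : NNReal}
    (hΦ : LipschitzWith K Φ) {B : ℝ} (hB : ∀ x, Φ x ≠ 0 → ‖x‖ ≤ B) :
    ∃ c C : ℝ, 0 ≤ C ∧ ∀ R : ℝ, 1 ≤ R →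
      |∑' x : Submodule.span ℤ (Set.range b), Φ (R⁻¹ • (x : E)) - c * R ^ finrank ℝ E| ≤
        C * R ^ finrank ℝ E / R := by
  let μ : Measure E := Measure.addHaar
  set F := ZSpan.fundamentalDomain b with hF
  obtain ⟨D, hD0, hD⟩ : ∃ D : ℝ, 0 < D ∧ ∀ y ∈ F, ‖y‖ ≤ D := by
    obtain ⟨D, hD0, hD⟩ := (ZSpan.fundamentalDomain_isBounded b).exists_pos_norm_le
    exact ⟨D, hD0, hD⟩
  have hFm : MeasurableSet F := ZSpan.fundamentalDomain_measurableSet b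
  have hFfin : μ F ≠ ⊤ := (ZSpan.fundamentalDomain_isBounded b).measure_lt_top.ne
  set v : ℝ := μ.real F with hv
  have hv0 : 0 < v :=
    ENNReal.toReal_pos (ZSpan.measure_fundamentalDomain_ne_zero b) hFfin
  set B' : ℝ := max B 0 with hB'
  have hB'0 : 0 ≤ B' := le_max_right _ _
  set V : ℝ := μ.real (Metric.closedBall (0 : E) (B' + D)) with hV
  refine ⟨v⁻¹ * ∫ x, Φ x ∂μ, v⁻¹ * (K * D * V), by positivity, fun R hR ↦ ?_⟩
  have hR0 : 0 < R := by linarith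
  have hRi : 0 < R⁻¹ := by positivity
  set f : E → ℝ := fun x ↦ Φ (R⁻¹ • x) with hf
  have hfc : Continuous f := hΦ.continuous.comp (by fun_prop)
  have hfs : ∀ x, f x ≠ 0 → ‖x‖ ≤ R * B' := fun x hx ↦ by
    have := (hB _ hx).trans (le_max_left B 0)
    rw [norm_smul, Real.norm_of_nonneg hRi.le, inv_mul_le_iff₀ hR0] at this
    exact this
  have hfi : Integrable f μ := by
    refine hfc.integrable_of_hasCompactSupport ?_
    refine HasCompactSupport.intro (isCompact_closedBall (0 : E) (R * B')) fun x hx ↦ ?_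
    by_contra h
    exact hx (by simpa using hfs x h)
  set g : E → ℝ := (Metric.closedBall (0 : E) (R * B' + D)).indicator (fun _ ↦ K * D / R) with hg
  have hgi : Integrable g μ :=
    (integrable_indicator_iff Metric.isClosed_closedBall.measurableSet).2
      (integrableOn_const (Metric.isBounded_closedBall.measure_lt_top.ne))
  have hgs : ∀ x, g x ≠ 0 → ‖x‖ ≤ R * B' + D := fun x hx ↦ by
    by_contra h
    exact hx (Set.indicator_of_notMem (by simpa using h) _)
  have hfin : {x : Submodule.span ℤ (Set.range b) | ‖(x : E)‖ ≤ R * B' + D + D}.Finite := by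
    have := ZSpan.setFinite_inter b (s := Metric.closedBall (0 : E) (R * B' + D + D))
      Metric.isBounded_closedBall
    refine (this.preimage (f := ((↑) : Submodule.span ℤ (Set.range b) → E))
      Subtype.coe_injective.injOn).subset fun x hx ↦ ?_
    exact ⟨by simpa using hx, x.2⟩
  set T := hfin.toFinset with hT
  have hTmem : ∀ x : Submodule.span ℤ (Set.range b), ‖(x : E)‖ ≤ R * B' + D + D → x ∈ T :=
    fun x hx ↦ by simpa [hT] using hx
  have h1 : ∑' x : Submodule.span ℤ (Set.range b), Φ (R⁻¹ • (x : E)) = ∑ x ∈ T, f x :=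
    tsum_eq_sum fun x hx ↦ by
      by_contra h
      have := hfs _ h
      exact hx (hTmem x (by linarith))
  have h2 := integral_eq_sum μ b hfi hD hfs T fun x hx ↦ hTmem x (by linarith)
  have h3 := integral_eq_sum μ b hgi hD hgs T hTmem
  have h4 : ∫ x, f x ∂μ = R ^ finrank ℝ E * ∫ x, Φ x ∂μ := by
    rw [hf, Measure.integral_comp_inv_smul_of_nonneg μ Φ hR0.le, smul_eq_mul]
  have h5 : ∫ x, g x ∂μ ≤ R ^ finrank ℝ E * V * (K * D / R) := by
    rw [hg, integral_indicator Metric.isClosed_closedBall.measurableSet, setIntegral_const,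
      smul_eq_mul]
    refine mul_le_mul_of_nonneg_right ?_ (by positivity)
    have : μ.real (Metric.closedBall (0 : E) (R * (B' + D))) = R ^ finrank ℝ E * V := by
      rw [measureReal_def, Measure.addHaar_closedBall_mul μ 0 hR0.le (by positivity),
        ENNReal.toReal_mul, ENNReal.toReal_ofReal (by positivity), hV, measureReal_def]
    rw [← this]
    refine measureReal_mono (Metric.closedBall_subset_closedBall ?_)
      Metric.isBounded_closedBall.measure_lt_top.ne
    nlinarith
  have hcomp : ∀ (u : E → ℝ), Integrable u μ → ∀ x : E, IntegrableOn (fun y ↦ u (x + y)) F μ :=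
    fun u hu x ↦ (hu.comp_add_left x).integrableOn
  have h6 : |v * ∑ x ∈ T, f x - ∫ x, f x ∂μ| ≤ ∫ x, g x ∂μ := by
    rw [h2, h3, Finset.mul_sum, ← Finset.sum_sub_distrib]
    refine (Finset.abs_sum_le_sum_abs _ _).trans (Finset.sum_le_sum fun x _ ↦ ?_)
    have : v * f x = ∫ y in F, f x ∂μ := by rw [setIntegral_const, smul_eq_mul]
    rw [this, ← integral_sub (integrableOn_const (C := f x) hFfin) (hcomp f hfi x),
      ← Real.norm_eq_abs]
    refine norm_integral_le_of_norm_le (hcomp g hgi x) ?_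
    filter_upwards [ae_restrict_mem hFm] with y hy
    have hy' := hD y hy
    by_cases hxy : ‖(x : E) + y‖ ≤ R * B' + D
    · rw [hg, Set.indicator_of_mem (by simpa using hxy)]
      have := hΦ.dist_le_mul (R⁻¹ • (x : E)) (R⁻¹ • ((x : E) + y))
      rw [dist_eq_norm, dist_eq_norm, ← smul_sub, norm_smul, sub_add_cancel_left, norm_neg,
        Real.norm_of_nonneg hRi.le] at this
      refine this.trans ?_
      calc (K : ℝ) * (R⁻¹ * ‖y‖) ≤ K * (R⁻¹ * D) := by gcongr
        _ = _ := by ring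
    · rw [hg, Set.indicator_of_notMem (by simpa using hxy)]
      have e1 : f (x + y) = 0 := by
        by_contra h
        have := hfs _ h
        exact hxy (by linarith)
      have e2 : f x = 0 := by
        by_contra h
        have e3 := hfs _ h
        have e4 := norm_add_le (x : E) y
        exact hxy (by linarith)
      simp [e1, e2]
  rw [h1]
  have h7 : ∑ x ∈ T, f x - v⁻¹ * (∫ x, Φ x ∂μ) * R ^ finrank ℝ E =
      v⁻¹ * (v * ∑ x ∈ T, f x - ∫ x, f x ∂μ) := by
    rw [h4]
    field_simp
  rw [h7, abs_mul, abs_of_pos (by positivity : 0 < v⁻¹)]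
  calc _ ≤ v⁻¹ * (R ^ finrank ℝ E * V * (K * D / R)) := by
        gcongr
        exact h6.trans h5
    _ = _ := by ring

end LatticeSum

namespace LatticeSum

/-- The tent function; its integer translates form a partition of unity. -/
noncomputable def tent (t : ℝ) : ℝ := max (1 - |t|) 0

theorem tent_nonneg (t : ℝ) : 0 ≤ tent t := le_max_right _ _

theorem tent_le_one (t : ℝ) : tent t ≤ 1 := max_le (by linarith [abs_nonneg t]) zero_le_one

theorem abs_lt_one_of_tent_ne_zero {t : ℝ} (h : tent t ≠ 0) : |t| < 1 := by
  by_contra! h1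
  exact h (max_eq_right (by linarith))

theorem lipschitzWith_tent : LipschitzWith 1 tent := by
  refine LipschitzWith.of_dist_le_mul fun x y ↦ ?_
  simp only [Real.dist_eq, NNReal.coe_one, one_mul, tent]
  refine (abs_max_sub_max_le_abs _ _ _).trans ?_
  rw [sub_sub_sub_cancel_left, abs_sub_comm x y]
  exact abs_abs_sub_abs_le _ _

theorem tent_add_ne_zero {t : ℝ} {n : ℤ} (h : tent (t + n) ≠ 0) :
    n ∈ ({-⌊t⌋, -⌊t⌋ - 1} : Finset ℤ) := by
  obtain ⟨h1, h2⟩ := abs_lt.1 (abs_lt_one_of_tent_ne_zero h)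
  have h3 := Int.floor_le t
  have h4 := Int.lt_floor_add_one t
  have h5 : (n : ℝ) < ((-⌊t⌋ + 1 : ℤ) : ℝ) := by push_cast; linarith
  have h6 : ((-⌊t⌋ - 2 : ℤ) : ℝ) < n := by push_cast; linarith
  rw [Int.cast_lt] at h5 h6
  simp only [Finset.mem_insert, Finset.mem_singleton]
  omega

theorem sum_tent (t : ℝ) : ∑ n ∈ ({-⌊t⌋, -⌊t⌋ - 1} : Finset ℤ), tent (t + n) = 1 := by
  rw [Finset.sum_pair (by omega)]
  have h3 := Int.floor_le t
  have h4 := Int.lt_floor_add_one t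
  push_cast
  rw [tent, tent, abs_of_nonneg (by linarith),
    abs_of_nonpos (by linarith), max_eq_left (by linarith),
    max_eq_left (by linarith)]
  ring

theorem tsum_prod_tent {r : ℕ} (t : Fin r → ℝ) :
    (Function.support fun n : Fin r → ℤ ↦ ∏ i, tent (t i + n i)).Finite ∧
      ∑' n : Fin r → ℤ, ∏ i, tent (t i + n i) = 1 := by
  set T := Fintype.piFinset fun i ↦ ({-⌊t i⌋, -⌊t i⌋ - 1} : Finset ℤ)
  have h : ∀ n : Fin r → ℤ, ∏ i, tent (t i + n i) ≠ 0 → n ∈ T := fun n hn ↦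
    Fintype.mem_piFinset.2 fun i ↦
      tent_add_ne_zero (Finset.prod_ne_zero_iff.1 hn i (Finset.mem_univ i))
  refine ⟨T.finite_toSet.subset h, ?_⟩
  rw [tsum_eq_sum fun n hn ↦ by_contra fun h1 ↦ hn (h n h1),
    ← Finset.prod_univ_sum (fun i ↦ ({-⌊t i⌋, -⌊t i⌋ - 1} : Finset ℤ)) fun i n ↦ tent (t i + n)]
  exact Finset.prod_eq_one fun i _ ↦ sum_tent (t i)

/-- A second difference, under doubling, of `x ↦ max (1 - x) 0`. -/
noncomputable def hat (x : ℝ) : ℝ :=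
  max (1 - x) 0 - 3 / 2 * max (1 - 2 * x) 0 + 1 / 2 * max (1 - 4 * x) 0

theorem hat_eq_zero_of_le {x : ℝ} (h : x ≤ 1 / 4) : hat x = 0 := by
  rw [hat, max_eq_left (by linarith), max_eq_left (by linarith), max_eq_left (by linarith)]
  ring

theorem hat_eq_zero_of_ge {x : ℝ} (h : 1 ≤ x) : hat x = 0 := by
  rw [hat, max_eq_right (by linarith), max_eq_right (by linarith), max_eq_right (by linarith)]
  ring

theorem abs_hat_sub_hat_le (x y : ℝ) : |hat x - hat y| ≤ 6 * |x - y| := by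
  have key : ∀ k : ℝ, 0 ≤ k → |max (1 - k * x) 0 - max (1 - k * y) 0| ≤ k * |x - y| := fun k hk ↦ by
    refine (abs_max_sub_max_le_abs _ _ _).trans ?_
    rw [sub_sub_sub_cancel_left, ← mul_sub, abs_mul, abs_of_nonneg hk, abs_sub_comm]
  have h1 := abs_le.1 (key 1 (by norm_num))
  have h2 := abs_le.1 (key 2 (by norm_num))
  have h4 := abs_le.1 (key 4 (by norm_num))
  simp only [one_mul] at h1
  rw [hat, hat, abs_le]
  constructor <;> linarith [h1.1, h1.2, h2.1, h2.2, h4.1, h4.2]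

theorem abs_hat_le_one (x : ℝ) : |hat x| ≤ 1 := by
  rcases le_or_gt x (1 / 4) with h | h
  · rw [hat_eq_zero_of_le h]
    norm_num
  rcases le_or_gt 1 x with h' | h'
  · rw [hat_eq_zero_of_ge h']
    norm_num
  rw [hat, max_eq_left (by linarith : 0 ≤ 1 - x),
    max_eq_right (by linarith : 1 - 4 * x ≤ 0), abs_le]
  rcases max_cases (1 - 2 * x) 0 with h2 | h2 <;> constructor <;> linarith

theorem abs_hat_exp_sub_le (u v : ℝ) :
    |hat (Real.exp u) - hat (Real.exp v)| ≤ 6 * |u - v| := by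
  have key : ∀ u, hat (Real.exp u) = hat (Real.exp (min u 0)) := fun u ↦ by
    rcases le_total u 0 with h | h
    · rw [min_eq_left h]
    · rw [min_eq_right h, Real.exp_zero, hat_eq_zero_of_ge le_rfl,
        hat_eq_zero_of_ge (Real.one_le_exp h)]
  rw [key u, key v]
  refine (abs_hat_sub_hat_le _ _).trans (mul_le_mul_of_nonneg_left ?_ (by norm_num))
  have hexp : ∀ a b : ℝ, a ≤ b → b ≤ 0 → Real.exp b - Real.exp a ≤ b - a := fun a b hab hb ↦ by
    have h1 := Real.add_one_le_exp (a - b)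
    have h2 : Real.exp a = Real.exp b * Real.exp (a - b) := by rw [← Real.exp_add]; ring_nf
    have h3 := Real.exp_le_one_iff.2 hb
    have h4 := Real.exp_pos b
    nlinarith
  have hmin : ∀ a b : ℝ, |Real.exp (min a 0) - Real.exp (min b 0)| ≤ |min a 0 - min b 0| :=
    fun a b ↦ by
      rcases le_total (min a 0) (min b 0) with h | h
      · rw [abs_sub_comm, abs_sub_comm (min a 0), abs_of_nonneg (sub_nonneg.2 h),
          abs_of_nonneg (sub_nonneg.2 (Real.exp_le_exp.2 h))]
        exact hexp _ _ h (min_le_right _ _)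
      · rw [abs_of_nonneg (sub_nonneg.2 h), abs_of_nonneg (sub_nonneg.2 (Real.exp_le_exp.2 h))]
        exact hexp _ _ h (min_le_right _ _)
  refine (hmin u v).trans ?_
  simpa using abs_min_sub_min_le_max u 0 v 0

theorem exists_lipschitzWith_prod {E κ : Type*} [PseudoMetricSpace E] (s : Finset κ)
    (f : κ → E → ℝ) (hf : ∀ i ∈ s, ∃ K, LipschitzWith K (f i)) (h1 : ∀ i ∈ s, ∀ x, |f i x| ≤ 1) :
    ∃ K, LipschitzWith K fun x ↦ ∏ i ∈ s, f i x := by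
  classical
  induction s using Finset.induction_on with
  | empty => exact ⟨0, by simp⟩
  | insert a s ha ih =>
    obtain ⟨K, hK⟩ := ih (fun i hi ↦ hf i (Finset.mem_insert_of_mem hi))
      fun i hi ↦ h1 i (Finset.mem_insert_of_mem hi)
    obtain ⟨L, hL⟩ := hf a (Finset.mem_insert_self a s)
    refine ⟨L + K, LipschitzWith.of_dist_le_mul fun x y ↦ ?_⟩
    have e1 := hK.dist_le_mul x y
    have e2 := hL.dist_le_mul x y
    simp only [Finset.prod_insert ha]
    rw [Real.dist_eq] at e1 e2 ⊢
    have e3 : |∏ i ∈ s, f i y| ≤ 1 := by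
      rw [Finset.abs_prod]
      exact Finset.prod_le_one (fun _ _ ↦ abs_nonneg _)
        fun i hi ↦ h1 i (Finset.mem_insert_of_mem hi) y
    have e4 := h1 a (Finset.mem_insert_self a s) x
    calc _ = |f a x * (∏ i ∈ s, f i x - ∏ i ∈ s, f i y) + (f a x - f a y) * ∏ i ∈ s, f i y| := by
          congr 1
          ring
      _ ≤ |f a x| * |∏ i ∈ s, f i x - ∏ i ∈ s, f i y| + |f a x - f a y| * |∏ i ∈ s, f i y| := by
          rw [← abs_mul, ← abs_mul]
          exact abs_add_le _ _
      _ ≤ 1 * (K * dist x y) + L * dist x y * 1 := by gcongr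
      _ = _ := by
          push_cast
          ring

/-- A compactly supported Lipschitz function of the logarithms of finitely many absolute values
extends by zero to a Lipschitz function. -/
theorem exists_lipschitzWith_comp_log {E ι : Type*} [NormedAddCommGroup E] [Fintype ι]
    {Ψ : (ι → ℝ) → ℝ} {K : NNReal} (hK : LipschitzWith K Ψ) {M B : ℝ} (hM : ∀ u, |Ψ u| ≤ M)
    (hB : ∀ u, Ψ u ≠ 0 → ‖u‖ ≤ B) {ν : E → ι → ℝ}
    (hν : ∀ x y i, |ν x i - ν y i| ≤ ‖x - y‖) {Φ : E → ℝ}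
    (hΦ : ∀ x, (∀ i, 0 < ν x i) → Φ x = Ψ fun i ↦ Real.log (ν x i))
    (hΦ0 : ∀ x, ¬ (∀ i, 0 < ν x i) → Φ x = 0) : ∃ L, LipschitzWith L Φ := by
  have hM0 : 0 ≤ M := (abs_nonneg _).trans (hM 0)
  have hΦM : ∀ x, |Φ x| ≤ M := fun x ↦ by
    by_cases h : ∀ i, 0 < ν x i
    · rw [hΦ x h]
      exact hM _
    · rw [hΦ0 x h, abs_zero]
      exact hM0
  set e := Real.exp B with he
  have he0 : 0 < e := Real.exp_pos B
  set L : ℝ := 2 * e * (2 * M + K) with hL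
  have hL0 : 0 ≤ L := by positivity
  have key : ∀ x y, Φ x ≠ 0 → |Φ x - Φ y| ≤ L * ‖x - y‖ := fun x y hx ↦ by
    have hpos : ∀ i, 0 < ν x i := by
      by_contra h
      exact hx (hΦ0 x h)
    have hlow : ∀ i, e⁻¹ ≤ ν x i := fun i ↦ by
      rw [he, ← Real.exp_neg, ← Real.le_log_iff_exp_le (hpos i)]
      rw [hΦ x hpos] at hx
      have := (norm_le_pi_norm (fun i ↦ Real.log (ν x i)) i).trans (hB _ hx)
      exact (abs_le.1 this).1
    rcases le_or_gt (1 / (2 * e)) ‖x - y‖ with h | h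
    · have h1 : 1 ≤ 2 * e * ‖x - y‖ := by
        rw [div_le_iff₀ (by positivity)] at h
        linarith
      calc |Φ x - Φ y| ≤ |Φ x| + |Φ y| := abs_sub _ _
        _ ≤ 2 * M * 1 := by linarith [hΦM x, hΦM y]
        _ ≤ 2 * M * (2 * e * ‖x - y‖) := by gcongr
        _ ≤ 2 * M * (2 * e * ‖x - y‖) + K * (2 * e * ‖x - y‖) := by
            have : 0 ≤ K * (2 * e * ‖x - y‖) := by positivity
            linarith
        _ = _ := by ring
    · have hlow' : ∀ i, 1 / (2 * e) ≤ ν y i := fun i ↦ by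
        have h1 := (abs_le.1 (hν x y i)).2
        have h2 := hlow i
        have h3 : e⁻¹ = 1 / (2 * e) + 1 / (2 * e) := by
          field_simp
          norm_num
        linarith
      have hpos' : ∀ i, 0 < ν y i := fun i ↦ lt_of_lt_of_le (by positivity) (hlow' i)
      rw [hΦ x hpos, hΦ y hpos']
      have h1 := hK.dist_le_mul (fun i ↦ Real.log (ν x i)) fun i ↦ Real.log (ν y i)
      rw [Real.dist_eq] at h1
      refine h1.trans ?_
      have h2 : dist (fun i ↦ Real.log (ν x i)) (fun i ↦ Real.log (ν y i)) ≤ 2 * e * ‖x - y‖ := by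
        refine (dist_pi_le_iff (by positivity)).2 fun i ↦ ?_
        have hlog : ∀ a b : ℝ, 1 / (2 * e) ≤ a → 1 / (2 * e) ≤ b →
            Real.log a - Real.log b ≤ 2 * e * |a - b| := fun a b ha hb ↦ by
          have hb0 : 0 < b := lt_of_lt_of_le (by positivity) hb
          have ha0 : 0 < a := lt_of_lt_of_le (by positivity) ha
          rw [← Real.log_div ha0.ne' hb0.ne']
          refine (Real.log_le_sub_one_of_pos (by positivity)).trans ?_
          rw [div_sub_one hb0.ne', div_le_iff₀ hb0]
          rw [div_le_iff₀ (by positivity)] at hb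
          calc a - b ≤ |a - b| := le_abs_self _
            _ ≤ |a - b| * (b * (2 * e)) := le_mul_of_one_le_right (abs_nonneg _) hb
            _ = _ := by ring
        have e0 : 1 / (2 * e) ≤ e⁻¹ := by
          rw [one_div, mul_inv]
          have : 0 < e⁻¹ := by positivity
          linarith
        have e1 := hlog _ _ (e0.trans (hlow i)) (hlow' i)
        have e2 := hlog _ _ (hlow' i) (e0.trans (hlow i))
        rw [abs_sub_comm] at e2
        have e3 := mul_le_mul_of_nonneg_left (hν x y i) (by positivity : 0 ≤ 2 * e)
        rw [Real.dist_eq, abs_le]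
        constructor <;> linarith
      calc _ ≤ K * (2 * e * ‖x - y‖) := by gcongr
        _ ≤ 2 * M * (2 * e * ‖x - y‖) + K * (2 * e * ‖x - y‖) := by
            have : 0 ≤ 2 * M * (2 * e * ‖x - y‖) := by positivity
            linarith
        _ = _ := by ring
  refine ⟨⟨L, hL0⟩, LipschitzWith.of_dist_le_mul fun x y ↦ ?_⟩
  rw [Real.dist_eq, dist_eq_norm]
  change _ ≤ L * _
  by_cases hx : Φ x = 0
  · by_cases hy : Φ y = 0
    · rw [hx, hy, sub_zero, abs_zero]
      positivity
    · rw [abs_sub_comm, norm_sub_rev]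
      exact key y x hy
  · exact key x y hx

end LatticeSum

namespace NumberField.IdealCount

open Module LatticeSum mixedEmbedding InfinitePlace NumberField.Units
  NumberField.Units.dirichletUnitTheorem
  mixedEmbedding.fundamentalCone
open scoped NumberField Classical

variable (K : Type*) [Field K] [NumberField K]

/-- The basis of the logarithmic space given by a system of fundamental units. -/
noncomputable def logBasis : Basis (Fin (rank K)) ℝ (logSpace K) :=
  (basisUnitLattice K).ofZLatticeBasis ℝ (unitLattice K)

/-- A Lipschitz replacement for the indicator function of the fundamental cone, truncated to
the elements whose norm is about `1`. -/
noncomputable def coneWeight (x : mixedSpace K) : ℝ :=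
  hat (mixedEmbedding.norm x) * ∏ i, tent ((logBasis K).repr (logMap x) i)

theorem normAtPlace_sub_abs_le (x y : mixedSpace K) (w : InfinitePlace K) :
    |normAtPlace w x - normAtPlace w y| ≤ ‖x - y‖ := by
  have key : ∀ x y : mixedSpace K, normAtPlace w x - normAtPlace w y ≤ ‖x - y‖ := fun x y ↦ by
    have h1 := normAtPlace_add_le w (x - y) y
    rw [sub_add_cancel] at h1
    have h2 : normAtPlace w (x - y) ≤ ‖x - y‖ := by
      rw [norm_eq_sup'_normAtPlace]
      exact Finset.le_sup' (fun w ↦ normAtPlace w (x - y)) (Finset.mem_univ w)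
    linarith
  rw [abs_le]
  have h1 := key x y
  have h2 := key y x
  rw [norm_sub_rev] at h2
  constructor <;> linarith

/-- The logarithm of the norm, as a linear form in the logarithms of the absolute values. -/
noncomputable def logNorm : (InfinitePlace K → ℝ) →ₗ[ℝ] ℝ :=
  ∑ w, (mult w : ℝ) • LinearMap.proj w

theorem logNorm_apply (u : InfinitePlace K → ℝ) : logNorm K u = ∑ w, (mult w : ℝ) * u w := by
  simp [logNorm]

/-- The map `logMap` in terms of the logarithms of the absolute values. -/
noncomputable def logCoord : (InfinitePlace K → ℝ) →ₗ[ℝ] logSpace K :=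
  LinearMap.pi fun w ↦ (mult w.1 : ℝ) • (LinearMap.proj w.1 - (finrank ℚ K : ℝ)⁻¹ • logNorm K)

theorem logCoord_apply (u : InfinitePlace K → ℝ) (w : {w : InfinitePlace K // w ≠ w₀}) :
    logCoord K u w = mult w.1 * (u w - logNorm K u * (finrank ℚ K : ℝ)⁻¹) := by
  simp [logCoord, mul_comm]

theorem log_norm_eq {x : mixedSpace K} (hx : ∀ w, 0 < normAtPlace w x) :
    Real.log (mixedEmbedding.norm x) = logNorm K fun w ↦ Real.log (normAtPlace w x) := by
  rw [logNorm_apply, mixedEmbedding.norm_apply, Real.log_prod fun w _ ↦ pow_ne_zero _ (hx w).ne']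
  simp

theorem logMap_eq_logCoord {x : mixedSpace K} (hx : ∀ w, 0 < normAtPlace w x) :
    logMap x = logCoord K fun w ↦ Real.log (normAtPlace w x) := by
  ext w
  rw [logMap_apply, logCoord_apply, log_norm_eq K hx]

omit [NumberField K] in
theorem cast_mult_pos (w : InfinitePlace K) : (0 : ℝ) < mult w := by exact_mod_cast mult_pos

theorem eq_zero_of_logNorm_of_logCoord {u : InfinitePlace K → ℝ} (h1 : logNorm K u = 0)
    (h2 : logCoord K u = 0) : u = 0 := by
  have h3 : ∀ w, w ≠ w₀ → u w = 0 := fun w hw ↦ by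
    have := congrFun h2 ⟨w, hw⟩
    rw [logCoord_apply, h1, zero_mul, sub_zero] at this
    exact (mul_eq_zero.1 this).resolve_left (cast_mult_pos K w).ne'
  ext w
  by_cases hw : w = w₀
  · rw [logNorm_apply, Finset.sum_eq_single w₀ (fun v _ hv ↦ by rw [h3 v hv, mul_zero])
      fun h ↦ absurd (Finset.mem_univ _) h] at h1
    rw [hw]
    exact (mul_eq_zero.1 h1).resolve_left (cast_mult_pos K w₀).ne'
  · exact h3 w hw

theorem norm_pos_iff_forall (x : mixedSpace K) :
    0 < mixedEmbedding.norm x ↔ ∀ w, 0 < normAtPlace w x := by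
  rw [(mixedEmbedding.norm_nonneg x).lt_iff_ne', mixedEmbedding.norm_ne_zero_iff]
  exact forall_congr' fun w ↦ (normAtPlace_nonneg w x).lt_iff_ne'.symm

theorem exists_lipschitzWith_coneWeight : (∃ L, LipschitzWith L (coneWeight K)) ∧
    ∃ B, ∀ x, coneWeight K x ≠ 0 → ‖x‖ ≤ B := by
  set Ψ : (InfinitePlace K → ℝ) → ℝ := fun u ↦
    hat (Real.exp (logNorm K u)) * ∏ i, tent ((logBasis K).repr (logCoord K u) i) with hΨ
  have hlin : ∀ f : (InfinitePlace K → ℝ) →ₗ[ℝ] ℝ, ∃ L, LipschitzWith L f := fun f ↦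
    ⟨_, (LinearMap.toContinuousLinearMap f).lipschitz⟩
  obtain ⟨M, hM⟩ : ∃ M, LipschitzWith M Ψ := by
    obtain ⟨L, hL⟩ := exists_lipschitzWith_prod (Finset.univ : Finset (Option (Fin (rank K))))
      (fun o u ↦ o.elim (hat (Real.exp (logNorm K u)))
        fun i ↦ tent ((logBasis K).repr (logCoord K u) i)) (fun o _ ↦ by
          cases o with
          | none =>
            obtain ⟨L, hL⟩ := hlin (logNorm K)
            have : LipschitzWith 6 fun u : ℝ ↦ hat (Real.exp u) :=
              LipschitzWith.of_dist_le_mul fun u v ↦ abs_hat_exp_sub_le u v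
            exact ⟨_, this.comp hL⟩
          | some i =>
            obtain ⟨L, hL⟩ := hlin ((logBasis K).coord i ∘ₗ logCoord K)
            exact ⟨_, lipschitzWith_tent.comp hL⟩) (fun o _ u ↦ by
          cases o with
          | none => exact abs_hat_le_one _
          | some i =>
            change |tent _| ≤ 1
            rw [abs_of_nonneg (tent_nonneg _)]
            exact tent_le_one _)
    refine ⟨L, ?_⟩
    simpa only [Fintype.prod_option, Option.elim] using hL
  have hbd : ∀ u, |Ψ u| ≤ 1 := fun u ↦ by
    rw [hΨ, abs_mul, Finset.abs_prod]
    refine mul_le_one₀ (abs_hat_le_one _) (Finset.prod_nonneg fun _ _ ↦ abs_nonneg _)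
      (Finset.prod_le_one (fun _ _ ↦ abs_nonneg _) fun i _ ↦ ?_)
    rw [abs_of_nonneg (tent_nonneg _)]
    exact tent_le_one _
  set T : (InfinitePlace K → ℝ) →ₗ[ℝ] ℝ × (Fin (rank K) → ℝ) :=
    (logNorm K).prod ((logBasis K).equivFun.toLinearMap ∘ₗ logCoord K) with hT
  have hker : LinearMap.ker T = ⊥ := by
    refine LinearMap.ker_eq_bot'.2 fun u hu ↦ ?_
    have h1 : logNorm K u = 0 := congrArg Prod.fst hu
    have h2 : (logBasis K).equivFun (logCoord K u) = 0 := congrArg Prod.snd hu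
    exact eq_zero_of_logNorm_of_logCoord K h1 ((LinearEquiv.map_eq_zero_iff _).1 h2)
  obtain ⟨A, -, hA⟩ := T.exists_antilipschitzWith hker
  have hsupp : ∀ u, Ψ u ≠ 0 → ‖u‖ ≤ A * max (Real.log 4) 1 := fun u hu ↦ by
    have h0 : ‖u‖ ≤ A * ‖T u‖ := by simpa using hA.le_mul_dist u 0
    refine h0.trans (mul_le_mul_of_nonneg_left ?_ A.2)
    refine max_le_max ?_ ?_
    · have h1 : hat (Real.exp (logNorm K u)) ≠ 0 := left_ne_zero_of_mul hu
      have h2 : Real.exp (logNorm K u) ≤ 1 := by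
        by_contra! h
        exact h1 (hat_eq_zero_of_ge h.le)
      have h3 : 1 / 4 ≤ Real.exp (logNorm K u) := by
        by_contra! h
        exact h1 (hat_eq_zero_of_le h.le)
      have h4 : Real.log (1 / 4) ≤ logNorm K u := (Real.log_le_iff_le_exp (by norm_num)).2 h3
      rw [one_div, Real.log_inv] at h4
      change |logNorm K u| ≤ _
      rw [abs_of_nonpos (Real.exp_le_one_iff.1 h2)]
      linarith
    · have h1 := right_ne_zero_of_mul hu
      refine (pi_norm_le_iff_of_nonneg zero_le_one).2 fun i ↦ ?_
      exact (abs_lt_one_of_tent_ne_zero (Finset.prod_ne_zero_iff.1 h1 i (Finset.mem_univ i))).le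
  have hpos : ∀ x, (∀ w, 0 < normAtPlace w x) →
      coneWeight K x = Ψ fun w ↦ Real.log (normAtPlace w x) := fun x hx ↦ by
    simp only [hΨ]
    rw [coneWeight, ← log_norm_eq K hx, ← logMap_eq_logCoord K hx,
      Real.exp_log ((norm_pos_iff_forall K x).2 hx)]
  have hzero : ∀ x, ¬ (∀ w, 0 < normAtPlace w x) → coneWeight K x = 0 := fun x hx ↦ by
    rw [← norm_pos_iff_forall, not_lt] at hx
    rw [coneWeight, hat_eq_zero_of_le (hx.trans (by norm_num)), zero_mul]
  refine ⟨exists_lipschitzWith_comp_log hM hbd hsupp (normAtPlace_sub_abs_le K) hpos hzero,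
    Real.exp (A * max (Real.log 4) 1), fun x hx ↦ ?_⟩
  have hx' : ∀ w, 0 < normAtPlace w x := by
    by_contra h
    exact hx (hzero x h)
  rw [hpos x hx'] at hx
  rw [norm_eq_sup'_normAtPlace]
  refine Finset.sup'_le _ _ fun w _ ↦ ?_
  rw [← Real.log_le_iff_le_exp (hx' w)]
  exact (le_abs_self _).trans
    ((norm_le_pi_norm (fun w ↦ Real.log (normAtPlace w x)) w).trans (hsupp _ hx))

end NumberField.IdealCount

namespace NumberField.IdealCount

open Module LatticeSum mixedEmbedding InfinitePlace NumberField.Units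
  NumberField.Units.dirichletUnitTheorem mixedEmbedding.fundamentalCone
open scoped NumberField Classical nonZeroDivisors

variable (K : Type*) [Field K] [NumberField K]

/-- Every unit is uniquely a root of unity times a product of powers of fundamental units. -/
noncomputable def unitEquiv : torsion K × (Fin (rank K) → ℤ) ≃ (𝓞 K)ˣ :=
  Equiv.ofBijective (fun e ↦ e.1 * ∏ i, fundSystem K i ^ e.2 i)
    (Function.bijective_iff_existsUnique _ |>.2 fun x ↦ by
      simpa only [eq_comm] using exist_unique_eq_mul_prod K x)

theorem repr_logMap_unitEquiv {y : mixedSpace K} (hy : mixedEmbedding.norm y ≠ 0)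
    (e : torsion K × (Fin (rank K) → ℤ)) (i : Fin (rank K)) :
    (logBasis K).repr (logMap (unitEquiv K e • y)) i = (logBasis K).repr (logMap y) i + e.2 i := by
  have h1 : logEmbedding K (Additive.ofMul (unitEquiv K e)) = ∑ j, (e.2 j : ℝ) • logBasis K j := by
    have h2 : logEmbedding K (Additive.ofMul (e.1 : (𝓞 K)ˣ)) = 0 :=
      logEmbedding_eq_zero_iff.2 e.1.2
    change logEmbedding K (Additive.ofMul ((e.1 : (𝓞 K)ˣ) * ∏ i, fundSystem K i ^ e.2 i)) = _
    rw [ofMul_mul, map_add, h2, zero_add, ofMul_prod, map_sum]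
    refine Finset.sum_congr rfl fun j _ ↦ ?_
    rw [ofMul_zpow, map_zsmul, logEmbedding_fundSystem, logBasis, Basis.ofZLatticeBasis_apply,
      Int.cast_smul_eq_zsmul]
  rw [logMap_unit_smul _ hy, map_add, h1, Finsupp.add_apply, Basis.repr_sum_self, add_comm]

theorem tsum_coneWeight_unit_smul {y : mixedSpace K} (hy : mixedEmbedding.norm y ≠ 0) :
    ∑' u : (𝓞 K)ˣ, coneWeight K (u • y) = torsionOrder K * hat (mixedEmbedding.norm y) := by
  simp only [coneWeight, norm_unit_smul]
  rw [tsum_mul_left, ← (unitEquiv K).tsum_eq]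
  simp only [repr_logMap_unitEquiv K hy]
  obtain ⟨hfin, hsum⟩ := tsum_prod_tent fun i ↦ (logBasis K).repr (logMap y) i
  have h1 : Summable fun e : torsion K × (Fin (rank K) → ℤ) ↦
      ∏ i, tent ((logBasis K).repr (logMap y) i + e.2 i) := by
    refine summable_of_hasFiniteSupport ((Set.Finite.prod Set.finite_univ hfin).subset
      fun e he ↦ ?_)
    exact ⟨Set.mem_univ _, he⟩
  rw [h1.tsum_prod]
  simp only [hsum]
  rw [tsum_const, nsmul_eq_mul, mul_one, mul_comm, torsionOrder]

theorem norm_mixedEmbedding_eq_absNorm (x : 𝓞 K) :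
    mixedEmbedding.norm (mixedEmbedding K x) = Ideal.absNorm (Ideal.span {x}) := by
  rw [norm_eq_norm, Ideal.absNorm_span_singleton, Nat.cast_natAbs, ← Algebra.coe_norm_int]
  simp

variable {K}

theorem mk0_eq_inv_iff {J I : (Ideal (𝓞 K))⁰} :
    ClassGroup.mk0 I = (ClassGroup.mk0 J)⁻¹ ↔
      ∃ x : 𝓞 K, Ideal.span {x} = (J : Ideal (𝓞 K)) * I := by
  rw [eq_inv_iff_mul_eq_one, mul_comm, ← map_mul]
  refine (ClassGroup.mk0_eq_one_iff (J * I).2).trans ⟨fun ⟨x, hx⟩ ↦ ⟨x, hx.symm⟩, fun ⟨x, hx⟩ ↦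
    ⟨x, ?_⟩⟩
  simpa using hx.symm

theorem tsum_coneWeight_span {ι : Type*} [Finite ι] (b : Basis ι ℝ (mixedSpace K))
    (J : (Ideal (𝓞 K))⁰) (hmem : ∀ x : mixedSpace K, x ∈ Submodule.span ℤ (Set.range b) ↔
      ∃ y ∈ (J : Ideal (𝓞 K)), mixedEmbedding K y = x) {R : ℝ} (hR : 0 < R) :
    ∑' x : Submodule.span ℤ (Set.range b), coneWeight K (R⁻¹ • (x : mixedSpace K)) =
      torsionOrder K * ∑' I : {I : (Ideal (𝓞 K))⁰ // ClassGroup.mk0 I = (ClassGroup.mk0 J)⁻¹},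
        hat (Ideal.absNorm (I.1 : Ideal (𝓞 K)) * Ideal.absNorm (J : Ideal (𝓞 K)) /
          R ^ finrank ℚ K) := by
  set X := {I : (Ideal (𝓞 K))⁰ // ClassGroup.mk0 I = (ClassGroup.mk0 J)⁻¹} with hX
  choose γ hγ using fun I : X ↦ mk0_eq_inv_iff.1 I.2
  have hγJ : ∀ I (u : (𝓞 K)ˣ), (u : 𝓞 K) * γ I ∈ (J : Ideal (𝓞 K)) := fun I u ↦ by
    have h1 : γ I ∈ (J : Ideal (𝓞 K)) * (I.1 : Ideal (𝓞 K)) := by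
      rw [← hγ]
      exact Ideal.mem_span_singleton_self (γ I)
    have h2 : (J : Ideal (𝓞 K)) * (I.1 : Ideal (𝓞 K)) ≤ J := Ideal.mul_le_left
    exact Ideal.mul_mem_left _ _ (h2 h1)
  have hγ0 : ∀ I, γ I ≠ 0 := fun I h ↦ by
    have := hγ I
    rw [h, Ideal.span_singleton_zero, eq_comm] at this
    exact nonZeroDivisors.coe_ne_zero (J * I.1) this
  set G : X × (𝓞 K)ˣ → Submodule.span ℤ (Set.range b) := fun p ↦
    ⟨mixedEmbedding K ((p.2 : 𝓞 K) * γ p.1 : 𝓞 K), (hmem _).2 ⟨_, hγJ p.1 p.2, rfl⟩⟩ with hG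
  have hGinj : Function.Injective G := fun ⟨I, u⟩ ⟨I', u'⟩ h ↦ by
    have h1 : (u : 𝓞 K) * γ I = u' * γ I' := by
      have := mixedEmbedding_injective K (congrArg Subtype.val h)
      exact RingOfIntegers.ext this
    have h2 : I = I' := by
      have h3 : (J : Ideal (𝓞 K)) * I.1 = J * I'.1 := by
        rw [← hγ, ← hγ, ← Ideal.span_singleton_mul_left_unit u.isUnit, h1,
          Ideal.span_singleton_mul_left_unit u'.isUnit]
      exact Subtype.ext (Subtype.ext (mul_left_cancel₀ (nonZeroDivisors.coe_ne_zero J) h3))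
    subst h2
    have h3 := mul_right_cancel₀ (hγ0 I) h1
    rw [Units.val_inj] at h3
    rw [h3]
  set F : Submodule.span ℤ (Set.range b) → ℝ := fun x ↦ coneWeight K (R⁻¹ • (x : mixedSpace K))
    with hF
  have hFfin : F.support.Finite := by
    obtain ⟨-, B, hB⟩ := exists_lipschitzWith_coneWeight K
    have := ZSpan.setFinite_inter b (s := Metric.closedBall (0 : mixedSpace K) (R * B))
      Metric.isBounded_closedBall
    refine (this.preimage (f := ((↑) : Submodule.span ℤ (Set.range b) → mixedSpace K))
      Subtype.coe_injective.injOn).subset fun x hx ↦ ⟨?_, x.2⟩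
    have := hB _ hx
    rw [_root_.norm_smul, Real.norm_of_nonneg (by positivity), inv_mul_le_iff₀ hR] at this
    simpa using this
  have hrange : F.support ⊆ Set.range G := fun x hx ↦ by
    obtain ⟨y, hyJ, hy⟩ := (hmem x).1 x.2
    have hy0 : y ≠ 0 := by
      rintro rfl
      refine hx ?_
      have h0 : (x : mixedSpace K) = 0 := by rw [← hy]; simp
      simp only [hF, h0, smul_zero, coneWeight, map_zero]
      rw [hat_eq_zero_of_le (by norm_num), zero_mul]
    obtain ⟨I, hI⟩ := Ideal.dvd_iff_le.2 ((Ideal.span_singleton_le_iff_mem _).2 hyJ)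
    have hI0 : I ∈ (Ideal (𝓞 K))⁰ := by
      refine mem_nonZeroDivisors_of_ne_zero ?_
      rintro rfl
      exact hy0 (by simpa using hI)
    have hcl : ClassGroup.mk0 (⟨I, hI0⟩ : (Ideal (𝓞 K))⁰) = (ClassGroup.mk0 J)⁻¹ :=
      mk0_eq_inv_iff.2 ⟨y, hI⟩
    have h1 : Ideal.span {y} = Ideal.span {γ ⟨⟨I, hI0⟩, hcl⟩} := by rw [hγ, hI]
    obtain ⟨u, hu⟩ := Ideal.span_singleton_eq_span_singleton.1 h1.symm
    refine ⟨(⟨⟨I, hI0⟩, hcl⟩, u), Subtype.ext ?_⟩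
    simp only [hG]
    rw [mul_comm, hu, hy]
  rw [← hGinj.tsum_eq hrange]
  have hsum : Summable fun p ↦ F (G p) := (summable_of_hasFiniteSupport hFfin).comp_injective hGinj
  rw [hsum.tsum_prod, ← tsum_mul_left]
  refine tsum_congr fun I ↦ ?_
  have hn : mixedEmbedding.norm (R⁻¹ • mixedEmbedding K (γ I)) =
      Ideal.absNorm (I.1 : Ideal (𝓞 K)) * Ideal.absNorm (J : Ideal (𝓞 K)) / R ^ finrank ℚ K := by
    rw [mixedEmbedding.norm_smul, norm_mixedEmbedding_eq_absNorm, hγ, map_mul, Nat.cast_mul,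
      abs_of_pos (by positivity), inv_pow]
    ring
  rw [← hn, ← tsum_coneWeight_unit_smul]
  · refine tsum_congr fun u ↦ ?_
    simp only [hF, hG, unitSMul_smul]
    rw [show ((u * γ I : 𝓞 K) : K) = algebraMap (𝓞 K) K u * (γ I : K) from
      map_mul (algebraMap (𝓞 K) K) _ _, map_mul, mul_smul_comm]
  · rw [hn]
    have h1 := Ideal.absNorm_ne_zero_of_nonZeroDivisors I.1
    have h2 := Ideal.absNorm_ne_zero_of_nonZeroDivisors J
    positivity

theorem tsum_coneWeight_lattice (J : (Ideal (𝓞 K))⁰) {R : ℝ} (hR : 0 < R) :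
    ∑' x : Submodule.span ℤ (Set.range (fractionalIdealLatticeBasis K (FractionalIdeal.mk0 K J))),
        coneWeight K (R⁻¹ • (x : mixedSpace K)) =
      torsionOrder K * ∑' I : {I : (Ideal (𝓞 K))⁰ // ClassGroup.mk0 I = (ClassGroup.mk0 J)⁻¹},
        hat (Ideal.absNorm (I.1 : Ideal (𝓞 K)) * Ideal.absNorm (J : Ideal (𝓞 K)) /
          R ^ finrank ℚ K) := by
  refine tsum_coneWeight_span _ J (fun x ↦ ?_) hR
  rw [mem_span_fractionalIdealLatticeBasis]
  simp [FractionalIdeal.coe_mk0]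

end NumberField.IdealCount

namespace LatticeSum

open Finset

theorem exists_abs_sub_le_of_half {f : ℝ → ℝ} {r c C θ : ℝ} (hf : ∀ X < 1, f X = 0) (hr : 0 ≤ r)
    (hr1 : r ≤ 1) (hθ : 0 < θ) (hθ1 : θ < 1)
    (h : ∀ X, 1 ≤ X → |f X - r * f (X / 2) - c * X| ≤ C * X ^ θ) :
    ∃ c' C' : ℝ, 0 ≤ C' ∧ ∀ X, 0 < X → |f X - c' * X| ≤ C' * X ^ θ := by
  have h2 : (1 / 2 : ℝ) ^ θ < 1 := Real.rpow_lt_one (by norm_num) (by norm_num) hθ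
  have hC : 0 ≤ C := by
    have := (abs_nonneg _).trans (h 1 le_rfl)
    simpa using this
  set c' := c / (1 - r / 2)
  have hc' : c' * (1 - r / 2) = c := div_mul_cancel₀ _ (by linarith)
  set M := |c'| + C / (1 - (1 / 2 : ℝ) ^ θ)
  have hM : 0 ≤ M := add_nonneg (abs_nonneg _) (div_nonneg hC (by linarith))
  have hCM : C ≤ M * (1 - (1 / 2 : ℝ) ^ θ) := by
    have h3 : C / (1 - (1 / 2 : ℝ) ^ θ) * (1 - (1 / 2 : ℝ) ^ θ) = C :=
      div_mul_cancel₀ _ (by linarith)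
    have h4 := mul_nonneg (abs_nonneg c') (sub_nonneg.2 h2.le)
    simp only [M, add_mul]
    linarith
  have key : ∀ n : ℕ, ∀ X, 0 < X → X < 2 ^ n → |f X - c' * X| ≤ M * X ^ θ := by
    intro n
    induction n with
    | zero =>
      intro X hX hX1
      rw [pow_zero] at hX1
      rw [hf X hX1, zero_sub, abs_neg, abs_mul, abs_of_pos hX]
      have h3 : X ≤ X ^ θ := by
        simpa using Real.rpow_le_rpow_of_exponent_ge hX hX1.le hθ1.le
      have h4 : |c'| ≤ M := le_add_of_nonneg_right (div_nonneg hC (by linarith))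
      gcongr
    | succ n ih =>
      intro X hX hXn
      rcases lt_or_ge X (2 ^ n) with hlt | hge
      · exact ih X hX hlt
      have hX1 : 1 ≤ X := (one_le_pow₀ (by norm_num)).trans hge
      have h3 := ih (X / 2) (by positivity) (by rw [pow_succ] at hXn; linarith)
      have h4 : f X - c' * X = (f X - r * f (X / 2) - c * X) + r * (f (X / 2) - c' * (X / 2)) := by
        rw [← hc']
        ring
      have h5 : (X / 2) ^ θ = X ^ θ * (1 / 2 : ℝ) ^ θ := by
        rw [← Real.mul_rpow hX.le (by norm_num)]
        ring_nf
      rw [h5] at h3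
      calc |f X - c' * X| ≤ C * X ^ θ + r * |f (X / 2) - c' * (X / 2)| := by
            rw [h4]
            refine (abs_add_le _ _).trans (add_le_add (h X hX1) ?_)
            rw [abs_mul, abs_of_nonneg hr]
        _ ≤ C * X ^ θ + 1 * (M * (X ^ θ * (1 / 2 : ℝ) ^ θ)) := by gcongr
        _ ≤ M * (1 - (1 / 2 : ℝ) ^ θ) * X ^ θ + 1 * (M * (X ^ θ * (1 / 2 : ℝ) ^ θ)) := by gcongr
        _ = M * X ^ θ := by ring
  refine ⟨c', M, hM, fun X hX ↦ ?_⟩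
  obtain ⟨n, hn⟩ := pow_unbounded_of_one_lt X (by norm_num : (1 : ℝ) < 2)
  exact key n X hX hn

/-- The Cesàro-type mean `∑_{n ≤ X} a n (1 - n / X)`. -/
noncomputable def rieszMean (a : ℕ → ℝ) (X : ℝ) : ℝ :=
  ∑ n ∈ Icc 0 ⌊X⌋₊, a n * max (1 - n / X) 0

theorem rieszMean_eq {X : ℝ} (hX : 0 < X) {N : ℕ} (hN : ⌊X⌋₊ ≤ N) (a : ℕ → ℝ) :
    rieszMean a X = ∑ n ∈ Icc 0 N, a n * max (1 - n / X) 0 := by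
  refine sum_subset (Icc_subset_Icc_right hN) fun n _ hn ↦ ?_
  rw [mem_Icc, not_and, not_le] at hn
  have h1 : X ≤ n := (Nat.lt_of_floor_lt (hn n.zero_le)).le
  rw [max_eq_right, mul_zero]
  rw [sub_nonpos, one_le_div hX]
  exact h1

theorem mul_rieszMean_eq {X : ℝ} (hX : 0 < X) {N : ℕ} (hN : ⌊X⌋₊ ≤ N) (a : ℕ → ℝ) :
    X * rieszMean a X = ∑ n ∈ Icc 0 N, a n * max (X - n) 0 := by
  rw [rieszMean_eq hX hN, mul_sum]
  refine sum_congr rfl fun n _ ↦ ?_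
  rw [mul_left_comm, mul_max_of_nonneg _ _ hX.le, mul_zero, mul_sub, mul_one,
    mul_div_cancel₀ _ hX.ne']

theorem rieszMean_of_lt_one {a : ℕ → ℝ} (h0 : a 0 = 0) {X : ℝ} (hX : X < 1) :
    rieszMean a X = 0 := by
  simp [rieszMean, Nat.floor_eq_zero.2 hX, h0]

theorem sum_hat_eq (a : ℕ → ℝ) {X : ℝ} (hX : 0 < X) :
    ∑ n ∈ Icc 0 ⌊X⌋₊, a n * hat (n / X) =
      rieszMean a X - 3 / 2 * rieszMean a (X / 2) + 1 / 2 * rieszMean a (X / 4) := by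
  rw [rieszMean_eq hX le_rfl, rieszMean_eq (X := X / 2) (by positivity)
    (Nat.floor_mono (by linarith : X / 2 ≤ X)), rieszMean_eq (X := X / 4) (by positivity)
    (Nat.floor_mono (by linarith : X / 4 ≤ X)), mul_sum, mul_sum, ← sum_sub_distrib,
    ← sum_add_distrib]
  refine sum_congr rfl fun n _ ↦ ?_
  rw [hat, show (n : ℝ) / (X / 2) = 2 * (n / X) by field_simp,
    show (n : ℝ) / (X / 4) = 4 * (n / X) by field_simp]
  ring

theorem exists_abs_rieszMean_sub_le {a : ℕ → ℝ} (h0 : a 0 = 0) {c C θ : ℝ} (hθ : 0 < θ)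
    (hθ1 : θ < 1)
    (h : ∀ X, 1 ≤ X → |∑ n ∈ Icc 0 ⌊X⌋₊, a n * hat (n / X) - c * X| ≤ C * X ^ θ) :
    ∃ c' C' : ℝ, 0 ≤ C' ∧ ∀ X, 0 < X → |rieszMean a X - c' * X| ≤ C' * X ^ θ := by
  obtain ⟨c₁, C₁, hC₁, h₁⟩ := exists_abs_sub_le_of_half
    (f := fun X ↦ rieszMean a X - rieszMean a (X / 2)) (r := 1 / 2) (c := c) (C := C) (θ := θ)
    (fun X hX ↦ by
      have h1 : X / 2 < 1 := by linarith
      simp only [rieszMean_of_lt_one h0 hX, rieszMean_of_lt_one h0 h1, sub_zero])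
    (by norm_num) (by norm_num) hθ hθ1 (fun X hX ↦ by
      have := h X hX
      rw [sum_hat_eq a (by linarith)] at this
      refine le_of_eq_of_le ?_ this
      congr 1
      rw [show X / 2 / 2 = X / 4 by ring]
      ring)
  refine exists_abs_sub_le_of_half (f := rieszMean a) (r := 1) (c := c₁) (C := C₁)
    (fun X hX ↦ rieszMean_of_lt_one h0 hX) (by norm_num) le_rfl hθ hθ1 fun X hX ↦ ?_
  simpa using h₁ X (by linarith)

theorem exists_powerSaving {a : ℕ → ℝ} (h0 : a 0 = 0) (ha : ∀ n, 0 ≤ a n) {c C θ : ℝ} (hθ : 0 < θ)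
    (hθ1 : θ < 1)
    (h : ∀ X, 1 ≤ X → |∑ n ∈ Icc 0 ⌊X⌋₊, a n * hat (n / X) - c * X| ≤ C * X ^ θ) :
    ∃ c' C' : ℝ, 0 ≤ C' ∧
      ∀ X, 1 ≤ X → |∑ n ∈ Icc 0 ⌊X⌋₊, a n - c' * X| ≤ C' * X ^ (1 - (1 - θ) / 2) := by
  obtain ⟨c', C', hC', h'⟩ := exists_abs_rieszMean_sub_le h0 hθ hθ1 h
  have hV : ∀ X, 0 < X → |X * rieszMean a X - c' * X ^ 2| ≤ C' * X ^ (1 + θ) := fun X hX ↦ by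
    rw [show X * rieszMean a X - c' * X ^ 2 = X * (rieszMean a X - c' * X) by ring, abs_mul,
      abs_of_pos hX, Real.rpow_add hX, Real.rpow_one, mul_left_comm]
    gcongr
    exact h' X hX
  refine ⟨2 * c', |c'| + 5 * C', by positivity, fun X hX ↦ ?_⟩
  have hX0 : 0 < X := by linarith
  set u := X ^ (1 - (1 - θ) / 2) with hu
  have hu0 : 0 < u := by positivity
  have huX : u ≤ X := by
    simpa using Real.rpow_le_rpow_of_exponent_le hX (by linarith : 1 - (1 - θ) / 2 ≤ 1)
  have huu : X ^ (1 + θ) = u * u := by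
    rw [hu, ← Real.rpow_add hX0]
    ring_nf
  have hup : (∑ n ∈ Icc 0 ⌊X⌋₊, a n) * u ≤ (X + u) * rieszMean a (X + u) - X * rieszMean a X := by
    rw [mul_rieszMean_eq (X := X + u) (by positivity) le_rfl, mul_rieszMean_eq hX0
      (Nat.floor_mono (by linarith : X ≤ X + u)), ← sum_sub_distrib, sum_mul]
    refine (sum_le_sum fun n hn ↦ ?_).trans (sum_le_sum_of_subset_of_nonneg
      (Icc_subset_Icc_right (Nat.floor_mono (by linarith : X ≤ X + u))) fun n _ _ ↦ ?_)
    · have h1 : (n : ℝ) ≤ X := Nat.le_floor_iff hX0.le |>.1 (mem_Icc.1 hn).2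
      rw [max_eq_left (by linarith), max_eq_left (by linarith)]
      linarith [ha n]
    · rw [← mul_sub]
      exact mul_nonneg (ha n) (sub_nonneg.2 (max_le_max_right _ (by linarith)))
  have hlow : X * rieszMean a X - (X - u) * rieszMean a (X - u) ≤ (∑ n ∈ Icc 0 ⌊X⌋₊, a n) * u := by
    rcases huX.eq_or_lt with heq | hlt
    · rw [heq, sub_self, zero_mul, sub_zero, mul_rieszMean_eq hX0 le_rfl, sum_mul]
      refine sum_le_sum fun n _ ↦ mul_le_mul_of_nonneg_left (max_le ?_ hX0.le) (ha n)
      linarith [(n.cast_nonneg : (0 : ℝ) ≤ n)]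
    · rw [mul_rieszMean_eq (X := X - u) (by linarith)
        (Nat.floor_mono (by linarith : X - u ≤ X)), mul_rieszMean_eq hX0 le_rfl,
        ← sum_sub_distrib, sum_mul]
      refine sum_le_sum fun n _ ↦ ?_
      rw [← mul_sub]
      refine mul_le_mul_of_nonneg_left ?_ (ha n)
      rw [sub_le_iff_le_add]
      refine max_le ?_ (by positivity)
      linarith [le_max_left (X - u - n) 0]
  have hV1 := abs_le.1 (hV X hX0)
  have hV2 : |(X + u) * rieszMean a (X + u) - c' * (X + u) ^ 2| ≤ C' * (4 * (u * u)) := by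
    refine (hV _ (by positivity)).trans ?_
    gcongr
    calc (X + u) ^ (1 + θ) ≤ (2 * X) ^ (1 + θ) := by
          refine Real.rpow_le_rpow (by positivity) (by linarith) (by linarith)
      _ = 2 ^ (1 + θ) * (u * u) := by rw [Real.mul_rpow (by norm_num) hX0.le, huu]
      _ ≤ 2 ^ (2 : ℝ) * (u * u) := by
        gcongr
        · norm_num
        · linarith
      _ = 4 * (u * u) := by norm_num
  have hV3 : |(X - u) * rieszMean a (X - u) - c' * (X - u) ^ 2| ≤ C' * (u * u) := by
    rcases huX.eq_or_lt with heq | hlt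
    · rw [heq, sub_self]
      simp only [zero_mul, ne_eq, OfNat.ofNat_ne_zero, not_false_eq_true, zero_pow, mul_zero,
        sub_self, abs_zero]
      positivity
    · refine (hV _ (by linarith)).trans ?_
      rw [← huu]
      gcongr
      linarith
  rw [huu] at hV1
  rw [abs_le] at hV2 hV3
  have hc1 := neg_abs_le c'
  have hc2 := le_abs_self c'
  have hcu1 : c' * (u * u) ≤ |c'| * (u * u) := by gcongr
  have hcu2 : -(|c'| * (u * u)) ≤ c' * (u * u) := by
    rw [← neg_mul]
    gcongr
  have hCu : 0 ≤ C' * (u * u) := by positivity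
  rw [abs_le]
  constructor
  · refine le_of_mul_le_mul_right ?_ hu0
    nlinarith
  · refine le_of_mul_le_mul_right ?_ hu0
    nlinarith

end LatticeSum

namespace NumberField.IdealCount

open Module LatticeSum mixedEmbedding Filter Topology BeurlingPNT
open scoped NumberField Classical nonZeroDivisors

variable (K : Type*) [Field K] [NumberField K]

/-- The number of nonzero ideals of norm `n`. -/
noncomputable def idealCount (n : ℕ) : ℝ :=
  Nat.card {I : (Ideal (𝓞 K))⁰ // Ideal.absNorm (I : Ideal (𝓞 K)) = n}

theorem idealCount_zero : idealCount K 0 = 0 := by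
  have : IsEmpty {I : (Ideal (𝓞 K))⁰ // Ideal.absNorm (I : Ideal (𝓞 K)) = 0} :=
    ⟨fun I ↦ Ideal.absNorm_ne_zero_of_nonZeroDivisors I.1 I.2⟩
  simp [idealCount]

theorem summable_comp_absNorm {F : ℕ → ℝ} {N : ℕ} (hF : ∀ n, N < n → F n = 0) :
    Summable fun I : (Ideal (𝓞 K))⁰ ↦ F (Ideal.absNorm (I : Ideal (𝓞 K))) := by
  refine summable_of_hasFiniteSupport ((Ideal.finite_setOfPred_absNorm_le₀ N).subset fun I hI ↦ ?_)
  by_contra h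
  exact hI (hF _ (not_le.1 h))

theorem tsum_comp_absNorm {F : ℕ → ℝ} {N : ℕ} (hF : ∀ n, N < n → F n = 0) :
    ∑' I : (Ideal (𝓞 K))⁰, F (Ideal.absNorm (I : Ideal (𝓞 K))) =
      ∑ n ∈ Finset.Icc 0 N, idealCount K n * F n := by
  set e := Equiv.sigmaFiberEquiv fun I : (Ideal (𝓞 K))⁰ ↦ Ideal.absNorm (I : Ideal (𝓞 K))
  have hs : Summable fun p ↦ F (Ideal.absNorm (e p : Ideal (𝓞 K))) :=
    e.summable_iff.2 (summable_comp_absNorm K hF)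
  rw [← e.tsum_eq, hs.tsum_sigma]
  have h : ∀ n, ∑' I : {I : (Ideal (𝓞 K))⁰ // Ideal.absNorm (I : Ideal (𝓞 K)) = n},
      F (Ideal.absNorm (e ⟨n, I⟩ : Ideal (𝓞 K))) = idealCount K n * F n := fun n ↦ by
    rw [tsum_congr (g := fun _ ↦ F n) fun I ↦ congrArg F I.2, tsum_const, nsmul_eq_mul, idealCount]
  rw [tsum_congr h]
  refine tsum_eq_sum fun n hn ↦ ?_
  rw [hF n (by simpa using hn), mul_zero]

theorem sum_idealCount (N : ℕ) : ∑ n ∈ Finset.Icc 0 N, idealCount K n =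
    Nat.card {I : (Ideal (𝓞 K))⁰ // Ideal.absNorm (I : Ideal (𝓞 K)) ≤ N} := by
  have h := tsum_comp_absNorm K (F := fun n ↦ if n ≤ N then 1 else 0) (N := N)
    fun n hn ↦ if_neg (not_le.2 hn)
  rw [Finset.sum_congr rfl fun n hn ↦ by rw [if_pos (Finset.mem_Icc.1 hn).2, mul_one]] at h
  rw [← h]
  have h1 := tsum_subtype {I : (Ideal (𝓞 K))⁰ | Ideal.absNorm (I : Ideal (𝓞 K)) ≤ N}
    fun _ ↦ (1 : ℝ)
  rw [tsum_const, nsmul_eq_mul, mul_one] at h1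
  refine Eq.trans ?_ h1.symm
  exact tsum_congr fun I ↦ by simp [Set.indicator]

theorem exists_abs_tsum_class_sub_le (C : ClassGroup (𝓞 K)) :
    ∃ c M : ℝ, ∀ X, 1 ≤ X →
      |∑' I : {I : (Ideal (𝓞 K))⁰ // ClassGroup.mk0 I = C},
        hat (Ideal.absNorm (I.1 : Ideal (𝓞 K)) / X) - c * X| ≤
          M * X ^ (1 - (finrank ℚ K : ℝ)⁻¹) := by
  obtain ⟨J, hJ⟩ := ClassGroup.mk0_surjective C⁻¹
  obtain ⟨⟨L, hL⟩, B, hB⟩ := exists_lipschitzWith_coneWeight K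
  obtain ⟨c, M, hM, h⟩ := exists_abs_tsum_sub_le (E := mixedSpace K) (Φ := coneWeight K)
    (fractionalIdealLatticeBasis K (FractionalIdeal.mk0 K J)) hL hB
  rw [mixedEmbedding.finrank] at h
  set d := finrank ℚ K
  have hd : (d : ℝ) ≠ 0 := Nat.cast_ne_zero.2 finrank_pos.ne'
  set N : ℝ := (Ideal.absNorm (J : Ideal (𝓞 K)) : ℝ)
  have hN : 1 ≤ N := Nat.one_le_cast.2
    (Nat.one_le_iff_ne_zero.2 (Ideal.absNorm_ne_zero_of_nonZeroDivisors J))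
  set w : ℝ := (NumberField.Units.torsionOrder K : ℝ)
  have hw : 0 < w := Nat.cast_pos.2 (NumberField.Units.torsionOrder_pos K)
  refine ⟨c * N / w, M * N ^ (1 - (d : ℝ)⁻¹) / w, fun X hX ↦ ?_⟩
  have hX0 : 0 < X := by linarith
  set R := (X * N) ^ (d : ℝ)⁻¹
  have hR : 1 ≤ R := Real.one_le_rpow (by nlinarith) (by positivity)
  have hR0 : 0 < R := by linarith
  have hRd : R ^ d = X * N := by
    rw [← Real.rpow_natCast, ← Real.rpow_mul (by positivity), inv_mul_cancel₀ hd, Real.rpow_one]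
  have hRd' : R ^ d / R = X ^ (1 - (d : ℝ)⁻¹) * N ^ (1 - (d : ℝ)⁻¹) := by
    rw [hRd, ← Real.mul_rpow (by positivity) (by positivity), Real.rpow_sub (by positivity),
      Real.rpow_one]
  have h1 := h R hR
  rw [mul_div_assoc, hRd', tsum_coneWeight_lattice J hR0, hRd, hJ, inv_inv] at h1
  have h2 : ∀ I : {I : (Ideal (𝓞 K))⁰ // ClassGroup.mk0 I = C},
      (Ideal.absNorm (I.1 : Ideal (𝓞 K)) : ℝ) * N / (X * N) =
        Ideal.absNorm (I.1 : Ideal (𝓞 K)) / X := fun I ↦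
    mul_div_mul_right _ _ (by positivity)
  rw [tsum_congr fun I ↦ congrArg hat (h2 I)] at h1
  set S := ∑' I : {I : (Ideal (𝓞 K))⁰ // ClassGroup.mk0 I = C},
    hat (Ideal.absNorm (I.1 : Ideal (𝓞 K)) / X)
  have h3 : S - c * N / w * X = (w * S - c * (X * N)) / w := by field_simp
  rw [h3, abs_div, abs_of_pos hw, div_le_iff₀ hw]
  refine h1.trans_eq ?_
  field_simp

theorem exists_abs_sum_hat_sub_le :
    ∃ c M : ℝ, ∀ X, 1 ≤ X →
      |∑ n ∈ Finset.Icc 0 ⌊X⌋₊, idealCount K n * hat (n / X) - c * X| ≤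
        M * X ^ (1 - (finrank ℚ K : ℝ)⁻¹) := by
  choose c M h using exists_abs_tsum_class_sub_le K
  refine ⟨∑ C, c C, ∑ C, M C, fun X hX ↦ ?_⟩
  have hF : ∀ n : ℕ, ⌊X⌋₊ < n → hat (n / X) = 0 := fun n hn ↦
    hat_eq_zero_of_ge (by
      rw [one_le_div (by linarith)]
      exact (Nat.lt_of_floor_lt hn).le)
  set e := Equiv.sigmaFiberEquiv fun I : (Ideal (𝓞 K))⁰ ↦ ClassGroup.mk0 I
  have hs : Summable fun p ↦ hat (Ideal.absNorm (e p : Ideal (𝓞 K)) / X) :=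
    e.summable_iff.2 (summable_comp_absNorm K hF)
  rw [← tsum_comp_absNorm K hF, ← e.tsum_eq, hs.tsum_sigma, tsum_fintype, Finset.sum_mul,
    ← Finset.sum_sub_distrib, Finset.sum_mul]
  exact (Finset.abs_sum_le_sum_abs _ _).trans (Finset.sum_le_sum fun C _ ↦ h C X hX)

/-- The number of ideals of norm at most `x` is `c x + O(x ^ (1 - η))` for some `c, η > 0`. -/
theorem exists_powerSaving_idealCount :
    ∃ c C η : ℝ, 0 < c ∧ PowerSaving (idealCount K) c C η := by
  obtain ⟨c₀, M, h₀⟩ := exists_abs_sum_hat_sub_le K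
  set d := finrank ℚ K
  have hd : (1 : ℝ) ≤ d := Nat.one_le_cast.2 finrank_pos
  have hd' : (d : ℝ)⁻¹ ≤ 1 := inv_le_one_of_one_le₀ hd
  have hd0 : 0 < (d : ℝ)⁻¹ := by positivity
  have hM : 0 ≤ M := by
    have := (abs_nonneg _).trans (h₀ 1 le_rfl)
    simpa using this
  obtain ⟨c, C, hC, h⟩ := LatticeSum.exists_powerSaving (θ := 1 - (d : ℝ)⁻¹ / 2)
    (idealCount_zero K) (fun n ↦ Nat.cast_nonneg _) (by linarith) (by linarith) (c := c₀) (C := M)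
    fun X hX ↦ (h₀ X hX).trans (by gcongr; linarith)
  set η := (1 - (1 - (d : ℝ)⁻¹ / 2)) / 2 with hη
  have hη0 : 0 < η := by linarith
  have hlim := NumberField.Ideal.tendsto_norm_le_div_atTop₀ K
  have hpos : 0 < c := by
    have h1 : Tendsto (fun s : ℝ ↦
        (Nat.card {I : (Ideal (𝓞 K))⁰ // (Ideal.absNorm (I : Ideal (𝓞 K)) : ℝ) ≤ s} : ℝ) / s)
        atTop (𝓝 c) := by
      have h2 : Tendsto (fun s : ℝ ↦ C * s ^ (-η)) atTop (𝓝 0) := by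
        simpa using (tendsto_rpow_neg_atTop hη0).const_mul C
      rw [tendsto_iff_norm_sub_tendsto_zero]
      refine squeeze_zero' (Eventually.of_forall fun s ↦ norm_nonneg _) ?_ h2
      filter_upwards [eventually_ge_atTop 1] with s hs
      have hs0 : 0 < s := by linarith
      have h3 := h s hs
      rw [sum_idealCount] at h3
      simp only [← Nat.le_floor_iff hs0.le]
      rw [Real.norm_eq_abs, div_sub' hs0.ne', abs_div, abs_of_pos hs0, div_le_iff₀ hs0, mul_assoc,
        ← Real.rpow_add_one hs0.ne', mul_comm s c, neg_add_eq_sub]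
      exact h3
    rw [tendsto_nhds_unique h1 hlim]
    have := NumberField.Units.regulator_pos K
    have h4 : 0 < NumberField.Units.torsionOrder K := NumberField.Units.torsionOrder_pos K
    have h5 : NumberField.discr K ≠ 0 := NumberField.discr_ne_zero K
    have h6 : 0 < NumberField.classNumber K := Fintype.card_pos
    positivity
  exact ⟨c, C, η, hpos, idealCount_zero K, fun n ↦ Nat.cast_nonneg _, hη0, by linarith, hC, hpos.le,
    h⟩

end NumberField.IdealCount

namespace NumberField.IdealCount

open Module BeurlingPNT _root_.Ideal UniqueFactorizationMonoid
open scoped NumberField Classical nonZeroDivisors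

variable {K : Type*} [Field K] [NumberField K]

/-- The von Mangoldt function on ideals: `log N(P)` at the powers of the prime `P`. -/
noncomputable def idealVonMangoldt (I : Ideal (𝓞 K)) : ℝ :=
  if IsPrimePow I then Real.log (absNorm I.radical) else 0

theorem idealVonMangoldt_pow {P : Ideal (𝓞 K)} (hP : Prime P) {k : ℕ} (hk : k ≠ 0) :
    idealVonMangoldt (P ^ k) = Real.log (absNorm P) := by
  rw [idealVonMangoldt, if_pos ⟨P, k, hP, Nat.pos_of_ne_zero hk, rfl⟩,
    _root_.Ideal.radical_pow _ hk,
    (isPrime_of_prime hP).radical]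

theorem idealVonMangoldt_nonneg (I : Ideal (𝓞 K)) : 0 ≤ idealVonMangoldt I := by
  rw [idealVonMangoldt]
  split_ifs
  · exact Real.log_natCast_nonneg _
  · rfl

theorem one_lt_absNorm_of_prime {P : Ideal (𝓞 K)} (hP : Prime P) : 1 < absNorm P := by
  have h0 : absNorm P ≠ 0 := fun h ↦ hP.ne_zero (absNorm_eq_zero_iff.1 h)
  have h1 : absNorm P ≠ 1 := fun h ↦ (isPrime_of_prime hP).ne_top (absNorm_eq_one_iff.1 h)
  omega

theorem finite_setOf_dvd {I : Ideal (𝓞 K)} (hI : I ≠ 0) : {A | A ∣ I}.Finite := by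
  refine (finite_setOfPred_absNorm_le (absNorm I)).subset fun A hA ↦ ?_
  have hI' : absNorm I ≠ 0 := fun h ↦ hI (absNorm_eq_zero_iff.1 h)
  exact Nat.le_of_dvd (Nat.pos_of_ne_zero hI') (map_dvd absNorm hA)

theorem sum_idealVonMangoldt_dvd {I : Ideal (𝓞 K)} (hI : I ≠ 0) :
    ∑ A ∈ (finite_setOf_dvd hI).toFinset, idealVonMangoldt A = Real.log (absNorm I) := by
  have h0 : ∀ P ∈ normalizedFactors I, (absNorm P : ℝ) ≠ 0 := fun P hP ↦ by
    have := one_lt_absNorm_of_prime (prime_of_normalized_factor P hP)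
    positivity
  have h1 : Real.log (absNorm I) =
      ((normalizedFactors I).map fun P ↦ Real.log (absNorm P : ℝ)).sum := by
    conv_lhs => rw [← _root_.Ideal.prod_normalizedFactors_eq_self hI]
    rw [map_multiset_prod, Nat.cast_multiset_prod, Multiset.map_map, Real.log_multiset_prod,
      Multiset.map_map]
    · rfl
    · intro x hx
      obtain ⟨P, hP, rfl⟩ := Multiset.mem_map.1 hx
      exact h0 P hP
  rw [h1, Finset.sum_multiset_map_count]
  have h2 : ∀ P ∈ (normalizedFactors I).toFinset,
      (normalizedFactors I).count P • Real.log (absNorm P : ℝ) =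
        ∑ k ∈ Finset.Icc 1 ((normalizedFactors I).count P), Real.log (absNorm P : ℝ) :=
    fun P _ ↦ by simp
  rw [Finset.sum_congr rfl h2, Finset.sum_sigma']
  symm
  have hle : ∀ (P : Ideal (𝓞 K)) (k : ℕ), Prime P →
      (k ≤ (normalizedFactors I).count P ↔ P ^ k ∣ I) := fun P k hP ↦ by
    rw [Multiset.le_count_iff_replicate_le, pow_dvd_iff_le_emultiplicity,
      le_emultiplicity_iff_replicate_le_normalizedFactors hP.irreducible hI, normalize_eq]
  refine Finset.sum_bij_ne_zero (fun x _ _ ↦ x.1 ^ x.2) ?_ ?_ ?_ ?_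
  · rintro ⟨P, k⟩ h -
    simp only [Finset.mem_sigma, Multiset.mem_toFinset, Finset.mem_Icc] at h
    simpa using (hle P k (prime_of_normalized_factor P h.1)).1 h.2.2
  · rintro ⟨P, k⟩ h - ⟨Q, l⟩ h' - heq
    simp only [Finset.mem_sigma, Multiset.mem_toFinset, Finset.mem_Icc] at h h' heq
    have hP := prime_of_normalized_factor P h.1
    have hQ := prime_of_normalized_factor Q h'.1
    have h3 : P = Q := by
      have := congrArg _root_.Ideal.radical heq
      rwa [_root_.Ideal.radical_pow _ (by omega), _root_.Ideal.radical_pow _ (by omega),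
        (isPrime_of_prime hP).radical,
        (isPrime_of_prime hQ).radical] at this
    subst h3
    have h4 := congrArg absNorm heq
    rw [map_pow, map_pow] at h4
    rw [Nat.pow_right_injective (one_lt_absNorm_of_prime hP) h4]
  · intro A hA hA0
    have hpp : IsPrimePow A := by
      by_contra h
      exact hA0 (if_neg h)
    obtain ⟨P, k, hP, hk, rfl⟩ := hpp
    simp only [Set.Finite.mem_toFinset, Set.mem_ofPred_eq] at hA
    have hkc := (hle P k hP).2 hA
    refine ⟨⟨P, k⟩, ?_, ?_, rfl⟩
    · simp only [Finset.mem_sigma, Multiset.mem_toFinset, Finset.mem_Icc]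
      exact ⟨Multiset.count_pos.1 (Nat.lt_of_lt_of_le hk hkc), hk, hkc⟩
    · exact (Real.log_pos (Nat.one_lt_cast.2 (one_lt_absNorm_of_prime hP))).ne'
  · rintro ⟨P, k⟩ h -
    simp only [Finset.mem_sigma, Multiset.mem_toFinset, Finset.mem_Icc] at h
    exact (idealVonMangoldt_pow (prime_of_normalized_factor P h.1)
      (Nat.pos_iff_ne_zero.1 h.2.1)).symm

variable (K) in
/-- The ideals of norm `n`, as a finite set. -/
noncomputable def idealsOfNorm (n : ℕ) : Finset (Ideal (𝓞 K)) :=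
  (finite_setOfPred_absNorm_eq n).toFinset

@[simp] theorem mem_idealsOfNorm {n : ℕ} {I : Ideal (𝓞 K)} :
    I ∈ idealsOfNorm K n ↔ absNorm I = n := by
  simp [idealsOfNorm]

variable (K) in
theorem idealCount_eq_card {n : ℕ} (hn : n ≠ 0) : idealCount K n = (idealsOfNorm K n).card := by
  have : Nat.card {I : (Ideal (𝓞 K))⁰ // absNorm (I : Ideal (𝓞 K)) = n} =
      Nat.card (idealsOfNorm K n) := by
    refine Nat.card_congr ⟨fun I ↦ ⟨I.1.1, mem_idealsOfNorm.2 I.2⟩, fun I ↦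
      ⟨⟨I.1, absNorm_ne_zero_iff_mem_nonZeroDivisors.1 ?_⟩, mem_idealsOfNorm.1 I.2⟩,
      fun I ↦ rfl, fun I ↦ rfl⟩
    rwa [mem_idealsOfNorm.1 I.2]
  rw [idealCount, this, Nat.card_eq_fintype_card, Fintype.card_coe]

variable (K) in
/-- The sum of the von Mangoldt function over the ideals of norm `n`. -/
noncomputable def normVonMangoldt (n : ℕ) : ℝ := ∑ I ∈ idealsOfNorm K n, idealVonMangoldt I

variable (K) in
theorem isVonMangoldt_idealCount : IsVonMangoldt (idealCount K) (normVonMangoldt K) where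
  one := by
    rw [idealCount_eq_card K one_ne_zero, show idealsOfNorm K 1 = {⊤} by
      ext I; simp [absNorm_eq_one_iff]]
    simp
  nonneg n := Finset.sum_nonneg fun I _ ↦ idealVonMangoldt_nonneg I
  conv n := by
    rcases eq_or_ne n 0 with rfl | hn
    · simp
    have hne : ∀ {I : Ideal (𝓞 K)}, absNorm I = n → I ≠ 0 := fun h h' ↦ by
      rw [h', Ideal.zero_eq_bot, absNorm_bot] at h
      exact hn h.symm
    have hfin : {p : Ideal (𝓞 K) × Ideal (𝓞 K) | absNorm (p.1 * p.2) = n}.Finite := by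
      refine ((finite_setOfPred_absNorm_le n).prod (finite_setOfPred_absNorm_le n)).subset
        fun p hp ↦ ?_
      have h1 : absNorm (p.1 * p.2) = n := hp
      rw [map_mul] at h1
      exact ⟨Nat.le_of_dvd (Nat.pos_of_ne_zero hn) ⟨_, h1.symm⟩,
        Nat.le_of_dvd (Nat.pos_of_ne_zero hn) ⟨_, by rw [mul_comm]; exact h1.symm⟩⟩
    have hleft := Finset.sum_fiberwise_of_maps_to (s := hfin.toFinset)
      (t := n.divisorsAntidiagonal) (g := fun p ↦ (absNorm p.1, absNorm p.2))
      (fun p hp ↦ by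
        simp only [Set.Finite.mem_toFinset, Set.mem_ofPred_eq, map_mul] at hp
        exact Nat.mem_divisorsAntidiagonal.2 ⟨hp, hn⟩) fun p ↦ idealVonMangoldt p.1
    have hright := Finset.sum_fiberwise_of_maps_to (s := hfin.toFinset)
      (t := idealsOfNorm K n) (g := fun p ↦ p.1 * p.2)
      (fun p hp ↦ by simpa using hp) fun p ↦ idealVonMangoldt p.1
    have h1 : ∀ q ∈ n.divisorsAntidiagonal, normVonMangoldt K q.1 * idealCount K q.2 =
        ∑ p ∈ hfin.toFinset with (absNorm p.1, absNorm p.2) = q, idealVonMangoldt p.1 :=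
      fun q hq ↦ by
        have hq' := Nat.mem_divisorsAntidiagonal.1 hq
        have h2 : {p ∈ hfin.toFinset | (absNorm p.1, absNorm p.2) = q} =
            idealsOfNorm K q.1 ×ˢ idealsOfNorm K q.2 := by
          ext p
          simp only [Finset.mem_filter, Set.Finite.mem_toFinset, Set.mem_ofPred_eq, Prod.ext_iff,
            Finset.mem_product, mem_idealsOfNorm, map_mul, and_iff_right_iff_imp, and_imp]
          intro h3 h4
          rw [h3, h4, hq'.1]
        rw [h2, Finset.sum_product, normVonMangoldt, Finset.sum_mul,
          idealCount_eq_card K fun h ↦ hn (by rw [← hq'.1, h, mul_zero])]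
        simp [mul_comm]
    have h3 : ∀ I ∈ idealsOfNorm K n,
        ∑ p ∈ hfin.toFinset with p.1 * p.2 = I, idealVonMangoldt p.1 = Real.log n := fun I hI ↦ by
      rw [mem_idealsOfNorm] at hI
      have h4 := sum_idealVonMangoldt_dvd (hne hI)
      rw [hI] at h4
      rw [← h4]
      refine Finset.sum_nbij Prod.fst ?_ ?_ ?_ fun _ _ ↦ rfl
      · intro p hp
        simp only [Finset.mem_filter] at hp
        simpa using ⟨_, hp.2.symm⟩
      · intro p hp q hq hpq
        simp only [Finset.coe_filter, Set.mem_ofPred_eq] at hp hq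
        have hp0 : p.1 ≠ 0 := fun h ↦ hne hI (by rw [← hp.2, h, zero_mul])
        refine Prod.ext hpq (mul_left_cancel₀ hp0 ?_)
        rw [hp.2, hpq, hq.2]
      · rintro A hA
        simp only [Set.Finite.coe_toFinset, Set.mem_ofPred_eq] at hA
        obtain ⟨B, rfl⟩ := hA
        exact ⟨(A, B), by simpa using hI, rfl⟩
    rw [Finset.sum_congr rfl h1, hleft, ← hright, Finset.sum_congr rfl h3, Finset.sum_const,
      nsmul_eq_mul, idealCount_eq_card K hn]

end NumberField.IdealCount

namespace BeurlingPNT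

open Finset ArithmeticFunction

theorem isVonMangoldt_oneSeq : IsVonMangoldt oneSeq vonMangoldt where
  one := by simp [oneSeq]
  nonneg _ := vonMangoldt_nonneg
  conv n := by
    rcases eq_or_ne n 0 with rfl | hn
    · simp
    have h1 : ∀ p ∈ n.divisorsAntidiagonal, vonMangoldt p.1 * oneSeq p.2 = vonMangoldt p.1 :=
      fun p hp ↦ by
        have h2 : p.2 ≠ 0 := fun h ↦
          hn (by rw [← (Nat.mem_divisorsAntidiagonal.1 hp).1, h, mul_zero])
        simp [oneSeq, h2]
    rw [sum_congr rfl h1, Nat.sum_divisorsAntidiagonal (fun i _ ↦ vonMangoldt i),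
      vonMangoldt_sum]
    simp [oneSeq, hn]

theorem abs_sum_mul_le_of_antitone {g w : ℕ → ℝ} {B : ℝ} {z M : ℕ} (hzM : z < M)
    (hw : ∀ n, z < n → w (n + 1) ≤ w n) (hw0 : ∀ n, z < n → 0 ≤ w n)
    (hB : ∀ m, z < m → m ≤ M → |∑ n ∈ Ioc z m, g n| ≤ B) :
    |∑ n ∈ Ioc z M, g n * w n| ≤ B * w (z + 1) := by
  have key : ∀ m, z + 1 ≤ m → m ≤ M →
      |∑ n ∈ Ioc z m, g n * w n - (∑ n ∈ Ioc z m, g n) * w m| ≤ B * (w (z + 1) - w m) := by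
    intro m hm
    induction m, hm using Nat.le_induction with
    | base => simp
    | succ m hm ih =>
      intro hmM
      have h1 := ih (by omega)
      have h2 := hB m (by omega) (by omega)
      have h3 := mul_le_mul_of_nonneg_right h2 (sub_nonneg.2 (hw m hm))
      rw [← abs_of_nonneg (sub_nonneg.2 (hw m hm)), ← abs_mul,
        abs_of_nonneg (sub_nonneg.2 (hw m hm))] at h3
      rw [sum_Ioc_succ_top (by omega), sum_Ioc_succ_top (by omega)]
      calc _ = |(∑ n ∈ Ioc z m, g n * w n - (∑ n ∈ Ioc z m, g n) * w m) +
            (∑ n ∈ Ioc z m, g n) * (w m - w (m + 1))| := by ring_nf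
        _ ≤ _ := (abs_add_le _ _).trans (add_le_add h1 h3)
        _ = B * (w (z + 1) - w (m + 1)) := by ring
  have h1 := key M hzM le_rfl
  have h2 := mul_le_mul_of_nonneg_right (hB M hzM le_rfl) (hw0 M hzM)
  rw [← abs_of_nonneg (hw0 M hzM), ← abs_mul, abs_of_nonneg (hw0 M hzM)] at h2
  calc _ = |(∑ n ∈ Ioc z M, g n * w n - (∑ n ∈ Ioc z M, g n) * w M) +
        (∑ n ∈ Ioc z M, g n) * w M| := by ring_nf
    _ ≤ _ := (abs_add_le _ _).trans (add_le_add h1 h2)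
    _ = _ := by ring

theorem sum_vonMangoldt_mul_log_sq_le {N : ℕ} (hN : 2 ≤ N) :
    ∑ n ∈ Icc 1 N with ¬ n.Prime, vonMangoldt n * Real.log n ^ 2 ≤ 32 * (N * Real.log N) := by
  have hN1 : (1 : ℝ) ≤ N := by exact_mod_cast (by omega : 1 ≤ N)
  have hlog : 0 ≤ Real.log N := Real.log_nonneg hN1
  have h1 : ∑ n ∈ Icc 1 N with ¬ n.Prime, vonMangoldt n * Real.log n ^ 2 ≤
      (∑ n ∈ Icc 1 N with ¬ n.Prime, vonMangoldt n) * Real.log N ^ 2 := by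
    rw [sum_mul]
    refine sum_le_sum fun n hn ↦ ?_
    have hn' := mem_Icc.1 (mem_filter.1 hn).1
    have : (0 : ℝ) < n := by exact_mod_cast hn'.1
    have h2 : Real.log n ≤ Real.log N := Real.log_le_log this (by exact_mod_cast hn'.2)
    have h3 : 0 ≤ Real.log n := Real.log_natCast_nonneg n
    have h4 : 0 ≤ vonMangoldt n := vonMangoldt_nonneg
    gcongr
  have h2 := Chebyshev.psi_sub_theta_le hN1
  rw [Chebyshev.psi_sub_theta_eq_sum_not_prime, Nat.floor_natCast] at h2
  have h3 : Real.log N ^ 2 ≤ 16 * √N := by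
    have h4 := Real.log_le_rpow_div (x := N) (by positivity) (by norm_num : (0 : ℝ) < 1 / 4)
    have h5 : ((N : ℝ) ^ (1 / 4 : ℝ)) ^ 2 = √N := by
      rw [← Real.rpow_natCast, ← Real.rpow_mul (by positivity), Real.sqrt_eq_rpow]
      norm_num
    calc Real.log N ^ 2 ≤ ((N : ℝ) ^ (1 / 4 : ℝ) / (1 / 4)) ^ 2 := by gcongr
      _ = 16 * √N := by rw [div_pow, h5]; ring
  have h6 : √(N : ℝ) * √N = N := Real.mul_self_sqrt (by positivity)
  calc _ ≤ (2 * √N * Real.log N) * Real.log N ^ 2 := h1.trans (by gcongr; exact h2)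
    _ ≤ (2 * √N * Real.log N) * (16 * √N) := by gcongr
    _ = 32 * (N * Real.log N) := by linear_combination (32 * Real.log N) * h6

end BeurlingPNT

namespace NumberField.IdealCount

open Module BeurlingPNT _root_.Ideal ArithmeticFunction
open scoped NumberField Classical nonZeroDivisors

variable (K : Type*) [Field K] [NumberField K]

theorem normVonMangoldt_nonneg (n : ℕ) : 0 ≤ normVonMangoldt K n :=
  Finset.sum_nonneg fun I _ ↦ idealVonMangoldt_nonneg I

theorem normVonMangoldt_prime {p : ℕ} (hp : p.Prime) :
    normVonMangoldt K p = idealCount K p * Real.log p := by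
  rw [idealCount_eq_card K hp.ne_zero, normVonMangoldt, ← nsmul_eq_mul]
  refine Finset.sum_eq_card_nsmul fun I hI ↦ ?_
  rw [mem_idealsOfNorm] at hI
  have hI0 : I ≠ ⊥ := fun h ↦ hp.ne_zero (by rw [← hI, h, absNorm_bot])
  have h1 : I.IsPrime := isPrime_of_irreducible_absNorm (by rw [hI]; exact hp)
  rw [← pow_one I, idealVonMangoldt_pow (prime_of_isPrime hI0 h1) one_ne_zero, hI]

theorem normVonMangoldt_le (n : ℕ) : normVonMangoldt K n ≤ finrank ℚ K * vonMangoldt n := by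
  have hfilter : normVonMangoldt K n =
      ∑ A ∈ idealsOfNorm K n with IsPrimePow A, idealVonMangoldt A.radical := by
    rw [normVonMangoldt, Finset.sum_filter]
    refine Finset.sum_congr rfl fun A _ ↦ ?_
    split_ifs with h
    · obtain ⟨P, k, hP, hk, rfl⟩ := h
      rw [Ideal.radical_pow _ hk.ne', (isPrime_of_prime hP).radical,
        idealVonMangoldt_pow hP hk.ne', ← pow_one P, idealVonMangoldt_pow hP one_ne_zero, pow_one]
    · exact if_neg h
  rcases ({A ∈ idealsOfNorm K n | IsPrimePow A}).eq_empty_or_nonempty with h | ⟨A₀, h⟩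
  · rw [hfilter, h, Finset.sum_empty]
    exact mul_nonneg (Nat.cast_nonneg _) vonMangoldt_nonneg
  rw [Finset.mem_filter, mem_idealsOfNorm] at h
  obtain ⟨hA₀, P₀, k₀, hP₀, hk₀, rfl⟩ := h
  have : P₀.IsMaximal := (isPrime_of_prime hP₀).isMaximal hP₀.ne_zero
  obtain ⟨p, f, hf, -, hp, hPf⟩ := exists_prime_and_absNorm_eq_pow P₀
  have hn : n = p ^ (f * k₀) := by rw [← hA₀, map_pow, hPf, pow_mul]
  have hp0 : (span {(p : 𝓞 K)}) ≠ 0 := by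
    rw [Ne, Ideal.zero_eq_bot, span_singleton_eq_bot]
    exact_mod_cast hp.ne_zero
  have hsum := sum_idealVonMangoldt_dvd hp0
  rw [absNorm_span_natCast, RingOfIntegers.rank, Nat.cast_pow, Real.log_pow] at hsum
  rw [hn, vonMangoldt_apply_pow (by positivity), vonMangoldt_apply_prime hp, ← hsum, ← hn, hfilter]
  have hinj : Set.InjOn (fun A : Ideal (𝓞 K) ↦ A.radical)
      ({A ∈ idealsOfNorm K n | IsPrimePow A} : Finset _) := by
    intro A hA B hB hAB
    simp only [Finset.coe_filter, mem_idealsOfNorm, Set.mem_ofPred_eq] at hA hB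
    obtain ⟨hA, P, k, hP, hk, rfl⟩ := hA
    obtain ⟨hB, Q, l, hQ, hl, rfl⟩ := hB
    simp only [Ideal.radical_pow _ hk.ne', Ideal.radical_pow _ hl.ne',
      (isPrime_of_prime hP).radical, (isPrime_of_prime hQ).radical] at hAB
    subst hAB
    rw [← hB, map_pow, map_pow] at hA
    rw [Nat.pow_right_injective (one_lt_absNorm_of_prime hP) hA]
  rw [← Finset.sum_image (f := idealVonMangoldt) hinj]
  refine Finset.sum_le_sum_of_subset_of_nonneg ?_ fun I _ _ ↦ idealVonMangoldt_nonneg I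
  intro Q hQ
  obtain ⟨A, hA, rfl⟩ := Finset.mem_image.1 hQ
  rw [Finset.mem_filter, mem_idealsOfNorm] at hA
  obtain ⟨hA, P, k, hP, hk, rfl⟩ := hA
  rw [Ideal.radical_pow _ hk.ne', (isPrime_of_prime hP).radical]
  simp only [Set.Finite.mem_toFinset, Set.mem_ofPred_eq]
  rw [dvd_span_singleton]
  refine (isPrime_of_prime hP).mem_of_pow_mem (f * k₀) ?_
  have h1 := Ideal.pow_le_self hk.ne' (absNorm_mem (P ^ k))
  rwa [hA, hn, Nat.cast_pow] at h1

theorem exists_abs_sum_prime_mul_log_le : ∃ C, 0 ≤ C ∧ ∀ N : ℕ, 2 ≤ N →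
    |∑ n ∈ Finset.Icc 1 N with n.Prime, (idealCount K n - 1) * Real.log n ^ 3| ≤
      C * (N * Real.log N) := by
  obtain ⟨c, C, η, hc, h⟩ := exists_powerSaving_idealCount K
  obtain ⟨M, hM, hK⟩ := (isVonMangoldt_idealCount K).exists_abs_sum_le h hc
  obtain ⟨M', hM', hQ⟩ := isVonMangoldt_oneSeq.exists_abs_sum_le powerSaving_oneSeq one_pos
  refine ⟨M + M' + (finrank ℚ K + 1) * 32, by positivity, fun N hN ↦ ?_⟩
  have hsplit := Finset.sum_filter_add_sum_filter_not (Finset.Icc 1 N) (fun n ↦ n.Prime)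
    fun n ↦ (normVonMangoldt K n - vonMangoldt n) * Real.log n ^ 2
  have hprime : ∑ n ∈ Finset.Icc 1 N with n.Prime,
      (normVonMangoldt K n - vonMangoldt n) * Real.log n ^ 2 =
        ∑ n ∈ Finset.Icc 1 N with n.Prime, (idealCount K n - 1) * Real.log n ^ 3 := by
    refine Finset.sum_congr rfl fun n hn ↦ ?_
    have hp := (Finset.mem_filter.1 hn).2
    rw [normVonMangoldt_prime K hp, vonMangoldt_apply_prime hp]
    ring
  have hrest : |∑ n ∈ Finset.Icc 1 N with ¬ n.Prime,
      (normVonMangoldt K n - vonMangoldt n) * Real.log n ^ 2| ≤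
        (finrank ℚ K + 1) * (32 * (N * Real.log N)) := by
    refine (Finset.abs_sum_le_sum_abs _ _).trans (le_trans ?_ (mul_le_mul_of_nonneg_left
      (sum_vonMangoldt_mul_log_sq_le hN) (by positivity)))
    rw [Finset.mul_sum]
    refine Finset.sum_le_sum fun n _ ↦ ?_
    have h1 := normVonMangoldt_le K n
    have h2 := normVonMangoldt_nonneg K n
    have h3 : 0 ≤ vonMangoldt n := vonMangoldt_nonneg
    have h4 : (0 : ℝ) ≤ finrank ℚ K := Nat.cast_nonneg _
    have h5 := mul_nonneg h4 h3
    rw [abs_mul, abs_of_nonneg (sq_nonneg (Real.log n)), ← mul_assoc]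
    refine mul_le_mul_of_nonneg_right ?_ (sq_nonneg _)
    rw [abs_le]
    constructor <;> linarith
  have hall : ∑ n ∈ Finset.Icc 1 N, (normVonMangoldt K n - vonMangoldt n) * Real.log n ^ 2 =
      ∑ n ∈ Finset.Icc 1 N, (normVonMangoldt K n - 1) * Real.log n ^ 2 -
        ∑ n ∈ Finset.Icc 1 N, (vonMangoldt n - 1) * Real.log n ^ 2 := by
    rw [← Finset.sum_sub_distrib]
    exact Finset.sum_congr rfl fun n _ ↦ by ring
  rw [hprime, hall] at hsplit
  have h1 := abs_le.1 (hK N hN)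
  have h2 := abs_le.1 (hQ N hN)
  have h3 := abs_le.1 hrest
  rw [abs_le]
  constructor <;> linarith

theorem exists_abs_sum_prime_sub_one_le : ∃ C, 0 ≤ C ∧ ∀ z : ℕ, 2 ≤ z →
    |∑ p ∈ Finset.Ioc z (2 * z) with p.Prime, (idealCount K p - 1)| ≤
      C * z / Real.log z ^ 2 := by
  obtain ⟨C, hC, h⟩ := exists_abs_sum_prime_mul_log_le K
  refine ⟨8 * C, by positivity, fun z hz ↦ ?_⟩
  have hz1 : (1 : ℝ) < z := by exact_mod_cast hz
  have hlog : 0 < Real.log z := Real.log_pos hz1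
  set g : ℕ → ℝ := fun n ↦ if n.Prime then (idealCount K n - 1) * Real.log n ^ 3 else 0
  have hG : ∀ N : ℕ, 2 ≤ N → |∑ n ∈ Finset.Icc 1 N, g n| ≤ C * (N * Real.log N) := fun N hN ↦ by
    rw [← Finset.sum_filter]
    exact h N hN
  have hmono : ∀ m : ℕ, 2 ≤ m → m ≤ 2 * z → C * (m * Real.log m) ≤ C * (4 * z * Real.log z) :=
    fun m hm hmz ↦ by
      have h0 : (0 : ℝ) < m := by positivity
      have h1 : (m : ℝ) ≤ 2 * z := by exact_mod_cast hmz
      have h2 : Real.log m ≤ 2 * Real.log z := by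
        rw [← Real.log_rpow (by positivity), Real.rpow_ofNat]
        refine Real.log_le_log h0 (h1.trans ?_)
        have : (2 : ℝ) ≤ z := by exact_mod_cast hz
        nlinarith
      have h3 : 0 ≤ Real.log m := Real.log_natCast_nonneg m
      calc C * (m * Real.log m) ≤ C * (2 * z * (2 * Real.log z)) := by gcongr
        _ = C * (4 * z * Real.log z) := by ring
  have hlogm : ∀ n : ℕ, z < n → 0 < Real.log n := fun n hn ↦
    hlog.trans_le (Real.log_le_log (by positivity) (by exact_mod_cast hn.le))
  have key := abs_sum_mul_le_of_antitone (g := g) (w := fun n ↦ (Real.log n ^ 3)⁻¹)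
    (B := 8 * C * (z * Real.log z)) (z := z) (M := 2 * z) (by omega)
    (fun n hn ↦ by
      have := hlogm n hn
      have h0 : (0 : ℝ) < n := by exact_mod_cast (by omega : 0 < n)
      have h1 : Real.log n ≤ Real.log (n + 1 : ℕ) := Real.log_le_log h0 (by push_cast; linarith)
      gcongr)
    (fun n hn ↦ by
      have := hlogm n hn
      positivity)
    (fun m hm hmz ↦ by
      have h1 : ∑ n ∈ Finset.Ioc z m, g n =
          ∑ n ∈ Finset.Icc 1 m, g n - ∑ n ∈ Finset.Icc 1 z, g n := by
        rw [eq_sub_iff_add_eq', ← Finset.sum_union]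
        · refine Finset.sum_congr ?_ fun _ _ ↦ rfl
          ext n
          simp only [Finset.mem_union, Finset.mem_Icc, Finset.mem_Ioc]
          omega
        · rw [Finset.disjoint_left]
          intro n
          simp only [Finset.mem_Icc, Finset.mem_Ioc]
          omega
      have h2 := abs_le.1 ((hG m (by omega)).trans (hmono m (by omega) hmz))
      have h3 := abs_le.1 ((hG z hz).trans (hmono z hz (by omega)))
      rw [h1, abs_le]
      constructor <;> linarith)
  have heq : ∑ n ∈ Finset.Ioc z (2 * z), g n * (Real.log n ^ 3)⁻¹ =
      ∑ p ∈ Finset.Ioc z (2 * z) with p.Prime, (idealCount K p - 1) := by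
    rw [Finset.sum_filter]
    refine Finset.sum_congr rfl fun n hn ↦ ?_
    have := (hlogm n (Finset.mem_Ioc.1 hn).1).ne'
    simp only [g]
    split_ifs
    · field_simp
    · rw [zero_mul]
  rw [heq] at key
  refine key.trans ?_
  have h1 : (Real.log (z + 1 : ℕ) ^ 3)⁻¹ ≤ (Real.log z ^ 3)⁻¹ := by
    have h2 : Real.log z ≤ Real.log (z + 1 : ℕ) :=
      Real.log_le_log (by positivity) (by push_cast; linarith)
    gcongr
  calc 8 * C * (z * Real.log z) * (Real.log (z + 1 : ℕ) ^ 3)⁻¹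
      ≤ 8 * C * (z * Real.log z) * (Real.log z ^ 3)⁻¹ := by gcongr
    _ = 8 * C * z / Real.log z ^ 2 := by field_simp

end NumberField.IdealCount

section Derangements

open Finset
open scoped Classical

theorem sum_powerset_neg_one_pow_mul_natCard {X R : Type*} [Finite X] (Ω : Finset R)
    (B : X → R → Prop) :
    ∑ S ∈ Ω.powerset, (-1 : ℝ) ^ S.card * Nat.card {x // ∀ b ∈ S, B x b} =
      Nat.card {x // ∀ b ∈ Ω, ¬ B x b} := by
  have := Fintype.ofFinite X
  have hcard (q : X → Prop) : (Nat.card {x // q x} : ℝ) = ∑ x, if q x then 1 else 0 := by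
    rw [Nat.card_eq_fintype_card, Fintype.card_subtype, sum_boole]
  simp_rw [hcard, mul_sum]
  rw [sum_comm]
  refine sum_congr rfl fun x _ ↦ ?_
  have h1 : ∑ S ∈ Ω.powerset, (-1 : ℝ) ^ S.card * (if ∀ b ∈ S, B x b then 1 else 0) =
      ∑ S ∈ (Ω.filter (B x)).powerset, (-1 : ℝ) ^ S.card := by
    simp_rw [mul_ite, mul_one, mul_zero]
    rw [← sum_filter]
    refine sum_congr ?_ fun _ _ ↦ rfl
    ext S
    simp only [mem_filter, mem_powerset, subset_iff]
    grind
  have h2 := congrArg (Int.cast (R := ℝ)) (sum_powerset_neg_one_pow_card (x := Ω.filter (B x)))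
  push_cast at h2
  simp only [filter_eq_empty_iff] at h2
  convert h1.trans h2

variable {G X : Type*} [Group G] [MulAction G X] [Finite G] [Finite X]

theorem card_le_natCard_derangements_add_one [MulAction.IsPretransitive G X]
    (hX : 2 ≤ Nat.card X) :
    Nat.card X ≤ Nat.card {g : G // ∀ x : X, g • x ≠ x} + 1 := by
  have := Fintype.ofFinite X
  have := Fintype.ofFinite G
  have : Nonempty X := Finite.card_pos_iff.1 (by omega)
  have h := MulAction.sum_card_fixedBy_eq_card_orbits_mul_card_group G X
  rw [Fintype.card_eq_one_iff_nonempty_unique.2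
    ⟨MulAction.pretransitive_iff_unique_quotient_of_nonempty G X |>.1 inferInstance |>.some⟩,
    one_mul] at h
  rw [Nat.card_eq_fintype_card (α := {g : G // _}), Fintype.card_subtype]
  have h1 : ∀ g : G, g ∈ univ.erase (1 : G) → 1 ≤ Fintype.card (MulAction.fixedBy X g) +
      if ∀ x : X, g • x ≠ x then 1 else 0 := fun g _ ↦ by
    split_ifs with hg
    · omega
    · push Not at hg
      obtain ⟨x, hx⟩ := hg
      exact Fintype.card_pos_iff.2 ⟨⟨x, hx⟩⟩
  have h2 := sum_le_sum h1
  rw [sum_add_distrib, sum_boole, Nat.cast_id, sum_const, smul_eq_mul, mul_one,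
    card_erase_of_mem (mem_univ _), card_univ] at h2
  rw [← add_sum_erase _ _ (mem_univ (1 : G))] at h
  have h3 : Fintype.card (MulAction.fixedBy X (1 : G)) = Nat.card X := by
    rw [← Nat.card_eq_fintype_card]
    simp
  have h4 : #{g ∈ univ.erase (1 : G) | ∀ x : X, g • x ≠ x} ≤ #{g : G | ∀ x : X, g • x ≠ x} :=
    card_le_card (filter_subset_filter _ (erase_subset _ _))
  have h5 : 0 < Fintype.card G := Fintype.card_pos
  omega

omit [Finite G] in
theorem natCard_le_factorial_of_faithfulSMul [FaithfulSMul G X] :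
    Nat.card G ≤ (Nat.card X).factorial := by
  rw [← Nat.card_perm]
  exact Nat.card_le_card_of_injective _ (MulAction.toPerm_injective (α := G) (β := X))

end Derangements

namespace NumberField.IdealCount

open _root_.Ideal
open scoped NumberField nonZeroDivisors

section Hom

variable (K : Type*) [Field K] [NumberField K] (k : Type*) [Field k] {p : ℕ} [CharP k p]

theorem idealCount_prime (hp : p.Prime) :
    idealCount K p = Nat.card {ψ : 𝓞 K →+* k // ∀ x, ∃ n : ℤ, ψ x = n} := by
  have := Fact.mk hp
  have hker (ψ : 𝓞 K →+* k) (hψ : ∀ x, ∃ n : ℤ, ψ x = n) : absNorm (RingHom.ker ψ) = p := by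
    have h1 : ψ.range = (ZMod.castHom (dvd_refl p) k).range := by
      refine le_antisymm ?_ ?_
      · rintro _ ⟨x, rfl⟩
        obtain ⟨n, hn⟩ := hψ x
        exact ⟨n, by simp [hn]⟩
      · rintro _ ⟨x, rfl⟩
        obtain ⟨n, rfl⟩ := ZMod.intCast_surjective x
        exact ⟨n, by simp⟩
    have h2 : Nat.card (ZMod.castHom (dvd_refl p) k).range = p := by
      exact (Nat.card_congr (Equiv.ofInjective _ (ZMod.castHom_injective (R := k)))).symm.trans
        (Nat.card_zmod p)
    rw [absNorm_apply, Submodule.cardQuot_apply, ← h2, ← h1]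
    exact Nat.card_congr (RingHom.quotientKerEquivRange ψ).toEquiv
  have h0 (ψ : 𝓞 K →+* k) (hψ : ∀ x, ∃ n : ℤ, ψ x = n) :
      RingHom.ker ψ ∈ (Ideal (𝓞 K))⁰ := by
    rw [mem_nonZeroDivisors_iff_ne_zero]
    intro h
    have := hker ψ hψ
    rw [h, Ideal.zero_eq_bot, absNorm_bot] at this
    exact hp.ne_zero this.symm
  rw [idealCount, Nat.cast_inj]
  refine (Nat.card_eq_of_bijective
    (fun ψ ↦ ⟨⟨RingHom.ker ψ.1, h0 ψ.1 ψ.2⟩, hker ψ.1 ψ.2⟩) ⟨?_, ?_⟩).symm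
  · rintro ⟨ψ, hψ⟩ ⟨ψ', hψ'⟩ h
    simp only [Subtype.mk.injEq] at h ⊢
    ext x
    obtain ⟨n, hn⟩ := hψ x
    have h1 : x - n ∈ RingHom.ker ψ := by simp [RingHom.mem_ker, hn]
    rw [h, RingHom.mem_ker, map_sub, map_intCast, sub_eq_zero] at h1
    rw [hn, h1]
  · rintro ⟨⟨I, hI0⟩, hI⟩
    simp only at hI
    rw [absNorm_apply, Submodule.cardQuot_apply] at hI
    have : Finite (𝓞 K ⧸ I) := Nat.finite_of_card_ne_zero (by rw [hI]; exact hp.ne_zero)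
    have := Fintype.ofFinite (𝓞 K ⧸ I)
    rw [Nat.card_eq_fintype_card] at hI
    set e := ZMod.ringEquivOfPrime (𝓞 K ⧸ I) hp hI
    set φ := (ZMod.castHom (dvd_refl p) k).comp e.symm.toRingHom
    have hφ : Function.Injective φ := (ZMod.castHom_injective k).comp e.symm.injective
    refine ⟨⟨φ.comp (Ideal.Quotient.mk I), fun x ↦ ?_⟩, ?_⟩
    · obtain ⟨n, hn⟩ := ZMod.intCast_surjective (e.symm (Ideal.Quotient.mk I x))
      exact ⟨n, by simp [φ, ← hn]⟩
    · simp only [Subtype.mk.injEq]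
      rw [RingHom.ker_comp_of_injective _ hφ, mk_ker]

end Hom

theorem _root_.RingHom.exists_comp_algebraMap_eq_of_isIntegral {R S k : Type*} [CommRing R]
    [CommRing S] [Algebra R S] [Algebra.IsIntegral R S] [FaithfulSMul R S] [Field k] [IsAlgClosed k]
    (ψ : R →+* k) : ∃ χ : S →+* k, χ.comp (algebraMap R S) = ψ := by
  have := RingHom.ker_isPrime ψ
  obtain ⟨Q, -, hQ, hQc⟩ := exists_ideal_over_prime_of_isIntegral (RingHom.ker ψ)
    (⊥ : Ideal S) (by
      rw [← RingHom.ker_eq_comap_bot, (RingHom.injective_iff_ker_eq_bot _).1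
        (FaithfulSMul.algebraMap_injective R S)]
      exact bot_le)
  have hQl : Q.LiesOver (RingHom.ker ψ) := ⟨hQc.symm⟩
  obtain ⟨φ, hφ, hφi⟩ : ∃ φ : R ⧸ RingHom.ker ψ →+* k, φ.comp (Ideal.Quotient.mk _) = ψ ∧
      Function.Injective φ := ⟨RingHom.kerLift ψ, by ext; rfl, RingHom.kerLift_injective ψ⟩
  rw [← hφ]
  clear hQc hφ
  generalize RingHom.ker ψ = P at *
  let _ := φ.toAlgebra
  have h1 : Module.IsTorsionFree (R ⧸ P) k := Module.isTorsionFree_iff_algebraMap_injective.2 hφi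
  have h2 : Module.IsTorsionFree (R ⧸ P) (S ⧸ Q) :=
    Module.isTorsionFree_iff_algebraMap_injective.2 (FaithfulSMul.algebraMap_injective _ _)
  have h3 : Algebra.IsAlgebraic (R ⧸ P) (S ⧸ Q) := Algebra.IsIntegral.isAlgebraic
  let l : (S ⧸ Q) →ₐ[R ⧸ P] k := IsAlgClosed.lift
  refine ⟨l.toRingHom.comp (Ideal.Quotient.mk Q), ?_⟩
  ext x
  exact l.commutes (Ideal.Quotient.mk _ x)

end NumberField.IdealCount

namespace NumberField.IdealCount

open Polynomial
open scoped NumberField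

variable {L : Type*} [Field L] [NumberField L]

theorem exists_smul_mem_adjoin_of_mem_adjoin (S : Set (𝓞 L)) {x : L}
    (hx : x ∈ Algebra.adjoin ℚ (algebraMap (𝓞 L) L '' S)) :
    ∃ N : ℕ, N ≠ 0 ∧ N • x ∈ (Algebra.adjoin ℤ S).map (Algebra.algHom ℤ (𝓞 L) L) := by
  set A := (Algebra.adjoin ℤ S).map (Algebra.algHom ℤ (𝓞 L) L)
  induction hx using Algebra.adjoin_induction with
  | mem x hx =>
    obtain ⟨y, hy, rfl⟩ := hx
    exact ⟨1, one_ne_zero, by rw [one_smul]; exact ⟨y, Algebra.subset_adjoin hy, rfl⟩⟩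
  | algebraMap q =>
    refine ⟨q.den, q.den_ne_zero, ?_⟩
    have : q.den • algebraMap ℚ L q = algebraMap ℤ L q.num := by
      rw [nsmul_eq_mul, eq_ratCast, eq_intCast]
      exact_mod_cast congrArg (Rat.cast (K := L)) (Rat.den_mul_eq_num q)
    rw [this]
    exact A.algebraMap_mem _
  | add x y _ _ hx hy =>
    obtain ⟨N, hN, hx⟩ := hx
    obtain ⟨M, hM, hy⟩ := hy
    refine ⟨N * M, mul_ne_zero hN hM, ?_⟩
    rw [smul_add]
    refine add_mem ?_ ?_
    · rw [mul_comm, mul_smul]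
      exact nsmul_mem hx M
    · rw [mul_smul]
      exact nsmul_mem hy N
  | mul x y _ _ hx hy =>
    obtain ⟨N, hN, hx⟩ := hx
    obtain ⟨M, hM, hy⟩ := hy
    refine ⟨N * M, mul_ne_zero hN hM, ?_⟩
    rw [mul_smul_mul_comm]
    exact mul_mem hx hy

theorem exists_forall_smul_mem_adjoin (S : Set (𝓞 L)) :
    ∃ N : ℕ, N ≠ 0 ∧ ∀ x : 𝓞 L,
      (x : L) ∈ IntermediateField.adjoin ℚ (algebraMap (𝓞 L) L '' S) →
        N • x ∈ Algebra.adjoin ℤ S := by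
  set F := IntermediateField.adjoin ℚ (algebraMap (𝓞 L) L '' S)
  let M : Submodule ℤ (𝓞 L) :=
    (F.toSubalgebra.restrictScalars ℤ).toSubmodule.comap (Algebra.algHom ℤ (𝓞 L) L).toLinearMap
  have hM : ∀ x : 𝓞 L, x ∈ M ↔ (x : L) ∈ F := fun x ↦ Iff.rfl
  have key : ∀ x ∈ M, ∃ N : ℕ, N ≠ 0 ∧ N • x ∈ Algebra.adjoin ℤ S := by
    intro x hx
    rw [hM, ← IntermediateField.mem_toSubalgebra,
      IntermediateField.adjoin_toSubalgebra_of_isAlgebraic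
        fun x _ ↦ Algebra.IsAlgebraic.isAlgebraic x] at hx
    obtain ⟨N, hN, y, hy, hxy⟩ := exists_smul_mem_adjoin_of_mem_adjoin S hx
    refine ⟨N, hN, ?_⟩
    have : y = N • x := RingOfIntegers.coe_injective (by rw [map_nsmul]; exact hxy)
    rwa [← this]
  choose! N hN0 hN using key
  obtain ⟨t, ht⟩ := (IsNoetherian.noetherian M : M.FG)
  have htM : ∀ x ∈ t, x ∈ M := fun x hx ↦ ht ▸ Submodule.subset_span hx
  refine ⟨∏ x ∈ t, N x, Finset.prod_ne_zero_iff.2 fun x hx ↦ hN0 x (htM x hx), fun x hx ↦ ?_⟩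
  rw [← hM, ← ht] at hx
  induction hx using Submodule.span_induction with
  | mem x hx =>
    obtain ⟨m, hm⟩ := Finset.dvd_prod_of_mem N hx
    rw [hm, mul_comm, mul_smul]
    exact nsmul_mem (hN x (htM x hx)) m
  | zero => simp
  | add x y _ _ hx hy => rw [smul_add]; exact add_mem hx hy
  | smul a x _ hx => rw [smul_comm]; exact zsmul_mem hx a

theorem exists_adjoin_ringOfIntegers_eq_top :
    ∃ θ : 𝓞 L, IntermediateField.adjoin ℚ {(θ : L)} = ⊤ := by
  obtain ⟨α, hα⟩ := Field.exists_primitive_element ℚ L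
  obtain ⟨n, hn, hint⟩ :=
    ((IsFractionRing.isAlgebraic_iff ℤ ℚ L).2
      (Algebra.IsAlgebraic.isAlgebraic (R := ℚ) α)).exists_integral_multiple
  refine ⟨⟨n • α, hint⟩, top_le_iff.1 ?_⟩
  rw [← hα, IntermediateField.adjoin_simple_le_iff]
  have h1 := IntermediateField.mem_adjoin_simple_self ℚ (n • α)
  have h2 : (n : ℚ)⁻¹ • n • α = α := by
    rw [← Int.cast_smul_eq_zsmul ℚ, inv_smul_smul₀ (by exact_mod_cast hn)]
  have h3 := IntermediateField.smul_mem _ (x := (n : ℚ)⁻¹) h1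
  rwa [h2] at h3

/-- Precomposition by the Galois group acts freely on the homomorphisms from the ring of integers
to `k`, and every subgroup acts transitively on those agreeing on its fixed elements. -/
def IsHomTorsor (L k : Type*) [Field L] [NumberField L] [Field k] : Prop :=
  ∀ χ : 𝓞 L →+* k,
    (∀ g : Gal(L/ℚ), (∀ x : 𝓞 L, χ (g • x) = χ x) → g = 1) ∧
    ∀ (H : Subgroup Gal(L/ℚ)) (χ' : 𝓞 L →+* k),
      (∀ x : 𝓞 L, (∀ h ∈ H, h • x = x) → χ x = χ' x) → ∃ h ∈ H, ∀ x, χ' x = χ (h • x)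

variable (L) in
theorem exists_forall_isHomTorsor : ∃ M : ℕ, M ≠ 0 ∧ ∀ p : ℕ, ¬ p ∣ M →
    ∀ (k : Type) [Field k] [CharP k p], IsHomTorsor L k := by
  classical
  obtain ⟨θ, hθ⟩ := exists_adjoin_ringOfIntegers_eq_top (L := L)
  obtain ⟨N, hN0, hN⟩ := exists_forall_smul_mem_adjoin {θ}
  rw [Set.image_singleton, hθ] at hN
  have hgθ : ∀ g : Gal(L/ℚ), g • θ = θ → g = 1 := by
    intro g hg
    have h1 : g (θ : L) = θ := congrArg (fun x : 𝓞 L ↦ (x : L)) hg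
    ext x
    have hx : x ∈ IntermediateField.adjoin ℚ {(θ : L)} := hθ ▸ IntermediateField.mem_top
    simp only [AlgEquiv.one_apply]
    induction hx using IntermediateField.adjoin_induction with
    | mem x hx => rw [Set.mem_singleton_iff.1 hx, h1]
    | algebraMap q => exact g.commutes q
    | add x y _ _ hx hy => rw [map_add, hx, hy]
    | inv x _ hx => rw [map_inv₀, hx]
    | mul x y _ _ hx hy => rw [map_mul, hx, hy]
  set Δ := ∏ g ∈ Finset.univ.erase (1 : Gal(L/ℚ)), (g • θ - θ)
  have hΔ : Δ ≠ 0 := Finset.prod_ne_zero_iff.2 fun g hg h ↦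
    (Finset.mem_erase.1 hg).1 (hgθ g (sub_eq_zero.1 h))
  have hΔN : Δ ∣ (Ideal.absNorm (Ideal.span {Δ}) : 𝓞 L) :=
    Ideal.mem_span_singleton.1 (Ideal.absNorm_mem _)
  refine ⟨N * Ideal.absNorm (Ideal.span {Δ}), mul_ne_zero hN0 ?_, fun p hpM k _ _ χ ↦ ⟨?_, ?_⟩⟩
  · rwa [Ne, Ideal.absNorm_eq_zero_iff, Ideal.span_singleton_eq_bot]
  · intro g hg
    by_contra hg1
    have h1 : χ Δ = 0 := by
      rw [map_prod]
      refine Finset.prod_eq_zero (Finset.mem_erase.2 ⟨hg1, Finset.mem_univ g⟩) ?_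
      rw [map_sub, hg, sub_self]
    have h2 := map_dvd χ hΔN
    rw [h1, zero_dvd_iff, map_natCast, CharP.cast_eq_zero_iff k p] at h2
    exact hpM (h2.mul_left N)
  · intro H χ' hχ
    have hNk : (N : k) ≠ 0 := by
      rw [Ne, CharP.cast_eq_zero_iff k p]
      exact fun h ↦ hpM (h.mul_right _)
    set f := MulSemiringAction.charpoly H θ
    have h1 : f.map χ = f.map χ' := by
      ext i
      rw [coeff_map, coeff_map]
      exact hχ _ fun h hh ↦ MulSemiringAction.smul_coeff_charpoly θ i (⟨h, hh⟩ : H)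
    have h2 : (f.map χ).eval (χ' θ) = 0 := by
      rw [h1, eval_map_apply, MulSemiringAction.eval_charpoly, map_zero]
    rw [show f = _ from MulSemiringAction.charpoly_eq H θ, Polynomial.map_prod, eval_prod,
      Finset.prod_eq_zero_iff] at h2
    obtain ⟨h, -, h2⟩ := h2
    simp only [Polynomial.map_sub, map_X, map_C, eval_sub, eval_X, eval_C, sub_eq_zero] at h2
    refine ⟨h, h.2, fun x ↦ mul_left_cancel₀ hNk ?_⟩
    have h3 : Algebra.adjoin ℤ {θ} ≤ AlgHom.equalizer χ'.toIntAlgHom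
        (χ.comp (MulSemiringAction.toRingHom Gal(L/ℚ) (𝓞 L) h)).toIntAlgHom := by
      rw [Algebra.adjoin_le_iff, Set.singleton_subset_iff]
      exact h2
    have h4 : χ' (N • x) = χ ((h : Gal(L/ℚ)) • (N • x)) :=
      h3 (hN x IntermediateField.mem_top)
    rwa [smul_comm, map_nsmul, map_nsmul, nsmul_eq_mul, nsmul_eq_mul] at h4

end NumberField.IdealCount

namespace NumberField.IdealCount

open scoped NumberField

variable {L : Type*} [Field L] [NumberField L] [IsGalois ℚ L]
variable {k : Type*} [Field k] [IsAlgClosed k]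

theorem exists_intCast_eq_of_forall_smul_eq {x : 𝓞 L} (hx : ∀ g : Gal(L/ℚ), g • x = x) :
    ∃ n : ℤ, x = n := by
  obtain ⟨q, hq⟩ := (IsGalois.mem_range_algebraMap_iff_fixed (F := ℚ) (x : L)).2
    fun g ↦ congrArg (fun x : 𝓞 L ↦ (x : L)) (hx g)
  have h1 : IsIntegral ℤ q :=
    (isIntegral_algebraMap_iff (algebraMap ℚ L).injective).1 (hq ▸ x.isIntegral_coe)
  obtain ⟨n, rfl⟩ := IsIntegrallyClosed.isIntegral_iff.1 h1
  exact ⟨n, RingOfIntegers.coe_injective (by simp [← hq])⟩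

theorem IsHomTorsor.natCard_hom (h : IsHomTorsor L k) :
    Nat.card (𝓞 L →+* k) = Nat.card Gal(L/ℚ) := by
  obtain ⟨χ, -⟩ := RingHom.exists_comp_algebraMap_eq_of_isIntegral (S := 𝓞 L) (Int.castRingHom k)
  refine (Nat.card_eq_of_bijective
    (fun g : Gal(L/ℚ) ↦ χ.comp (MulSemiringAction.toRingHom _ _ g))
      ⟨fun g g' hg ↦ ?_, fun χ' ↦ ?_⟩).symm
  · have h1 := (h χ).1 (g * g'⁻¹) fun x ↦ by
      have := DFunLike.congr_fun hg (g'⁻¹ • x)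
      simpa [mul_smul] using this
    exact mul_inv_eq_one.1 h1
  · obtain ⟨g, -, hg⟩ := (h χ).2 ⊤ χ' fun x hx ↦ by
      obtain ⟨n, rfl⟩ := exists_intCast_eq_of_forall_smul_eq fun g ↦ hx g trivial
      simp
    exact ⟨g, RingHom.ext fun x ↦ (hg x).symm⟩

theorem IsHomTorsor.finite (h : IsHomTorsor L k) : Finite (𝓞 L →+* k) :=
  Nat.finite_of_card_ne_zero (by rw [h.natCard_hom]; exact Nat.card_pos.ne')

theorem exists_algebraMap_eq_of_forall_fixingSubgroup_smul_eq (F : IntermediateField ℚ L) {x : 𝓞 L}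
    (hx : ∀ g ∈ F.fixingSubgroup, g • x = x) : ∃ y : 𝓞 F, algebraMap (𝓞 F) (𝓞 L) y = x := by
  have h1 : (x : L) ∈ F := by
    rw [← IsGalois.fixedField_fixingSubgroup F]
    exact fun g ↦ congrArg (fun x : 𝓞 L ↦ (x : L)) (hx g g.2)
  exact ⟨⟨⟨x, h1⟩, (isIntegral_algebraMap_iff (algebraMap F L).injective).1 x.isIntegral_coe⟩, rfl⟩

theorem IsHomTorsor.natCard_hom_restrict (h : IsHomTorsor L k) {p : ℕ} [CharP k p] (hp : p.Prime)
    (F : IntermediateField ℚ L) :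
    (Nat.card {χ : 𝓞 L →+* k // ∀ x : 𝓞 F, ∃ n : ℤ, χ (algebraMap _ _ x) = n} : ℝ) =
      Nat.card F.fixingSubgroup * idealCount F p := by
  rw [idealCount_prime F k hp, ← Nat.cast_mul, ← Nat.card_prod, Nat.cast_inj]
  choose χ hχ using RingHom.exists_comp_algebraMap_eq_of_isIntegral (R := 𝓞 F) (S := 𝓞 L) (k := k)
  have hχ (ψ : 𝓞 F →+* k) (x : 𝓞 F) : χ ψ (algebraMap _ _ x) = ψ x := DFunLike.congr_fun (hχ ψ) x
  have hfix (g : F.fixingSubgroup) (x : 𝓞 F) :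
      g.1 • algebraMap (𝓞 F) (𝓞 L) x = algebraMap (𝓞 F) (𝓞 L) x :=
    RingOfIntegers.coe_injective ((F.mem_fixingSubgroup_iff g.1).1 g.2 _ x.1.2)
  have hres (g : F.fixingSubgroup) (ψ : 𝓞 F →+* k) (x : 𝓞 F) :
      (χ ψ).comp (MulSemiringAction.toRingHom _ _ g.1) (algebraMap _ _ x) = ψ x := by
    rw [RingHom.comp_apply, MulSemiringAction.toRingHom_apply, hfix, hχ]
  refine (Nat.card_eq_of_bijective
    (fun gψ : F.fixingSubgroup × {ψ : 𝓞 F →+* k // ∀ x, ∃ n : ℤ, ψ x = n} ↦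
      ⟨(χ gψ.2.1).comp (MulSemiringAction.toRingHom _ _ gψ.1.1), fun x ↦ by
        rw [hres]
        exact gψ.2.2 x⟩) ⟨?_, ?_⟩).symm
  · rintro ⟨g, ψ, hψ⟩ ⟨g', ψ', hψ'⟩ hg
    simp only [Subtype.mk.injEq] at hg
    have h1 : ψ = ψ' := by
      ext x
      rw [← hres g, hg, hres]
    subst h1
    have h1 := (h (χ ψ)).1 (g * g'⁻¹) fun x ↦ by
      have := DFunLike.congr_fun hg ((g'⁻¹ : Gal(L/ℚ)) • x)
      simpa [mul_smul] using this
    rw [Subtype.ext (mul_inv_eq_one.1 h1)]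
  · rintro ⟨χ', hχ'⟩
    obtain ⟨g, hg, hg'⟩ := (h (χ (χ'.comp (algebraMap (𝓞 F) (𝓞 L))))).2 F.fixingSubgroup χ'
      fun x hx ↦ by
        obtain ⟨y, rfl⟩ := exists_algebraMap_eq_of_forall_fixingSubgroup_smul_eq F hx
        rw [hχ, RingHom.comp_apply]
    exact ⟨⟨⟨g, hg⟩, χ'.comp (algebraMap (𝓞 F) (𝓞 L)), hχ'⟩,
      Subtype.ext (RingHom.ext fun x ↦ (hg' x).symm)⟩

end NumberField.IdealCount

namespace NumberField.IdealCount

open Polynomial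
open scoped NumberField

theorem exists_intCast_mul_eq {k : Type*} [Field k] {p : ℕ} [CharP k p] (hp : p.Prime) {N : ℤ}
    (hN : ¬ (p : ℤ) ∣ N) : ∃ u : ℤ, (u * N : k) = 1 := by
  obtain ⟨v, u, h⟩ := (Nat.prime_iff_prime_int.1 hp).coprime_iff_not_dvd.2 hN
  refine ⟨u, ?_⟩
  have := congrArg (Int.cast (R := k)) h
  push_cast at this
  rwa [CharP.cast_eq_zero, mul_zero, zero_add] at this

variable {L : Type*} [Field L] [NumberField L]

theorem forall_exists_intCast_eq_iff {k : Type*} [Field k] {p : ℕ} [CharP k p] (hp : p.Prime)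
    {S : Set (𝓞 L)} {N : ℕ} (hN : ∀ x : 𝓞 L,
      (x : L) ∈ IntermediateField.adjoin ℚ (algebraMap (𝓞 L) L '' S) → N • x ∈ Algebra.adjoin ℤ S)
    (hpN : ¬ p ∣ N) (χ : 𝓞 L →+* k) :
    (∀ b ∈ S, ∃ n : ℤ, χ b = n) ↔
      ∀ x : 𝓞 (IntermediateField.adjoin ℚ (algebraMap (𝓞 L) L '' S)),
        ∃ n : ℤ, χ (algebraMap _ _ x) = n := by
  constructor
  · intro h x
    have h1 : Algebra.adjoin ℤ S ≤ (Subalgebra.comap χ.toIntAlgHom ⊥) := by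
      rw [Algebra.adjoin_le_iff]
      intro b hb
      obtain ⟨n, hn⟩ := h b hb
      exact ⟨n, by simp [hn]⟩
    obtain ⟨m, hm⟩ := h1 (hN (algebraMap _ _ x) x.1.2)
    obtain ⟨u, hu⟩ := exists_intCast_mul_eq (k := k) hp (N := N) (by exact_mod_cast hpN)
    refine ⟨u * m, ?_⟩
    simp only [nsmul_eq_mul, RingHom.coe_coe] at hm
    have hm' : (m : k) = N * χ (algebraMap _ _ x) := by simpa using hm
    push_cast at hu ⊢
    rw [hm', ← mul_assoc, hu, one_mul]
  · intro h b hb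
    have hbF : (b : L) ∈ IntermediateField.adjoin ℚ (algebraMap (𝓞 L) L '' S) :=
      IntermediateField.subset_adjoin _ _ ⟨b, hb, rfl⟩
    exact h ⟨⟨b, hbF⟩, (isIntegral_algebraMap_iff
      (algebraMap (IntermediateField.adjoin ℚ (algebraMap (𝓞 L) L '' S)) L).injective).1
        b.isIntegral_coe⟩

omit [NumberField L] in
theorem exists_dvd_eval_iff {k : Type*} [Field k] {p : ℕ} [CharP k p] (hp : p.Prime) {P : ℤ[X]}
    {Ω : Finset (𝓞 L)} {a c : ℤ} (hpa : ¬ (p : ℤ) ∣ a) (hpc : ¬ (p : ℤ) ∣ c)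
    (hP : ∀ n : ℤ, ((c * P.eval n : ℤ) : 𝓞 L) = ∏ b ∈ Ω, ((a * n : ℤ) - b)) (χ : 𝓞 L →+* k) :
    (∃ m : ℤ, (p : ℤ) ∣ P.eval m) ↔ ∃ b ∈ Ω, ∃ n : ℤ, χ b = n := by
  have key (m : ℤ) : (p : ℤ) ∣ P.eval m ↔ ∃ b ∈ Ω, ((a * m : ℤ) : k) = χ b := by
    have h1 : (p : ℤ) ∣ P.eval m ↔ (p : ℤ) ∣ c * P.eval m :=
      ⟨fun h ↦ h.mul_left c, ((Nat.prime_iff_prime_int.1 hp).dvd_or_dvd · |>.resolve_left hpc)⟩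
    have h2 := congrArg χ (hP m)
    rw [map_intCast, map_prod] at h2
    rw [h1, ← CharP.intCast_eq_zero_iff k, h2, Finset.prod_eq_zero_iff]
    simp only [map_sub, map_intCast, sub_eq_zero]
  constructor
  · rintro ⟨m, hm⟩
    obtain ⟨b, hb, h⟩ := (key m).1 hm
    exact ⟨b, hb, _, h.symm⟩
  · rintro ⟨b, hb, n, hn⟩
    obtain ⟨u, hu⟩ := exists_intCast_mul_eq (k := k) hp hpa
    refine ⟨u * n, (key _).2 ⟨b, hb, ?_⟩⟩
    push_cast
    rw [hn, mul_left_comm, ← mul_assoc, hu, one_mul]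

open scoped Classical in
theorem exists_forall_sum_powerset_eq [IsGalois ℚ L] {P : ℤ[X]} {Ω : Finset (𝓞 L)} {a c : ℤ}
    (ha : a ≠ 0) (hc : c ≠ 0)
    (hP : ∀ n : ℤ, ((c * P.eval n : ℤ) : 𝓞 L) = ∏ b ∈ Ω, ((a * n : ℤ) - b)) :
    ∃ M : ℕ, M ≠ 0 ∧ ∀ p : ℕ, p.Prime → ¬ p ∣ M →
      ∑ S ∈ Ω.powerset, (-1 : ℝ) ^ S.card *
        (Nat.card (IntermediateField.adjoin ℚ (algebraMap (𝓞 L) L '' S)).fixingSubgroup *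
          idealCount (IntermediateField.adjoin ℚ (algebraMap (𝓞 L) L '' S)) p) =
      Nat.card Gal(L/ℚ) * (if ∀ m : ℤ, ¬ (p : ℤ) ∣ P.eval m then 1 else 0) := by
  obtain ⟨M, hM0, hM⟩ := exists_forall_isHomTorsor L
  choose N hN0 hN using fun S : Set (𝓞 L) ↦ exists_forall_smul_mem_adjoin S
  refine ⟨M * (∏ S ∈ Ω.powerset, N S) * (a * c).natAbs, mul_ne_zero (mul_ne_zero hM0
    (Finset.prod_ne_zero_iff.2 fun S _ ↦ hN0 S)) (by simp [ha, hc]), fun p hp hpM ↦ ?_⟩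
  have := Fact.mk hp
  have hpM' : ¬ p ∣ M := fun h ↦ hpM ((h.mul_right _).mul_right _)
  have hpN (S) (hS : S ∈ Ω.powerset) : ¬ p ∣ N S := fun h ↦
    hpM (((h.trans
      (Finset.dvd_prod_of_mem (fun S : Finset (𝓞 L) ↦ N S) hS)).mul_left _).mul_right _)
  have hpac : ¬ (p : ℤ) ∣ a * c := fun h ↦ hpM ((Int.natCast_dvd.1 h).mul_left _)
  let k := AlgebraicClosure (ZMod p)
  have : CharP k p := charP_of_injective_algebraMap (algebraMap (ZMod p) k).injective p
  have htor := hM p hpM' k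
  have := htor.finite
  have h1 := sum_powerset_neg_one_pow_mul_natCard Ω fun (χ : 𝓞 L →+* k) b ↦ ∃ n : ℤ, χ b = n
  have h2 : ∀ S ∈ Ω.powerset,
      (Nat.card {χ : 𝓞 L →+* k // ∀ b ∈ S, ∃ n : ℤ, χ b = n} : ℝ) =
        Nat.card (IntermediateField.adjoin ℚ (algebraMap (𝓞 L) L '' S)).fixingSubgroup *
          idealCount (IntermediateField.adjoin ℚ (algebraMap (𝓞 L) L '' S)) p := fun S hS ↦ by
    rw [← htor.natCard_hom_restrict hp, Nat.cast_inj]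
    exact Nat.card_congr (Equiv.subtypeEquivRight fun χ ↦
      forall_exists_intCast_eq_iff hp (hN S) (hpN S hS) χ)
  rw [Finset.sum_congr rfl fun S hS ↦ congrArg ((-1 : ℝ) ^ S.card * ·) (h2 S hS)] at h1
  rw [h1, ← htor.natCard_hom]
  have h3 (χ : 𝓞 L →+* k) := exists_dvd_eval_iff hp (fun h ↦ hpac (h.mul_right c))
    (fun h ↦ hpac (h.mul_left a)) hP χ
  split_ifs with h
  · rw [mul_one, Nat.cast_inj]
    refine Nat.card_congr (Equiv.subtypeUnivEquiv fun χ b hb hn ↦ ?_)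
    obtain ⟨m, hm⟩ := (h3 χ).2 ⟨b, hb, hn⟩
    exact h m hm
  · push Not at h
    have : IsEmpty {χ : 𝓞 L →+* k // ∀ b ∈ Ω, ¬ ∃ n : ℤ, χ b = n} := ⟨fun χ ↦ by
      obtain ⟨b, hb, hn⟩ := (h3 χ.1).1 h
      exact χ.2 b hb hn⟩
    rw [Nat.card_of_isEmpty, Nat.cast_zero, mul_zero]

end NumberField.IdealCount

namespace NumberField.IdealCount

open Polynomial
open scoped NumberField Nat

section Roots

variable {P : ℤ[X]} (hirr : Irreducible P) (hdeg : 2 ≤ P.natDegree)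
include hirr hdeg

theorem irreducible_map_rat : Irreducible (P.map (algebraMap ℤ ℚ)) :=
  (IsPrimitive.irreducible_iff_irreducible_map_fraction_map
    (hirr.isPrimitive (by omega))).1 hirr

variable (L : Type*) [Field L] [NumberField L] [IsGalois ℚ L]
  [(P.map (algebraMap ℤ ℚ)).IsSplittingField ℚ L]

omit [IsGalois ℚ L] in
theorem natCard_rootSet_eq : Nat.card ((P.map (algebraMap ℤ ℚ)).rootSet L) = P.natDegree := by
  rw [Nat.card_eq_fintype_card, card_rootSet_eq_natDegree
    (irreducible_map_rat hirr hdeg).separable (IsSplittingField.splits L _),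
    natDegree_map_eq_of_injective (algebraMap ℤ ℚ).injective_int]

omit [(P.map (algebraMap ℤ ℚ)).IsSplittingField ℚ L] in
theorem isPretransitive_rootSet :
    MulAction.IsPretransitive Gal(L/ℚ) ((P.map (algebraMap ℤ ℚ)).rootSet L) := by
  have h := irreducible_map_rat hirr hdeg
  refine ⟨fun x y ↦ ?_⟩
  have hx := minpoly.eq_of_irreducible h (mem_rootSet.1 x.2).2
  obtain ⟨σ, hσ⟩ := minpoly.exists_algEquiv_of_root (K := ℚ) (x := (x : L)) (y := (y : L))
    (Algebra.IsAlgebraic.isAlgebraic _) (by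
      rw [← minpoly.eq_of_irreducible h (mem_rootSet.1 y.2).2, hx]
      exact minpoly.aeval ..)
  exact ⟨σ, Subtype.ext hσ⟩

omit [IsGalois ℚ L] in
theorem intCast_eval_eq_prod_rootSet (n : ℤ) : ((P.eval n : ℤ) : L) =
    P.leadingCoeff * ∏ x : (P.map (algebraMap ℤ ℚ)).rootSet L, ((n : L) - x) := by
  classical
  have h1 := (IsSplittingField.splits L (P.map (algebraMap ℤ ℚ))).eval_eq_prod_roots (n : L)
  have h2 : ((P.map (algebraMap ℤ ℚ)).map (algebraMap ℚ L)).roots.Nodup :=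
    nodup_roots (irreducible_map_rat hirr hdeg).separable.map
  have h3 := Finset.prod_subtype (F := rootSetFintype (P.map (algebraMap ℤ ℚ)) L)
    (p := (· ∈ (P.map (algebraMap ℤ ℚ)).rootSet L)) ((P.map (algebraMap ℤ ℚ)).aroots L).toFinset
    (fun x ↦ Iff.rfl) ((n : L) - ·)
  rw [Finset.prod, Multiset.toFinset_val, Multiset.dedup_eq_self.2 h2] at h3
  rw [h3, leadingCoeff_map, leadingCoeff_map_of_injective (algebraMap ℤ ℚ).injective_int,
    map_map, eval_intCast_map] at h1
  simpa using h1

theorem exists_finset_scaled_roots : ∃ Ω : Finset (𝓞 L),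
    (∀ n : ℤ, ((P.leadingCoeff ^ (P.natDegree - 1) * P.eval n : ℤ) : 𝓞 L) =
      ∏ b ∈ Ω, ((P.leadingCoeff * n : ℤ) - b)) ∧
    Nat.card Gal(L/ℚ) ≤ P.natDegree ! ∧
    P.natDegree ≤ Nat.card {g : Gal(L/ℚ) // ∀ b ∈ Ω, g • b ≠ b} + 1 := by
  classical
  let f := P.map (algebraMap ℤ ℚ)
  have hcard := natCard_rootSet_eq hirr hdeg L
  have hP0 : P.leadingCoeff ≠ 0 := leadingCoeff_ne_zero.2 hirr.ne_zero
  have hroot (x : f.rootSet L) : aeval (x : L) P = 0 := by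
    rw [← aeval_map_algebraMap ℚ]
    exact (mem_rootSet.1 x.2).2
  let e (x : f.rootSet L) : 𝓞 L := ⟨P.leadingCoeff • x, isIntegral_leadingCoeff_smul P _ (hroot x)⟩
  have he (x : f.rootSet L) : (e x : L) = P.leadingCoeff * x := by simp [e]
  have he_inj : Function.Injective e := fun x y h ↦ by
    have := congrArg (fun x : 𝓞 L ↦ (x : L)) h
    simp only [he] at this
    exact Subtype.ext (mul_left_cancel₀ (by exact_mod_cast hP0) this)
  have he_smul (g : Gal(L/ℚ)) (x : f.rootSet L) : g • e x = e x ↔ g • x = x := by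
    rw [← he_inj.eq_iff]
    have : g • e x = e (g • x) := RingOfIntegers.ext <| by
      rw [he]
      change g (e x : L) = _ * g x
      rw [he, map_mul, map_intCast]
    rw [this]
  refine ⟨Finset.univ.image e, fun n ↦ ?_, ?_, ?_⟩
  · rw [Finset.prod_image he_inj.injOn]
    refine RingOfIntegers.coe_injective ?_
    rw [map_prod]
    simp_rw [map_sub, map_intCast, he]
    push_cast
    rw [intCast_eval_eq_prod_rootSet hirr hdeg L]
    simp_rw [← mul_sub]
    rw [Finset.prod_mul_distrib, Finset.prod_const, Finset.card_univ, ← Nat.card_eq_fintype_card,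
      hcard, ← mul_assoc, ← pow_succ, Nat.sub_add_cancel (by omega)]
  · rw [← hcard]
    have : FaithfulSMul Gal(L/ℚ) (f.rootSet L) := ⟨fun {σ τ} h ↦
      AlgEquiv.coe_toAlgHom_injective <| AlgHom.ext_of_adjoin_eq_top
        (IsSplittingField.adjoin_rootSet L f) fun x hx ↦ congrArg Subtype.val (h ⟨x, hx⟩)⟩
    exact natCard_le_factorial_of_faithfulSMul
  · rw [← hcard]
    have := isPretransitive_rootSet hirr hdeg L
    refine (card_le_natCard_derangements_add_one (G := Gal(L/ℚ)) (by omega)).trans_eq ?_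
    congr 1
    exact Nat.card_congr (Equiv.subtypeEquivRight fun g ↦ by
      rw [Finset.forall_mem_image]
      simp only [Finset.mem_univ, forall_const, ne_eq, he_smul, f])

end Roots

end NumberField.IdealCount

namespace NumberField.IdealCount

open Finset
open scoped NumberField

theorem one_le_four_mul_div_log_sq {z : ℕ} (hz : 2 ≤ z) : 1 ≤ 4 * z / Real.log z ^ 2 := by
  have hz' : (0 : ℝ) ≤ z := by positivity
  have h1 : 0 < Real.log z := Real.log_pos (by exact_mod_cast hz)
  have h2 : Real.log z ≤ 2 * √z := by
    have := Real.log_le_rpow_div hz' (ε := 1 / 2) (by norm_num)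
    rw [← Real.sqrt_eq_rpow] at this
    linarith
  rw [one_le_div (by positivity)]
  nlinarith [Real.sq_sqrt hz', Real.sqrt_nonneg (z : ℝ)]

theorem card_primes_Ioc (z : ℕ) :
    (#{p ∈ Ioc z (2 * z) | p.Prime} : ℝ) = Nat.primeCounting (2 * z) - Nat.primeCounting z := by
  have h (n : ℕ) : Nat.primeCounting n = #{p ∈ Icc 1 n | p.Prime} := by
    rw [Nat.primeCounting, Nat.primeCounting', Nat.count_eq_card_filter_range]
    congr 1
    ext p
    simp only [mem_filter, mem_range, mem_Icc]
    exact ⟨fun ⟨h1, h2⟩ ↦ ⟨⟨h2.one_le, by omega⟩, h2⟩, fun ⟨h1, h2⟩ ↦ ⟨by omega, h2⟩⟩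
  rw [eq_sub_iff_add_eq', h, h, ← Nat.cast_add, ← card_union_of_disjoint, ← filter_union]
  · congr 3
    ext p
    simp only [mem_union, mem_Icc, mem_Ioc]
    omega
  · refine disjoint_filter_filter (disjoint_left.2 fun p ↦ ?_)
    simp only [mem_Icc, mem_Ioc]
    omega

theorem exists_abs_sum_sub_le {ι : Type*} {s : Finset ι} {w : ι → ℝ} {f : ι → ℕ → ℝ} {g : ℕ → ℝ}
    {M : ℕ} {B : ℝ} (hM : M ≠ 0) (hB : ∀ p, |g p| ≤ B)
    (hf : ∀ i, ∃ C, 0 ≤ C ∧ ∀ z : ℕ, 2 ≤ z →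
      |∑ p ∈ Ioc z (2 * z) with p.Prime, (f i p - 1)| ≤ C * z / Real.log z ^ 2)
    (hg : ∀ p : ℕ, p.Prime → ¬ p ∣ M → ∑ i ∈ s, w i * f i p = g p) :
    ∃ C, ∀ z : ℕ, 2 ≤ z → |∑ p ∈ Icc z (2 * z) with p.Prime, g p -
      (∑ i ∈ s, w i) * (Nat.primeCounting (2 * z) - Nat.primeCounting z)| ≤
        C * z / Real.log z ^ 2 := by
  choose C hC0 hC using hf
  set E := ∑ p ∈ M.primeFactors, |g p - ∑ i ∈ s, w i * f i p|
  refine ⟨∑ i ∈ s, |w i| * C i + 4 * (B + E), fun z hz ↦ ?_⟩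
  have h1 : |∑ p ∈ Icc z (2 * z) with p.Prime, g p -
      ∑ p ∈ Ioc z (2 * z) with p.Prime, g p| ≤ B := by
    rw [← Ioc_insert_left (by omega), filter_insert]
    split_ifs
    · rw [sum_insert (by simp), add_sub_cancel_right]
      exact hB z
    · simpa using (abs_nonneg _).trans (hB z)
  have h2 : |∑ p ∈ Ioc z (2 * z) with p.Prime, (g p - ∑ i ∈ s, w i * f i p)| ≤ E := by
    refine (abs_sum_le_sum_abs _ _).trans ?_
    rw [← sum_filter_add_sum_filter_not _ (· ∣ M), sum_eq_zero (s := filter (¬ · ∣ M) _), add_zero]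
    · refine sum_le_sum_of_subset_of_nonneg (fun p ↦ ?_) fun _ _ _ ↦ abs_nonneg _
      simp only [mem_filter, Nat.mem_primeFactors]
      tauto
    · intro p hp
      simp only [mem_filter] at hp
      rw [hg p hp.1.2 hp.2, sub_self, abs_zero]
  have h3 : ∑ p ∈ Ioc z (2 * z) with p.Prime, ∑ i ∈ s, w i * f i p -
      (∑ i ∈ s, w i) * (Nat.primeCounting (2 * z) - Nat.primeCounting z) =
      ∑ i ∈ s, w i * ∑ p ∈ Ioc z (2 * z) with p.Prime, (f i p - 1) := by
    rw [← card_primes_Ioc, sum_comm, sum_mul, ← sum_sub_distrib]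
    refine sum_congr rfl fun i _ ↦ ?_
    rw [sum_sub_distrib, sum_const, nsmul_one, mul_sub, mul_sum]
  have h4 : |∑ i ∈ s, w i * ∑ p ∈ Ioc z (2 * z) with p.Prime, (f i p - 1)| ≤
      ∑ i ∈ s, |w i| * (C i * z / Real.log z ^ 2) := by
    refine (abs_sum_le_sum_abs _ _).trans (sum_le_sum fun i _ ↦ ?_)
    rw [abs_mul]
    exact mul_le_mul_of_nonneg_left (hC i z hz) (abs_nonneg _)
  have h5 : ∑ i ∈ s, |w i| * (C i * z / Real.log z ^ 2) =
      (∑ i ∈ s, |w i| * C i) * z / Real.log z ^ 2 := by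
    simp_rw [sum_mul, sum_div, mul_assoc, mul_div_assoc]
  rw [sum_sub_distrib] at h2
  rw [← h3, h5] at h4
  have hBE : 0 ≤ B + E := add_nonneg ((abs_nonneg _).trans (hB 0))
    (sum_nonneg fun _ _ ↦ abs_nonneg _)
  have h6 := mul_le_mul_of_nonneg_left (one_le_four_mul_div_log_sq hz) hBE
  rw [show (∑ i ∈ s, |w i| * C i + 4 * (B + E)) * z / Real.log z ^ 2 =
    (∑ i ∈ s, |w i| * C i) * z / Real.log z ^ 2 + (B + E) * (4 * z / Real.log z ^ 2) by ring]
  rw [abs_le] at *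
  constructor <;> linarith

theorem natCard_fixingSubgroup_adjoin {K L : Type*} [Field K] [Field L] [Algebra K L] (S : Set L) :
    Nat.card (IntermediateField.adjoin K S).fixingSubgroup =
      Nat.card {g : Gal(L/K) // ∀ x ∈ S, g x = x} := by
  refine Nat.card_congr (Equiv.subtypeEquivRight fun g ↦ ?_)
  rw [IntermediateField.mem_fixingSubgroup_iff]
  refine ⟨fun h x hx ↦ h x (IntermediateField.subset_adjoin K S hx), fun h x hx ↦ ?_⟩
  induction hx using IntermediateField.adjoin_induction with
  | mem x hx => exact h x hx
  | algebraMap x => exact g.commutes x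
  | add x y _ _ hx hy => rw [map_add, hx, hy]
  | inv x _ hx => rw [map_inv₀, hx]
  | mul x y _ _ hx hy => rw [map_mul, hx, hy]

open scoped Nat Classical in
theorem exists_abs_card_primes_without_root_sub_le {P : Polynomial ℤ} (hirr : Irreducible P)
    (hdeg : 2 ≤ P.natDegree) : ∃ G d : ℕ, 0 < G ∧ G ≤ P.natDegree ! ∧ P.natDegree ≤ d + 1 ∧
      ∃ C : ℝ, ∀ z : ℕ, 2 ≤ z →
        |(#((Icc z (2 * z)).filter fun p : ℕ ↦ p.Prime ∧ ∀ m : ℤ, ¬ (p : ℤ) ∣ P.eval m) : ℝ) -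
          d / G * (Nat.primeCounting (2 * z) - Nat.primeCounting z)| ≤
          C * z / Real.log z ^ 2 := by
  let L := (P.map (algebraMap ℤ ℚ)).SplittingField
  have : NumberField L := ⟨⟩
  have : (P.map (algebraMap ℤ ℚ)).IsSplittingField ℚ L :=
    Polynomial.IsSplittingField.splittingField _
  have : IsGalois ℚ L :=
    .of_separable_splitting_field (irreducible_map_rat hirr hdeg).separable
  obtain ⟨Ω, hΩ, hG, hd⟩ := exists_finset_scaled_roots hirr hdeg L
  have hP0 : P.leadingCoeff ≠ 0 := Polynomial.leadingCoeff_ne_zero.2 hirr.ne_zero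
  obtain ⟨M, hM0, hM⟩ := exists_forall_sum_powerset_eq hP0 (pow_ne_zero _ hP0) hΩ
  refine ⟨_, _, Nat.card_pos, hG, hd, ?_⟩
  have h1 := sum_powerset_neg_one_pow_mul_natCard Ω fun (g : Gal(L/ℚ)) b ↦ g • b = b
  have h2 (S : Finset (𝓞 L)) :
      Nat.card (IntermediateField.adjoin ℚ (algebraMap (𝓞 L) L '' S)).fixingSubgroup =
        Nat.card {g : Gal(L/ℚ) // ∀ b ∈ S, g • b = b} := by
    rw [natCard_fixingSubgroup_adjoin]
    refine Nat.card_congr (Equiv.subtypeEquivRight fun g ↦ ?_)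
    rw [Set.forall_mem_image]
    exact forall₂_congr fun b _ ↦ RingOfIntegers.coe_injective.eq_iff (a := g • b)
  simp_rw [← h2] at h1
  obtain ⟨C, hC⟩ := exists_abs_sum_sub_le hM0 (s := Ω.powerset)
    (w := fun S ↦ (-1 : ℝ) ^ S.card *
      Nat.card (IntermediateField.adjoin ℚ (algebraMap (𝓞 L) L '' S)).fixingSubgroup)
    (g := fun p ↦ Nat.card Gal(L/ℚ) * if ∀ m : ℤ, ¬ (p : ℤ) ∣ P.eval m then 1 else 0)
    (B := Nat.card Gal(L/ℚ))
    (fun p ↦ by split_ifs <;> simp)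
    (fun S ↦ exists_abs_sum_prime_sub_one_le
      (IntermediateField.adjoin ℚ (algebraMap (𝓞 L) L '' S)))
    (fun p hp hpM ↦ by simp_rw [mul_assoc]; exact hM p hp hpM)
  have hG0 : (0 : ℝ) < Nat.card Gal(L/ℚ) := by exact_mod_cast Nat.card_pos
  refine ⟨C / Nat.card Gal(L/ℚ), fun z hz ↦ ?_⟩
  have h3 := hC z hz
  rw [h1, ← mul_sum, sum_boole, filter_filter] at h3
  rw [div_mul_eq_mul_div, div_mul_eq_mul_div, div_right_comm, le_div_iff₀ hG0,
    ← abs_of_pos hG0, ← abs_mul, abs_of_pos hG0, sub_mul, div_mul_cancel₀ _ hG0.ne']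
  rwa [mul_comm (Nat.card _ : ℝ)] at h3

end NumberField.IdealCount

open Polynomial Finset
open scoped Classical

/-- **Lemma (consequence of the Chebotarev density theorem).**
Let `P ∈ ℤ[x]` be irreducible of degree `D ≥ 2` and, for `z ≥ 2`, let `L_z` be
the set of primes `l ∈ [z, 2z]` such that `P` has no root modulo `l`. Then
there is a positive rational `κ ≤ D!/(D−1)` (depending only on `P`) with
`#L_z = (1/κ)(π(2z) − π(z)) + O(z (log z)^{-2})`. -/
theorem stmt10 (P : Polynomial ℤ) (hirr : Irreducible P) (D : ℕ)
    (hD : P.natDegree = D) (hD2 : 2 ≤ D) :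
    ∃ κ : ℚ, 0 < κ ∧ κ ≤ (Nat.factorial D : ℚ) / ((D : ℚ) - 1) ∧
      ∃ C : ℝ, ∀ z : ℕ, 2 ≤ z →
        |((((Finset.Icc z (2 * z)).filter
              (fun l : ℕ => l.Prime ∧ ∀ m : ℤ, ¬ ((l : ℤ) ∣ P.eval m))).card : ℝ)
          - (1 / (κ : ℝ)) * ((Nat.primeCounting (2 * z) : ℝ) - (Nat.primeCounting z : ℝ)))| ≤
          C * (z : ℝ) / (Real.log z) ^ 2 := by
  subst hD
  obtain ⟨G, d, hG0, hG, hd, C, hC⟩ :=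
    NumberField.IdealCount.exists_abs_card_primes_without_root_sub_le hirr hD2
  have hd0 : (0 : ℚ) < d := by exact_mod_cast (by omega : 0 < d)
  have hD0 : (0 : ℚ) < P.natDegree - 1 := by
    rw [sub_pos]
    exact_mod_cast hD2
  refine ⟨G / d, div_pos (by exact_mod_cast hG0) hd0, ?_, C, fun z hz ↦ ?_⟩
  · have h1 : (P.natDegree : ℚ) - 1 ≤ d := by
      rw [sub_le_iff_le_add]
      exact_mod_cast hd
    have h2 : (G : ℚ) ≤ P.natDegree.factorial := by exact_mod_cast hG
    gcongr
  · rw [Rat.cast_div, Rat.cast_natCast, Rat.cast_natCast, one_div_div]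
    exact hC z hz
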